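/- arXiv:2601.21642 — 2 statements merged into one kernel-verified Lean document; each statement's English description precedes it below -/
import Mathlib

section
/- Let b > 1 be an integer. There exist α > 0, η > 0 and C > 0 such that for every sufficiently large prime q and all integers 1 ≤ l1, l2 ≤ q^α one has |(q−1)^{-1} · Σ_{χ} χ(l1) χ(l2)^b L(χ^{-1}, 1/2) L(χ^b, 1/2) − ζ((b+1)/2) · (l1 · l2^b)^{-1/2}| ≤ C·q^{-η}, where the sum runs over all nontrivial Dirichlet characters χ modulo q and ζ denotes the Riemann zeta function. -/
open scoped Real Classical

open Finset in
/-- Van der Corput's inequality. -/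
lemma van_der_corput (a : ℕ → ℂ) (ha : ∀ n, ‖a n‖ ≤ 1) {M H Y : ℕ} (hMY : M ≤ Y) (hHY : H ≤ Y) :
    (H : ℝ) * ‖∑ n ∈ range M, a n‖ ^ 2 ≤ 2 * Y * (Y + 2 * ∑ h ∈ Ico 1 H,
      ‖∑ n ∈ range (M - h), a (n + h) * (starRingEnd ℂ) (a n)‖) := by
  rcases Nat.eq_zero_or_pos H with rfl | hH
  · simp only [Nat.cast_zero, zero_mul]; positivity
  set S := ∑ n ∈ range M, a n with hS
  set T : ℕ → ℝ := fun h ↦ ‖∑ n ∈ range (M - h), a (n + h) * (starRingEnd ℂ) (a n)‖ with hT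
  let g : ℕ → ℕ → ℂ := fun r m ↦ if m ∈ Ico r (M + r) then a (m - r) else 0
  have hg : ∀ r ∈ range H, ∑ m ∈ range (M + H), g r m = S := by
    intro r hr
    have hr := mem_range.1 hr
    rw [← sum_filter]
    have : (range (M + H)).filter (fun m ↦ m ∈ Ico r (M + r)) = Ico r (M + r) := by
      ext m; simp only [mem_filter, mem_range, mem_Ico]; omega
    rw [this, sum_Ico_eq_sum_range, Nat.add_sub_cancel, hS]
    exact sum_congr rfl fun i _ ↦ by rw [Nat.add_sub_cancel_left]
  have hG : ∀ r s, r ≤ s → s < H →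
      ‖∑ m ∈ range (M + H), g r m * (starRingEnd ℂ) (g s m)‖ = T (s - r) := by
    intro r s hrs hs
    have h1 : ∀ m, g r m * (starRingEnd ℂ) (g s m) =
        if m ∈ Ico s (M + r) then a (m - r) * (starRingEnd ℂ) (a (m - s)) else 0 := by
      intro m
      simp only [g, mem_Ico]
      split_ifs <;> first | rfl | omega | simp
    simp_rw [h1]
    rw [← sum_filter]
    have : (range (M + H)).filter (fun m ↦ m ∈ Ico s (M + r)) = Ico s (M + r) := by
      ext m; simp only [mem_filter, mem_range, mem_Ico]; omega
    rw [this, sum_Ico_eq_sum_range, hT]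
    have e : M + r - s = M - (s - r) := by omega
    simp only [e]
    congr 1
    refine sum_congr rfl fun i _ ↦ ?_
    congr 2
    · omega
    · congr 1; omega
  have hG' : ∀ r s, s ≤ r → r < H →
      ‖∑ m ∈ range (M + H), g r m * (starRingEnd ℂ) (g s m)‖ = T (r - s) := by
    intro r s hrs hs
    rw [← hG s r hrs hs, ← Complex.norm_conj, map_sum]
    congr 1
    exact sum_congr rfl fun i _ ↦ by simp [mul_comm]
  have hT0 : T 0 ≤ Y := by
    simp only [hT, Nat.sub_zero, Nat.add_zero]
    calc _ ≤ ∑ n ∈ range M, (1 : ℝ) := norm_sum_le_of_le _ fun n _ ↦ by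
          rw [norm_mul, Complex.norm_conj]
          exact mul_le_one₀ (ha n) (norm_nonneg _) (ha n)
      _ ≤ Y := by simpa using hMY
  have hTnn : ∀ h, 0 ≤ T h := fun h ↦ norm_nonneg _
  have hrow : ∀ r ∈ range H, ∑ s ∈ range H,
      ‖∑ m ∈ range (M + H), g r m * (starRingEnd ℂ) (g s m)‖ ≤ Y + 2 * ∑ h ∈ Ico 1 H, T h := by
    intro r hr
    have hr := mem_range.1 hr
    rw [← sum_range_add_sum_Ico _ hr.le, sum_eq_sum_Ico_succ_bot hr]
    rw [hG r r le_rfl hr, Nat.sub_self]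
    have h1 : ∑ s ∈ range r, ‖∑ m ∈ range (M + H), g r m * (starRingEnd ℂ) (g s m)‖ ≤
        ∑ h ∈ Ico 1 H, T h := by
      calc _ = ∑ s ∈ range r, T (r - s) :=
            sum_congr rfl fun s hs ↦ hG' r s (mem_range.1 hs).le hr
        _ = ∑ h ∈ (range r).image (fun s ↦ r - s), T h := by
            rw [sum_image]
            intro x hx y hy hxy
            have := mem_range.1 hx; have := mem_range.1 hy
            simp only at hxy; omega
        _ ≤ _ := sum_le_sum_of_subset_of_nonneg (by
            intro x hx
            obtain ⟨s, hs, rfl⟩ := mem_image.1 hx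
            have := mem_range.1 hs
            simp only [mem_Ico]; omega) fun _ _ _ ↦ hTnn _
    have h2 : ∑ s ∈ Ico (r + 1) H, ‖∑ m ∈ range (M + H), g r m * (starRingEnd ℂ) (g s m)‖ ≤
        ∑ h ∈ Ico 1 H, T h := by
      calc _ = ∑ s ∈ Ico (r + 1) H, T (s - r) :=
            sum_congr rfl fun s hs ↦ hG r s (by have := mem_Ico.1 hs; omega) (mem_Ico.1 hs).2
        _ = ∑ h ∈ (Ico (r + 1) H).image (fun s ↦ s - r), T h := by
            rw [sum_image]
            intro x hx y hy hxy
            have := mem_Ico.1 hx; have := mem_Ico.1 hy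
            simp only at hxy; omega
        _ ≤ _ := sum_le_sum_of_subset_of_nonneg (by
            intro x hx
            obtain ⟨s, hs, rfl⟩ := mem_image.1 hx
            have := mem_Ico.1 hs
            simp only [mem_Ico]; omega) fun _ _ _ ↦ hTnn _
    linarith
  have hHS : (H : ℂ) * S = ∑ m ∈ range (M + H), ∑ r ∈ range H, g r m := by
    rw [sum_comm, sum_congr rfl hg]; simp
  have hsq : ((H : ℝ) * ‖S‖) ^ 2 ≤
      (M + H) * ∑ m ∈ range (M + H), ‖∑ r ∈ range H, g r m‖ ^ 2 := by
    have h1 : (H : ℝ) * ‖S‖ ≤ ∑ m ∈ range (M + H), ‖∑ r ∈ range H, g r m‖ := by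
      calc (H : ℝ) * ‖S‖ = ‖(H : ℂ) * S‖ := by simp
        _ ≤ _ := by rw [hHS]; exact norm_sum_le _ _
    calc _ ≤ (∑ m ∈ range (M + H), ‖∑ r ∈ range H, g r m‖) ^ 2 := by gcongr
      _ ≤ _ := by
        have := sq_sum_le_card_mul_sum_sq (s := range (M + H))
          (f := fun m ↦ ‖∑ r ∈ range H, g r m‖)
        simpa using this
  have hexp : ∑ m ∈ range (M + H), ‖∑ r ∈ range H, g r m‖ ^ 2 ≤
      ∑ r ∈ range H, ∑ s ∈ range H,
        ‖∑ m ∈ range (M + H), g r m * (starRingEnd ℂ) (g s m)‖ := by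
    have h1 : ((∑ m ∈ range (M + H), ‖∑ r ∈ range H, g r m‖ ^ 2 : ℝ) : ℂ) =
        ∑ r ∈ range H, ∑ s ∈ range H, ∑ m ∈ range (M + H), g r m * (starRingEnd ℂ) (g s m) := by
      push_cast
      simp_rw [← Complex.mul_conj', map_sum, sum_mul_sum]
      rw [sum_comm]
      exact sum_congr rfl fun r _ ↦ sum_comm
    have h2 : (∑ m ∈ range (M + H), ‖∑ r ∈ range H, g r m‖ ^ 2 : ℝ) =
        ‖((∑ m ∈ range (M + H), ‖∑ r ∈ range H, g r m‖ ^ 2 : ℝ) : ℂ)‖ := by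
      rw [Complex.norm_real, Real.norm_of_nonneg (by positivity)]
    rw [h2, h1]
    refine (norm_sum_le _ _).trans (sum_le_sum fun r _ ↦ norm_sum_le _ _)
  have hfin : ∑ r ∈ range H, ∑ s ∈ range H,
        ‖∑ m ∈ range (M + H), g r m * (starRingEnd ℂ) (g s m)‖ ≤
        H * (Y + 2 * ∑ h ∈ Ico 1 H, T h) := by
    refine (sum_le_sum hrow).trans ?_
    simp [mul_add]
  have hH' : (0 : ℝ) < H := by exact_mod_cast hH
  have hMH : (M : ℝ) + H ≤ 2 * Y := by exact_mod_cast (by omega : M + H ≤ 2 * Y)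
  have hB : 0 ≤ (Y : ℝ) + 2 * ∑ h ∈ Ico 1 H, T h :=
    add_nonneg (Nat.cast_nonneg _) (mul_nonneg zero_le_two (sum_nonneg fun _ _ ↦ hTnn _))
  have key : (H : ℝ) * (H * ‖S‖ ^ 2) ≤ H * (2 * Y * (Y + 2 * ∑ h ∈ Ico 1 H, T h)) := by
    calc (H : ℝ) * (H * ‖S‖ ^ 2) = (H * ‖S‖) ^ 2 := by ring
      _ ≤ (M + H) * (H * (Y + 2 * ∑ h ∈ Ico 1 H, T h)) :=
        hsq.trans (by gcongr; exact hexp.trans hfin)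
      _ ≤ (2 * Y) * (H * (Y + 2 * ∑ h ∈ Ico 1 H, T h)) := by gcongr
      _ = _ := by ring
  exact le_of_mul_le_mul_left key hH'

/-- The additive character `x ↦ exp (2πix)`. -/
noncomputable def expPhase (x : ℝ) : ℂ := Complex.exp (Complex.I * ((2 * π * x : ℝ) : ℂ))

lemma norm_expPhase (x : ℝ) : ‖expPhase x‖ = 1 := by
  rw [expPhase, mul_comm, Complex.norm_exp_ofReal_mul_I]

lemma expPhase_add (x y : ℝ) : expPhase (x + y) = expPhase x * expPhase y := by
  rw [expPhase, expPhase, expPhase, ← Complex.exp_add]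
  congr 1; push_cast; ring

lemma conj_expPhase (x : ℝ) : (starRingEnd ℂ) (expPhase x) = expPhase (-x) := by
  rw [expPhase, expPhase, ← Complex.exp_conj, map_mul, Complex.conj_I, Complex.conj_ofReal]
  congr 1; push_cast; ring

lemma expPhase_mul_conj (x y : ℝ) :
    expPhase x * (starRingEnd ℂ) (expPhase y) = expPhase (x - y) := by
  rw [conj_expPhase, ← expPhase_add, sub_eq_add_neg]

lemma norm_sum_expPhase_linear_le {l : ℝ} (m : ℝ) (hl : 0 < l) (hl' : l ≤ 1 / 2) (M : ℕ) :
    ‖∑ n ∈ Finset.range M, expPhase (l * n + m)‖ ≤ 1 / (2 * l) := by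
  have h1 : ∀ n : ℕ, expPhase (l * n + m) = expPhase l ^ n * expPhase m := by
    intro n
    rw [expPhase_add]
    congr 1
    rw [expPhase, expPhase, ← Complex.exp_nat_mul]
    congr 1; push_cast; ring
  simp_rw [h1]
  rw [← Finset.sum_mul, norm_mul, norm_expPhase, mul_one]
  have hlow : 4 * l ≤ ‖expPhase l - 1‖ := by
    rw [expPhase, Complex.norm_exp_I_mul_ofReal_sub_one, norm_mul, Real.norm_ofNat]
    have h2 : 2 * π * l / 2 = π * l := by ring
    have h3 := Real.mul_le_sin (x := π * l) (by positivity) (by nlinarith [Real.pi_pos])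
    rw [h2, Real.norm_eq_abs]
    have h4 : 2 / π * (π * l) = 2 * l := by field_simp
    have := le_abs_self (Real.sin (π * l))
    linarith
  have hne : expPhase l ≠ 1 := by
    intro h; rw [h] at hlow; simp at hlow; linarith
  rw [geom_sum_eq hne, norm_div, div_le_div_iff₀ (by linarith) (by linarith)]
  have h5 : ‖expPhase l ^ M - 1‖ ≤ 2 := by
    refine (norm_sub_le _ _).trans ?_
    rw [norm_pow, norm_expPhase]; norm_num
  nlinarith

open Polynomial in
lemma natDegree_taylor_sub_le {f : ℝ[X]} {d : ℕ} (hf : f.natDegree ≤ d + 1) (h : ℝ) :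
    (taylor h f - f).natDegree ≤ d ∧
      (taylor h f - f).coeff d = (d + 1) * f.coeff (d + 1) * h := by
  have hc : ∀ n, d < n → (taylor h f).coeff n = f.coeff n := by
    intro n hn
    have : (hasseDeriv n f).natDegree = 0 := by
      have := natDegree_hasseDeriv_le f n
      omega
    rw [taylor_coeff, eq_C_of_natDegree_eq_zero this, eval_C, hasseDeriv_coeff]
    simp
  constructor
  · rw [natDegree_le_iff_coeff_eq_zero]
    intro n hn
    rw [coeff_sub, hc n (by omega), sub_self]
  · have h1 : (hasseDeriv d f).natDegree ≤ 1 := by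
      have := natDegree_hasseDeriv_le f d
      omega
    rw [coeff_sub, taylor_coeff, eval_eq_sum_range' (n := 2) (by omega)]
    simp [Finset.sum_range_succ, hasseDeriv_coeff, Nat.choose_succ_self_right, add_comm 1 d]

open Polynomial Finset in
/-- Weyl's inequality with shifts so short that no reduction modulo one takes place. -/
lemma weyl_inequality (d : ℕ) : ∃ C : ℝ, 0 < C ∧ ∀ (f : ℝ[X]) (H Y M : ℕ) (L : ℝ),
    f.natDegree ≤ d + 1 → 0 < f.coeff (d + 1) →
    ((d + 1).factorial : ℝ) * f.coeff (d + 1) * (H : ℝ) ^ d ≤ 1 / 2 →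
    1 ≤ H → H ≤ Y → M ≤ Y → ∑ h ∈ Ico 1 H, (1 / h : ℝ) ≤ L → 1 ≤ L →
    (‖∑ n ∈ range M, expPhase (f.eval (n : ℝ))‖ / Y) ^ (2 ^ d) ≤
      C * (1 / H + L ^ d / (f.coeff (d + 1) * (H : ℝ) ^ (d + 1))) := by
  induction d with
  | zero =>
    refine ⟨1, one_pos, ?_⟩
    intro f H Y M L hdeg hpos hsmall hH hHY hMY hL hL1
    have hf : ∀ n : ℕ, f.eval (n : ℝ) = f.coeff 1 * n + f.coeff 0 := by
      intro n
      rw [eval_eq_sum_range' (n := 2) (by omega)]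
      simp [sum_range_succ]; ring
    simp only [zero_add, pow_zero, pow_one, one_mul, mul_one, Nat.factorial_one,
      Nat.cast_one] at *
    simp_rw [hf]
    have h1 := norm_sum_expPhase_linear_le (f.coeff 0) hpos hsmall M
    have hH' : (0 : ℝ) < H := by exact_mod_cast hH
    have hY' : (H : ℝ) ≤ Y := by exact_mod_cast hHY
    have hY0 : (0 : ℝ) < Y := by linarith
    calc _ ≤ 1 / (2 * f.coeff 1) / H := by gcongr
      _ ≤ 1 / (f.coeff 1) / H := by gcongr; linarith
      _ = 1 / (f.coeff 1 * H) := by rw [div_div]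
      _ ≤ _ := by have : 0 ≤ 1 / (H : ℝ) := by positivity
                  linarith
  | succ d ih =>
    obtain ⟨C, hC, ih⟩ := ih
    refine ⟨4 ^ (2 ^ d) * (1 + C), by positivity, ?_⟩
    intro f H Y M L hdeg hpos hsmall hH hHY hMY hL hL1
    set l := f.coeff (d + 1 + 1) with hl
    have hH' : (0 : ℝ) < H := by exact_mod_cast hH
    have hY' : (H : ℝ) ≤ Y := by exact_mod_cast hHY
    have hY0 : (0 : ℝ) < Y := by linarith
    set a : ℕ → ℂ := fun n ↦ expPhase (f.eval (n : ℝ)) with ha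
    have hv := van_der_corput a (fun n ↦ (norm_expPhase _).le) hMY hHY
    set T : ℕ → ℝ := fun h ↦ ‖∑ n ∈ range (M - h), a (n + h) * (starRingEnd ℂ) (a n)‖ with hT
    have hTb : ∀ h ∈ Ico 1 H, (T h / Y) ^ (2 ^ d) ≤
        C * (1 / H + L ^ d / (l * (H : ℝ) ^ (d + 1)) * (1 / h)) := by
      intro h hh
      obtain ⟨h1, h2⟩ := mem_Ico.1 hh
      have h1' : (1 : ℝ) ≤ h := by exact_mod_cast h1
      have h2' : (h : ℝ) ≤ H := by exact_mod_cast h2.le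
      obtain ⟨hd1, hd2⟩ := natDegree_taylor_sub_le hdeg (h : ℝ)
      have hle : l * h ≤ (((d + 1 : ℕ) : ℝ) + 1) * l * h := by
        have : 0 ≤ ((d + 1 : ℕ) : ℝ) * (l * h) := by positivity
        linarith
      have := ih (taylor (h : ℝ) f - f) H Y (M - h) L hd1 (by rw [hd2]; positivity) (by
        rw [hd2]
        refine le_trans ?_ hsmall
        rw [Nat.factorial_succ (d + 1), pow_succ]
        push_cast
        calc _ ≤ ((d + 1).factorial : ℝ) * ((d + 1 + 1) * l * H) * H ^ d := by gcongr
          _ = _ := by ring) hH hHY (by omega) hL hL1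
      have e : T h = ‖∑ n ∈ range (M - h), expPhase ((taylor (h : ℝ) f - f).eval (n : ℝ))‖ := by
        simp only [hT, ha]
        congr 1
        refine sum_congr rfl fun n _ ↦ ?_
        rw [expPhase_mul_conj, eval_sub, taylor_eval]
        push_cast
        rfl
      rw [e]
      refine this.trans ?_
      rw [hd2]
      have e2 : L ^ d / (l * (H : ℝ) ^ (d + 1)) * (1 / h) = L ^ d / (l * h * H ^ (d + 1)) := by
        field_simp
      rw [e2]
      gcongr
    set t : ℕ → ℝ := fun h ↦ if h = 0 then 1 else T h / Y with ht
    have ht0 : ∀ h, 0 ≤ t h := by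
      intro h; simp only [ht]; split_ifs
      · exact zero_le_one
      · positivity
    have htsum : ∀ F : ℝ → ℝ, ∑ h ∈ range H, F (t h) = F 1 + ∑ h ∈ Ico 1 H, F (T h / Y) := by
      intro F
      rw [range_eq_Ico, sum_eq_sum_Ico_succ_bot hH]
      congr 1
      refine sum_congr rfl fun h hh ↦ ?_
      have := (mem_Ico.1 hh).1
      simp only [ht]; rw [if_neg (by omega)]
    set x := ‖∑ n ∈ range M, a n‖ / Y with hx
    have hx2 : x ^ 2 ≤ 4 * ((∑ h ∈ range H, t h) / H) := by
      have := htsum (fun y ↦ y)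
      rw [this, ← sum_div, hx, div_pow, ← mul_div_assoc, div_le_div_iff₀ (by positivity) hH']
      have h0 : 0 ≤ ∑ h ∈ Ico 1 H, T h := sum_nonneg fun _ _ ↦ norm_nonneg _
      calc _ = (H : ℝ) * ‖∑ n ∈ range M, a n‖ ^ 2 := by ring
        _ ≤ _ := hv
        _ ≤ 4 * Y * (Y + ∑ h ∈ Ico 1 H, T h) := by nlinarith
        _ = _ := by field_simp
    have hpm : ((∑ h ∈ range H, t h) / H) ^ (2 ^ d) ≤ (∑ h ∈ range H, t h ^ (2 ^ d)) / H := by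
      obtain ⟨k, hk⟩ : ∃ k, 2 ^ d = k + 1 := ⟨2 ^ d - 1, by have := Nat.one_le_two_pow (n := d); omega⟩
      have := pow_sum_div_card_le_sum_pow (s := range H) (f := t) (fun h _ ↦ ht0 h) k
      rw [card_range] at this
      rw [hk, div_pow, pow_succ (H : ℝ), ← div_div]
      gcongr
    have hsumt : ∑ h ∈ range H, t h ^ (2 ^ d) ≤
        1 + C * (1 + L ^ (d + 1) / (l * (H : ℝ) ^ (d + 1))) := by
      have := htsum (fun y ↦ y ^ (2 ^ d))
      simp only [one_pow] at this
      rw [this]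
      gcongr
      refine (sum_le_sum hTb).trans ?_
      rw [← mul_sum, sum_add_distrib, ← mul_sum]
      gcongr
      · rw [sum_const, Nat.card_Ico, nsmul_eq_mul, mul_one_div, div_le_one hH']
        exact_mod_cast Nat.sub_le _ _
      · calc _ ≤ L ^ d / (l * (H : ℝ) ^ (d + 1)) * L := by gcongr
          _ = _ := by ring
    calc x ^ (2 ^ (d + 1)) = (x ^ 2) ^ (2 ^ d) := by rw [← pow_mul, pow_succ, mul_comm 2]
      _ ≤ (4 * ((∑ h ∈ range H, t h) / H)) ^ (2 ^ d) := by gcongr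
      _ = 4 ^ (2 ^ d) * ((∑ h ∈ range H, t h) / H) ^ (2 ^ d) := by rw [mul_pow]
      _ ≤ 4 ^ (2 ^ d) * ((1 + C * (1 + L ^ (d + 1) / (l * (H : ℝ) ^ (d + 1)))) / H) := by
        gcongr
        exact hpm.trans (by gcongr)
      _ ≤ 4 ^ (2 ^ d) * (1 + C) * (1 / H + L ^ (d + 1) / (l * (H : ℝ) ^ (d + 1 + 1))) := by
        rw [mul_assoc]
        gcongr
        have h0 : 0 ≤ L ^ (d + 1) / (l * (H : ℝ) ^ (d + 1 + 1)) := by positivity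
        have e : (1 + C * (1 + L ^ (d + 1) / (l * (H : ℝ) ^ (d + 1)))) / H =
          (1 + C) * (1 / H) + C * (L ^ (d + 1) / (l * (H : ℝ) ^ (d + 1 + 1))) := by
          field_simp
          ring
        rw [e]; nlinarith

/-- The one-periodic extension of the second Bernoulli polynomial. -/
noncomputable def periodicB2 (x : ℝ) : ℝ := Int.fract x ^ 2 - Int.fract x + 1 / 6

lemma fract_add_eq_or {x h : ℝ} (h0 : 0 ≤ h) (h1 : h ≤ 1) :
    (Int.fract x + h < 1 ∧ Int.fract (x + h) = Int.fract x + h) ∨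
      (1 ≤ Int.fract x + h ∧ Int.fract (x + h) = Int.fract x + h - 1) := by
  have a0 := Int.fract_nonneg x
  have a1 := Int.fract_lt_one x
  rcases lt_or_ge (Int.fract x + h) 1 with hlt | hge
  · refine Or.inl ⟨hlt, ?_⟩
    rw [Int.fract_eq_iff]
    exact ⟨by linarith, hlt, ⌊x⌋, by have := Int.self_sub_floor x; linarith⟩
  · refine Or.inr ⟨hge, ?_⟩
    rw [Int.fract_eq_iff]
    exact ⟨by linarith, by linarith, ⌊x⌋ + 1, by
      push_cast; have := Int.self_sub_floor x; linarith⟩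

lemma periodicB2_add_sub_le {x h : ℝ} (h0 : 0 ≤ h) (h1 : h ≤ 1) :
    periodicB2 (x + h) - periodicB2 x - h ^ 2 ≤ 2 * h * (Int.fract x - 1 / 2) := by
  rw [periodicB2, periodicB2]
  rcases fract_add_eq_or (x := x) h0 h1 with ⟨h2, h3⟩ | ⟨h2, h3⟩ <;> rw [h3] <;> nlinarith

lemma le_periodicB2_sub {x h : ℝ} (h0 : 0 ≤ h) (h1 : h ≤ 1) :
    2 * h * (Int.fract x - 1 / 2) ≤ periodicB2 x - periodicB2 (x - h) + h ^ 2 := by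
  obtain ⟨y, rfl⟩ : ∃ y, x = y + h := ⟨x - h, by ring⟩
  rw [add_sub_cancel_right, periodicB2, periodicB2]
  have := Int.fract_lt_one y
  rcases fract_add_eq_or (x := y) h0 h1 with ⟨h2, h3⟩ | ⟨h2, h3⟩ <;> rw [h3] <;> nlinarith

lemma abs_sum_sawtooth_le {ι : Type*} (s : Finset ι) (u : ι → ℝ) {B h : ℝ} (h0 : 0 < h)
    (h1 : h ≤ 1) (hB : ∀ t, |∑ i ∈ s, periodicB2 (u i - t)| ≤ B) (t : ℝ) :
    |∑ i ∈ s, (Int.fract (u i - t) - 1 / 2)| ≤ s.card * h + B / h := by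
  have hup : ∑ i ∈ s, 2 * h * (Int.fract (u i - t) - 1 / 2) ≤
      ∑ i ∈ s, (periodicB2 (u i - t) - periodicB2 (u i - (t + h)) + h ^ 2) :=
    Finset.sum_le_sum fun i _ ↦ by
      have := le_periodicB2_sub (x := u i - t) h0.le h1
      rwa [sub_sub] at this
  have hlo : ∑ i ∈ s, (periodicB2 (u i - (t - h)) - periodicB2 (u i - t) - h ^ 2) ≤
      ∑ i ∈ s, 2 * h * (Int.fract (u i - t) - 1 / 2) :=
    Finset.sum_le_sum fun i _ ↦ by
      have := periodicB2_add_sub_le (x := u i - t) h0.le h1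
      rwa [show u i - t + h = u i - (t - h) by ring] at this
  simp only [Finset.sum_sub_distrib, Finset.sum_add_distrib, Finset.sum_const, nsmul_eq_mul,
    ← Finset.mul_sum] at hup hlo ⊢
  have b1 := abs_le.1 (hB t)
  have b2 := abs_le.1 (hB (t + h))
  have b3 := abs_le.1 (hB (t - h))
  set S := ∑ i ∈ s, Int.fract (u i - t) - s.card * (1 / 2) with hS
  have e : (s.card * h + B / h) * (2 * h) = 2 * s.card * h ^ 2 + 2 * B := by field_simp
  have hc : 0 ≤ (s.card : ℝ) * h ^ 2 := by positivity
  rw [abs_le]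
  constructor
  · refine le_of_mul_le_mul_right (a := 2 * h) ?_ (by positivity)
    rw [neg_mul, e]; linarith [mul_comm S (2 * h)]
  · refine le_of_mul_le_mul_right (a := 2 * h) ?_ (by positivity)
    rw [e]; linarith [mul_comm S (2 * h)]

lemma hasSum_periodicB2 (x : ℝ) :
    HasSum (fun n : ℕ ↦ 1 / (n : ℝ) ^ 2 * (expPhase (n * x)).re) (π ^ 2 * periodicB2 x) := by
  have h := hasSum_one_div_nat_pow_mul_cos (k := 1) one_ne_zero (x := Int.fract x)
    ⟨Int.fract_nonneg x, (Int.fract_lt_one x).le⟩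
  have hB : ((Polynomial.bernoulli 2).map (algebraMap ℚ ℝ)).eval (Int.fract x) =
      periodicB2 x := by
    rw [periodicB2, Polynomial.bernoulli]
    simp [Finset.sum_range_succ, bernoulli_one, bernoulli_two]
    ring
  simp only [mul_one] at h
  rw [hB] at h
  convert h using 1
  · funext n
    congr 1
    rw [expPhase, mul_comm, Complex.exp_ofReal_mul_I_re]
    have : 2 * π * (n * x) = 2 * π * n * Int.fract x + ((n * ⌊x⌋ : ℤ) : ℝ) * (2 * π) := by
      have := Int.self_sub_floor x
      push_cast
      rw [← this]; ring
    rw [this, Real.cos_add_int_mul_two_pi]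
  · rw [show ((Nat.factorial 2 : ℕ) : ℝ) = 2 by norm_num [Nat.factorial]]; ring

lemma abs_sum_periodicB2_le : ∃ C : ℝ, 0 < C ∧ ∀ {ι : Type} (s : Finset ι) (u : ι → ℝ)
    (e K : ℝ), 0 ≤ e → 1 ≤ K →
    (∀ n : ℕ, 1 ≤ n → (n : ℝ) ≤ K → ‖∑ i ∈ s, expPhase (n * u i)‖ ≤ s.card * e) →
    ∀ t, |∑ i ∈ s, periodicB2 (u i - t)| ≤ C * s.card * (e + K ^ (-(1 / 2) : ℝ)) := by
  have hsum : Summable fun n : ℕ ↦ 1 / (n : ℝ) ^ (3 / 2 : ℝ) :=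
    Real.summable_one_div_nat_rpow.2 (by norm_num)
  refine ⟨1 + ∑' n : ℕ, 1 / (n : ℝ) ^ (3 / 2 : ℝ), ?_, ?_⟩
  · have : 0 ≤ ∑' n : ℕ, 1 / (n : ℝ) ^ (3 / 2 : ℝ) := tsum_nonneg fun n ↦ by positivity
    linarith
  intro ι s u e K he hK hn t
  have h1 : HasSum (fun n : ℕ ↦ 1 / (n : ℝ) ^ 2 * (expPhase (n * (-t)) *
      ∑ i ∈ s, expPhase (n * u i)).re) (∑ i ∈ s, π ^ 2 * periodicB2 (u i - t)) := by
    convert hasSum_sum (s := s) fun i _ ↦ hasSum_periodicB2 (u i - t) using 1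
    funext n
    rw [Finset.mul_sum, Complex.re_sum, Finset.mul_sum]
    refine Finset.sum_congr rfl fun i _ ↦ ?_
    rw [← expPhase_add]
    congr 3; ring
  rw [← Finset.mul_sum] at h1
  set W := (s.card : ℝ) * (e + K ^ (-(1 / 2) : ℝ)) with hW
  have hK0 : 0 < K := by linarith
  have hW0 : 0 ≤ W := by positivity
  have hterm : ∀ n : ℕ, |1 / (n : ℝ) ^ 2 * (expPhase (n * (-t)) *
      ∑ i ∈ s, expPhase (n * u i)).re| ≤ W * (1 / (n : ℝ) ^ (3 / 2 : ℝ)) := by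
    intro n
    rcases Nat.eq_zero_or_pos n with rfl | hpos
    · simp
    have hn1 : (1 : ℝ) ≤ n := by exact_mod_cast hpos
    have hn0 : (0 : ℝ) < n := by linarith
    rw [abs_mul, abs_of_nonneg (by positivity : (0 : ℝ) ≤ 1 / (n : ℝ) ^ 2)]
    have h2 : |(expPhase (n * (-t)) * ∑ i ∈ s, expPhase (n * u i)).re| ≤
        ‖∑ i ∈ s, expPhase (n * u i)‖ := by
      refine (Complex.abs_re_le_norm _).trans ?_
      rw [norm_mul, norm_expPhase, one_mul]
    have h3 : (n : ℝ) ^ 2 = (n : ℝ) ^ (3 / 2 : ℝ) * (n : ℝ) ^ (1 / 2 : ℝ) := by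
      rw [← Real.rpow_add hn0]; norm_num
    have h4 : ‖∑ i ∈ s, expPhase (n * u i)‖ ≤ W * (n : ℝ) ^ (1 / 2 : ℝ) := by
      have hn2 : (1 : ℝ) ≤ (n : ℝ) ^ (1 / 2 : ℝ) := Real.one_le_rpow hn1 (by norm_num)
      rcases le_or_gt (n : ℝ) K with hle | hgt
      · refine (hn n hpos hle).trans ?_
        have : (s.card : ℝ) * e ≤ W := by
          rw [hW]; gcongr
          have : 0 ≤ K ^ (-(1 / 2) : ℝ) := by positivity
          linarith
        nlinarith
      · have h5 : ‖∑ i ∈ s, expPhase (n * u i)‖ ≤ s.card := by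
          refine (norm_sum_le_of_le _ fun i _ ↦ (norm_expPhase _).le).trans ?_
          simp
        have h6 : 1 ≤ K ^ (-(1 / 2) : ℝ) * (n : ℝ) ^ (1 / 2 : ℝ) := by
          rw [Real.rpow_neg hK0.le, inv_mul_eq_div, one_le_div (by positivity)]
          gcongr
        calc _ ≤ (s.card : ℝ) * 1 := by rw [mul_one]; exact h5
          _ ≤ s.card * (K ^ (-(1 / 2) : ℝ) * (n : ℝ) ^ (1 / 2 : ℝ)) := by gcongr
          _ = s.card * K ^ (-(1 / 2) : ℝ) * (n : ℝ) ^ (1 / 2 : ℝ) := by ring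
          _ ≤ _ := by rw [hW]; gcongr; linarith
    calc _ ≤ 1 / (n : ℝ) ^ 2 * (W * (n : ℝ) ^ (1 / 2 : ℝ)) := by gcongr; exact h2.trans h4
      _ = _ := by rw [h3]; field_simp
  have h7 : |π ^ 2 * ∑ i ∈ s, periodicB2 (u i - t)| ≤ W * ∑' n : ℕ, 1 / (n : ℝ) ^ (3 / 2 : ℝ) := by
    rw [← h1.tsum_eq, ← tsum_mul_left]
    exact tsum_of_norm_bounded (hsum.mul_left W).hasSum
      fun n ↦ (Real.norm_eq_abs _).trans_le (hterm n)
  rw [abs_mul, abs_of_nonneg (by positivity : (0 : ℝ) ≤ π ^ 2)] at h7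
  have h8 : 1 ≤ π ^ 2 := by nlinarith [Real.pi_gt_three]
  have h9 := abs_nonneg (∑ i ∈ s, periodicB2 (u i - t))
  calc _ ≤ π ^ 2 * |∑ i ∈ s, periodicB2 (u i - t)| := by nlinarith
    _ ≤ _ := h7
    _ ≤ W * (1 + ∑' n : ℕ, 1 / (n : ℝ) ^ (3 / 2 : ℝ)) := by gcongr; linarith
    _ = _ := by rw [hW]; ring

/-- An Erdős–Turán type inequality. -/
lemma discrepancy_le : ∃ C : ℝ, 0 < C ∧ ∀ {ι : Type} (s : Finset ι) (u : ι → ℝ)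
    (e K : ℝ), 0 ≤ e → 1 ≤ K → e + K ^ (-(1 / 2) : ℝ) ≤ 1 →
    (∀ n : ℕ, 1 ≤ n → (n : ℝ) ≤ K → ‖∑ i ∈ s, expPhase (n * u i)‖ ≤ s.card * e) →
    ∀ t, 0 ≤ t → t ≤ 1 →
      |((s.filter fun i ↦ Int.fract (u i) < t).card : ℝ) - t * s.card| ≤
        C * s.card * √(e + K ^ (-(1 / 2) : ℝ)) := by
  obtain ⟨C, hC, hb⟩ := abs_sum_periodicB2_le
  refine ⟨2 * (1 + C), by positivity, ?_⟩
  intro ι s u e K he hK hr hn t ht0 ht1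
  have hK0 : 0 < K := by linarith
  set r := e + K ^ (-(1 / 2) : ℝ) with hr'
  have hr0 : 0 < r := by positivity
  have hsaw := abs_sum_sawtooth_le s u (Real.sqrt_pos.2 hr0) (Real.sqrt_le_one.2 hr)
    (hb s u e K he hK hn)
  have hE : (s.card : ℝ) * √r + C * s.card * r / √r = (1 + C) * s.card * √r := by
    rw [mul_div_assoc, Real.div_sqrt]; ring
  rw [← hr', hE] at hsaw
  have hpt : ∀ i ∈ s, (if Int.fract (u i) < t then (1 : ℝ) else 0) =
      (Int.fract (u i - t) - 1 / 2) - (Int.fract (u i - 0) - 1 / 2) + t := by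
    intro i _
    have := fract_add_eq_or (x := u i - t) ht0 ht1
    have h0 := Int.fract_nonneg (u i - t)
    rw [sub_add_cancel] at this
    rw [sub_zero]
    split_ifs with hlt <;> rcases this with ⟨h2, h3⟩ | ⟨h2, h3⟩ <;> linarith [Int.fract_lt_one (u i - t)]
  rw [Finset.card_filter]
  push_cast
  rw [Finset.sum_congr rfl hpt, Finset.sum_add_distrib, Finset.sum_sub_distrib]
  have a1 := abs_le.1 (hsaw t)
  have a2 := abs_le.1 (hsaw 0)
  simp only [Finset.sum_const, nsmul_eq_mul] at *
  rw [abs_le]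
  constructor <;> linarith [mul_comm t (s.card : ℝ)]


lemma norm_cpow_neg_sub_le {a b : ℝ} (ha : 0 < a) (hab : a ≤ b) {s : ℂ} (hs : 0 < s.re) :
    ‖(a : ℂ) ^ (-s) - (b : ℂ) ^ (-s)‖ ≤ ‖s‖ * (b - a) * a ^ (-s.re - 1) := by
  have hs0 : -s ≠ 0 := by
    intro h; rw [neg_eq_zero] at h; rw [h] at hs; simp at hs
  have hd : ∀ t ∈ Set.Icc a b, HasDerivWithinAt (fun t : ℝ ↦ (t : ℂ) ^ (-s))
      (-s * (t : ℂ) ^ (-s - 1)) (Set.Icc a b) t := by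
    intro t ht
    have ht0 : t ≠ 0 := by linarith [ht.1]
    have h := (hasDerivAt_id (t : ℂ)).cpow_const (c := -s) (Or.inl (by
      simpa using ha.trans_le ht.1))
    simpa using (h.comp_ofReal).hasDerivWithinAt
  have hb : ∀ t ∈ Set.Icc a b, ‖-s * (t : ℂ) ^ (-s - 1)‖ ≤ ‖s‖ * a ^ (-s.re - 1) := by
    intro t ht
    have ht0 : 0 < t := ha.trans_le ht.1
    rw [norm_mul, norm_neg, Complex.norm_cpow_eq_rpow_re_of_pos ht0]
    gcongr
    simp only [Complex.sub_re, Complex.neg_re, Complex.one_re]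
    exact Real.rpow_le_rpow_of_nonpos ha ht.1 (by linarith)
  have := Convex.norm_image_sub_le_of_norm_hasDerivWithin_le hd hb (convex_Icc a b)
    (Set.right_mem_Icc.2 hab) (Set.left_mem_Icc.2 hab)
  refine this.trans (le_of_eq ?_)
  rw [Real.norm_eq_abs, abs_sub_comm, abs_of_nonneg (by linarith)]
  ring

open HurwitzZeta in
/-- Termwise comparison of two Hurwitz zeta functions at the central point. -/
lemma hurwitzZeta_sub_hurwitzZeta_half {x y : ℝ} (hx : 0 < x) (hxy : x ≤ y) (hy : y ≤ 1) :
    hurwitzZeta (x : UnitAddCircle) (1 / 2) - hurwitzZeta (y : UnitAddCircle) (1 / 2) =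
      ((x : ℂ) ^ (-(1 / 2) : ℂ) - (y : ℂ) ^ (-(1 / 2) : ℂ)) +
      ∑' n : ℕ, (((n + 1 + x : ℝ) : ℂ) ^ (-(1 / 2) : ℂ) -
        ((n + 1 + y : ℝ) : ℂ) ^ (-(1 / 2) : ℂ)) := by
  set U : Set ℂ := {s | 1 / 4 < s.re} ∩ Metric.ball 0 4 with hU
  have hUo : IsOpen U := (isOpen_lt continuous_const Complex.continuous_re).inter Metric.isOpen_ball
  have hUc : IsPreconnected U :=
    ((convex_halfSpace_re_gt (1 / 4)).inter (convex_ball 0 4)).isPreconnected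
  set g : ℂ → ℂ := fun s ↦ ((x : ℂ) ^ (-s) - (y : ℂ) ^ (-s)) +
      ∑' n : ℕ, (((n + 1 + x : ℝ) : ℂ) ^ (-s) - ((n + 1 + y : ℝ) : ℂ) ^ (-s)) with hg
  set f : ℂ → ℂ := fun s ↦ hurwitzZeta (x : UnitAddCircle) s - hurwitzZeta (y : UnitAddCircle) s
    with hf
  have hpow : ∀ c : ℝ, 0 < c → Differentiable ℂ fun s : ℂ ↦ (c : ℂ) ^ (-s) := fun c hc s ↦
    (differentiableAt_id.neg).const_cpow (Or.inl (by exact_mod_cast hc.ne'))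
  have hfa : AnalyticOnNhd ℂ f U :=
    (differentiable_hurwitzZeta_sub_hurwitzZeta _ _).differentiableOn.analyticOnNhd hUo
  have hga : AnalyticOnNhd ℂ g U := by
    refine DifferentiableOn.analyticOnNhd ?_ hUo
    refine (((hpow x hx).sub (hpow y (hx.trans_le hxy))).differentiableOn).add ?_
    refine Complex.differentiableOn_tsum_of_summable_norm
      (u := fun n : ℕ ↦ 4 * (1 / ((n + 1 : ℕ) : ℝ) ^ (5 / 4 : ℝ))) ?_ ?_ hUo ?_
    · exact ((summable_nat_add_iff 1).2
        (Real.summable_one_div_nat_rpow.2 (by norm_num : (1 : ℝ) < 5 / 4))).mul_left 4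
    · intro n
      exact ((hpow _ (by positivity)).sub
        (hpow _ (by have := hx.trans_le hxy; positivity))).differentiableOn
    · intro n s hs
      have hs1 : 1 / 4 < s.re := hs.1
      have hs2 : ‖s‖ < 4 := by simpa using hs.2
      refine (norm_cpow_neg_sub_le (by positivity) (by linarith) (by linarith)).trans ?_
      have h1 : (1 : ℝ) ≤ n + 1 + x := by have : (0 : ℝ) ≤ n := by positivity
                                          linarith
      have h2 : (n + 1 + x : ℝ) ^ (-s.re - 1) ≤ 1 / ((n + 1 : ℕ) : ℝ) ^ (5 / 4 : ℝ) := by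
        calc _ ≤ (n + 1 + x : ℝ) ^ (-(5 / 4) : ℝ) :=
              Real.rpow_le_rpow_of_exponent_le h1 (by linarith)
          _ ≤ ((n + 1 : ℕ) : ℝ) ^ (-(5 / 4) : ℝ) :=
              Real.rpow_le_rpow_of_nonpos (by positivity) (by push_cast; linarith) (by norm_num)
          _ = _ := by rw [Real.rpow_neg (by positivity), one_div]
      have h3 : ‖s‖ * (n + 1 + y - (n + 1 + x)) ≤ 4 := by
        have : n + 1 + y - (n + 1 + x) ≤ 1 := by linarith
        have h0 : 0 ≤ (n : ℝ) + 1 + y - (n + 1 + x) := by linarith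
        nlinarith [norm_nonneg s]
      gcongr
  have h2U : (2 : ℂ) ∈ U := by
    constructor
    · simp; norm_num
    · simp; norm_num
  have heq : f =ᶠ[nhds 2] g := by
    have : ∀ᶠ s : ℂ in nhds 2, 1 < s.re :=
      Complex.continuous_re.continuousAt.eventually (lt_mem_nhds (by simp))
    filter_upwards [this] with s hs
    have h1 := hasSum_hurwitzZeta_of_one_lt_re (a := x) ⟨hx.le, hxy.trans hy⟩ hs
    have h2 := hasSum_hurwitzZeta_of_one_lt_re (a := y) ⟨hx.le.trans hxy, hy⟩ hs
    have h3 := h1.sub h2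
    have h4 := h3.summable.tsum_eq_zero_add
    rw [h3.tsum_eq] at h4
    simp only [hf, hg]
    rw [h4]
    simp [Complex.cpow_neg]
  have := hfa.eqOn_of_preconnected_of_eventuallyEq hga hUc h2U heq
    (show (1 / 2 : ℂ) ∈ U from ⟨by simp; norm_num, by simp; norm_num⟩)
  simpa [hf, hg] using this

open HurwitzZeta in
/-- The behaviour of `x ↦ ζ(1/2, x)` on `(0, 1]`. -/
lemma hurwitzZeta_half_bounds : ∃ C : ℝ, 0 < C ∧
    (∀ x : ℝ, 0 < x → x ≤ 1 →
      ‖hurwitzZeta (x : UnitAddCircle) (1 / 2) - ((x ^ (-(1 / 2) : ℝ) : ℝ) : ℂ)‖ ≤ C) ∧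
    (∀ x y : ℝ, 0 < x → x ≤ y → y ≤ 1 →
      ‖hurwitzZeta (x : UnitAddCircle) (1 / 2) - hurwitzZeta (y : UnitAddCircle) (1 / 2)‖ ≤
        C * (y - x) * x ^ (-(3 / 2) : ℝ)) := by
  have hs : Summable fun n : ℕ ↦ 1 / ((n + 1 : ℕ) : ℝ) ^ (3 / 2 : ℝ) :=
    (summable_nat_add_iff 1).2 (Real.summable_one_div_nat_rpow.2 (by norm_num))
  set Z := ∑' n : ℕ, 1 / ((n + 1 : ℕ) : ℝ) ^ (3 / 2 : ℝ) with hZ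
  have hZ0 : 0 ≤ Z := tsum_nonneg fun n ↦ by positivity
  have htail : ∀ x y : ℝ, 0 < x → x ≤ y → y ≤ 1 →
      ‖∑' n : ℕ, (((n + 1 + x : ℝ) : ℂ) ^ (-(1 / 2) : ℂ) -
        ((n + 1 + y : ℝ) : ℂ) ^ (-(1 / 2) : ℂ))‖ ≤ (y - x) * Z := by
    intro x y hx hxy hy
    refine tsum_of_norm_bounded (hs.hasSum.mul_left (y - x)) fun n ↦ ?_
    refine (norm_cpow_neg_sub_le (by positivity) (by linarith) (by norm_num)).trans ?_
    have h2 : (n + 1 + x : ℝ) ^ (-(1 / 2 : ℂ).re - 1) ≤ 1 / ((n + 1 : ℕ) : ℝ) ^ (3 / 2 : ℝ) := by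
      calc _ = (n + 1 + x : ℝ) ^ (-(3 / 2) : ℝ) := by congr 1; norm_num
        _ ≤ ((n + 1 : ℕ) : ℝ) ^ (-(3 / 2) : ℝ) :=
            Real.rpow_le_rpow_of_nonpos (by positivity) (by push_cast; linarith) (by norm_num)
        _ = _ := by rw [Real.rpow_neg (by positivity), one_div]
    have h3 : ‖(1 / 2 : ℂ)‖ * (n + 1 + y - (n + 1 + x)) ≤ y - x := by
      norm_num; linarith
    gcongr
  have hreal : ∀ x : ℝ, 0 < x → (x : ℂ) ^ (-(1 / 2) : ℂ) = ((x ^ (-(1 / 2) : ℝ) : ℝ) : ℂ) := by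
    intro x hx
    rw [Complex.ofReal_cpow hx.le]; norm_num
  refine ⟨Z + ‖hurwitzZeta ((1 : ℝ) : UnitAddCircle) (1 / 2)‖ + 1, by positivity, ?_, ?_⟩
  · intro x hx hx1
    have h := hurwitzZeta_sub_hurwitzZeta_half hx hx1 le_rfl
    have ht := htail x 1 hx hx1 le_rfl
    rw [hreal x hx, hreal 1 one_pos] at h
    rw [sub_eq_iff_eq_add] at h
    rw [h, Real.one_rpow]
    set t := ∑' n : ℕ, (((n + 1 + x : ℝ) : ℂ) ^ (-(1 / 2) : ℂ) -
        ((n + 1 + 1 : ℝ) : ℂ) ^ (-(1 / 2) : ℂ))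
    calc _ = ‖(t + hurwitzZeta ((1 : ℝ) : UnitAddCircle) (1 / 2)) - 1‖ := by
          congr 1; push_cast; ring
      _ ≤ ‖t‖ + ‖hurwitzZeta ((1 : ℝ) : UnitAddCircle) (1 / 2)‖ + ‖(1 : ℂ)‖ :=
          (norm_sub_le _ _).trans (by gcongr; exact norm_add_le _ _)
      _ ≤ _ := by rw [norm_one]; gcongr; nlinarith
  · intro x y hx hxy hy
    rw [hurwitzZeta_sub_hurwitzZeta_half hx hxy hy]
    have h1 := norm_cpow_neg_sub_le hx hxy (s := 1 / 2) (by norm_num)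
    have e : (-(1 / 2 : ℂ).re - 1) = -(3 / 2) := by norm_num
    rw [e] at h1
    have h2 : 1 ≤ x ^ (-(3 / 2) : ℝ) :=
      Real.one_le_rpow_of_pos_of_le_one_of_nonpos hx (hxy.trans hy) (by norm_num)
    have h3 : ‖(1 / 2 : ℂ)‖ ≤ 1 := by norm_num
    have hd : 0 ≤ y - x := by linarith
    have hn := norm_nonneg (hurwitzZeta ((1 : ℝ) : UnitAddCircle) (1 / 2))
    calc _ ≤ 1 * (y - x) * x ^ (-(3 / 2) : ℝ) + (y - x) * Z :=
          (norm_add_le _ _).trans (add_le_add (h1.trans (by gcongr)) (htail x y hx hxy hy))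
      _ ≤ 1 * (y - x) * x ^ (-(3 / 2) : ℝ) + (y - x) * Z * x ^ (-(3 / 2) : ℝ) := by
          have := le_mul_of_one_le_right (mul_nonneg hd hZ0) h2
          linarith
      _ = (Z + 1) * (y - x) * x ^ (-(3 / 2) : ℝ) := by ring
      _ ≤ _ := by gcongr; linarith

open Finset in
lemma norm_sum_mul_le_of_partial_sums {w a : ℕ → ℂ} {m M : ℕ} (hmM : m ≤ M) (hM : 0 < M)
    {D T : ℝ} (hD : 0 ≤ D) (hT : 0 ≤ T)
    (hw : ∀ n, 0 < n → n ≤ M → ‖w n‖ ≤ D * (n : ℝ) ^ (-(1 / 2) : ℝ))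
    (hw' : ∀ n, 0 < n → n < M → ‖w n - w (n + 1)‖ ≤ D * (n : ℝ) ^ (-(3 / 2) : ℝ))
    (hA : ∀ n, m ≤ n → n ≤ M → ‖∑ i ∈ Ioc m n, a i‖ ≤ T * (n : ℝ) ^ (1 / 2 : ℝ)) :
    ‖∑ i ∈ Ioc m M, w i * a i‖ ≤ D * T * (2 + Real.log M) := by
  have hform : ∑ i ∈ Ioc m M, w i * a i = w M * ∑ i ∈ Ioc m M, a i +
      ∑ n ∈ Ico m M, (w n - w (n + 1)) * ∑ i ∈ Ioc m n, a i := by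
    clear hA hw hw' hM
    induction M, hmM using Nat.le_induction with
    | base => simp
    | succ k hk ih =>
      rw [sum_Ioc_succ_top (by omega), sum_Ico_succ_top (by omega),
        sum_Ioc_succ_top (by omega), ih]
      ring
  have hM' : (0 : ℝ) < M := by exact_mod_cast hM
  have h1 : ‖w M * ∑ i ∈ Ioc m M, a i‖ ≤ D * T := by
    rw [norm_mul]
    calc _ ≤ D * (M : ℝ) ^ (-(1 / 2) : ℝ) * (T * (M : ℝ) ^ (1 / 2 : ℝ)) :=
          mul_le_mul (hw M hM le_rfl) (hA M hmM le_rfl) (norm_nonneg _) (by positivity)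
      _ = D * T * ((M : ℝ) ^ (-(1 / 2) : ℝ) * (M : ℝ) ^ (1 / 2 : ℝ)) := by ring
      _ = D * T := by rw [← Real.rpow_add hM']; simp
  have h2 : ∀ n ∈ Ico m M, ‖(w n - w (n + 1)) * ∑ i ∈ Ioc m n, a i‖ ≤ D * T * (n : ℝ)⁻¹ := by
    intro n hn
    obtain ⟨hmn, hnM⟩ := mem_Ico.1 hn
    rcases Nat.eq_zero_or_pos n with rfl | hpos
    · have : m = 0 := by omega
      subst this; simp
    have hn' : (0 : ℝ) < n := by exact_mod_cast hpos
    rw [norm_mul]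
    calc _ ≤ D * (n : ℝ) ^ (-(3 / 2) : ℝ) * (T * (n : ℝ) ^ (1 / 2 : ℝ)) :=
          mul_le_mul (hw' n hpos hnM) (hA n hmn hnM.le) (norm_nonneg _) (by positivity)
      _ = D * T * ((n : ℝ) ^ (-(3 / 2) : ℝ) * (n : ℝ) ^ (1 / 2 : ℝ)) := by ring
      _ = D * T * (n : ℝ)⁻¹ := by
          rw [← Real.rpow_add hn', ← Real.rpow_neg_one]; norm_num
  have h3 : ∑ n ∈ Ico m M, (n : ℝ)⁻¹ ≤ 1 + Real.log M := by
    have := harmonic_le_one_add_log M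
    rw [harmonic_eq_sum_Icc] at this
    push_cast at this
    refine le_trans ?_ this
    calc _ ≤ ∑ n ∈ Icc 0 M, (n : ℝ)⁻¹ := sum_le_sum_of_subset_of_nonneg (by
          intro x hx; simp only [mem_Ico, mem_Icc] at *; omega) fun _ _ _ ↦ by positivity
      _ = _ := by
          rw [← Ico_add_one_right_eq_Icc, sum_eq_sum_Ico_succ_bot (by omega)]
          simp [Ico_add_one_right_eq_Icc]
  rw [hform]
  calc _ ≤ D * T + ∑ n ∈ Ico m M, D * T * (n : ℝ)⁻¹ :=
        (norm_add_le _ _).trans (add_le_add h1 (norm_sum_le_of_le _ h2))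
    _ ≤ D * T + D * T * (1 + Real.log M) := by rw [← mul_sum]; gcongr
    _ = _ := by ring

/-- The value `ζ(1/2, n/q)` of the Hurwitz zeta function. -/
noncomputable def hurwitzHalf (q n : ℕ) : ℂ :=
  HurwitzZeta.hurwitzZeta (((n : ℝ) / q : ℝ) : UnitAddCircle) (1 / 2)

lemma hurwitzHalf_bounds : ∃ C : ℝ, 0 < C ∧ ∀ q n : ℕ, 0 < n → n < q →
    ‖hurwitzHalf q n - (((q : ℝ) ^ (1 / 2 : ℝ) * (n : ℝ) ^ (-(1 / 2) : ℝ) : ℝ) : ℂ)‖ ≤ C ∧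
    ‖hurwitzHalf q n‖ ≤ C * (q : ℝ) ^ (1 / 2 : ℝ) * (n : ℝ) ^ (-(1 / 2) : ℝ) ∧
    ‖hurwitzHalf q n - hurwitzHalf q (n + 1)‖ ≤
      C * (q : ℝ) ^ (1 / 2 : ℝ) * (n : ℝ) ^ (-(3 / 2) : ℝ) := by
  obtain ⟨C, hC, h1, h2⟩ := hurwitzZeta_half_bounds
  refine ⟨C + 1, by positivity, fun q n hn hnq ↦ ?_⟩
  have hn0 : (0 : ℝ) < n := by exact_mod_cast hn
  have hq0 : (0 : ℝ) < q := by exact_mod_cast hn.trans hnq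
  have hnq' : (n : ℝ) + 1 ≤ q := by exact_mod_cast hnq
  have hx0 : 0 < (n : ℝ) / q := by positivity
  have hx1 : (n : ℝ) / q ≤ 1 := by rw [div_le_one hq0]; linarith
  have e : ((n : ℝ) / q) ^ (-(1 / 2) : ℝ) = (q : ℝ) ^ (1 / 2 : ℝ) * (n : ℝ) ^ (-(1 / 2) : ℝ) := by
    rw [Real.div_rpow hn0.le hq0.le, Real.rpow_neg hq0.le, div_inv_eq_mul, mul_comm]
  have e' : ((n : ℝ) / q) ^ (-(3 / 2) : ℝ) = (q : ℝ) ^ (3 / 2 : ℝ) * (n : ℝ) ^ (-(3 / 2) : ℝ) := by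
    rw [Real.div_rpow hn0.le hq0.le, Real.rpow_neg hq0.le, div_inv_eq_mul, mul_comm]
  have a1 := h1 _ hx0 hx1
  rw [e] at a1
  have hone : 1 ≤ (q : ℝ) ^ (1 / 2 : ℝ) * (n : ℝ) ^ (-(1 / 2) : ℝ) := by
    rw [← e]; exact Real.one_le_rpow_of_pos_of_le_one_of_nonpos hx0 hx1 (by norm_num)
  refine ⟨a1.trans (by linarith), ?_, ?_⟩
  · have := norm_le_norm_sub_add (hurwitzHalf q n)
      (((q : ℝ) ^ (1 / 2 : ℝ) * (n : ℝ) ^ (-(1 / 2) : ℝ) : ℝ) : ℂ)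
    rw [Complex.norm_real, Real.norm_of_nonneg (by positivity)] at this
    have a2 : ‖hurwitzHalf q n - (((q : ℝ) ^ (1 / 2 : ℝ) * (n : ℝ) ^ (-(1 / 2) : ℝ) : ℝ) : ℂ)‖ ≤ C :=
      a1
    nlinarith
  · have := h2 ((n : ℝ) / q) (((n + 1 : ℕ) : ℝ) / q) hx0 (by push_cast; gcongr; linarith)
      (by rw [div_le_one hq0]; push_cast; exact hnq')
    refine this.trans ?_
    have e3 : C * (((n + 1 : ℕ) : ℝ) / q - (n : ℝ) / q) * ((n : ℝ) / q) ^ (-(3 / 2) : ℝ) =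
        C * (q : ℝ) ^ (1 / 2 : ℝ) * (n : ℝ) ^ (-(3 / 2) : ℝ) := by
      have h3 : (q : ℝ) ^ (3 / 2 : ℝ) = q * (q : ℝ) ^ (1 / 2 : ℝ) := by
        rw [← Real.rpow_one_add' hq0.le (by norm_num)]; norm_num
      rw [e', h3]
      push_cast
      field_simp
      ring
    rw [e3]
    gcongr
    linarith

open Finset Polynomial in
lemma card_filter_mul_pow_mod_le {q b c : ℕ} [hq : Fact q.Prime] (hb : 0 < b)
    (hc : ¬ q ∣ c) {Y : ℕ} (hY : Y < q) (n : ℕ) :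
    ((range Y).filter fun i ↦ (c * (i + 1) ^ b) % q ≤ n).card ≤ b * n := by
  have hpos : ∀ i ∈ range Y, (c * (i + 1) ^ b) % q ≠ 0 := by
    intro i hi h0
    have hi := mem_range.1 hi
    rcases hq.out.dvd_mul.1 (Nat.dvd_of_mod_eq_zero h0) with h | h
    · exact hc h
    · exact absurd (Nat.le_of_dvd (by omega) (hq.out.dvd_of_dvd_pow h)) (by omega)
  have hmaps : ∀ i ∈ (range Y).filter (fun i ↦ (c * (i + 1) ^ b) % q ≤ n),
      (c * (i + 1) ^ b) % q ∈ Icc 1 n := by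
    intro i hi
    obtain ⟨h1, h2⟩ := mem_filter.1 hi
    exact mem_Icc.2 ⟨Nat.one_le_iff_ne_zero.2 (hpos i h1), h2⟩
  have := card_le_mul_card_image_of_maps_to hmaps b (fun v hv ↦ ?_)
  · simpa using this
  set S := ((range Y).filter (fun i ↦ (c * (i + 1) ^ b) % q ≤ n)).filter
    (fun i ↦ (c * (i + 1) ^ b) % q = v) with hS
  have hinj : Set.InjOn (fun i : ℕ ↦ ((i + 1 : ℕ) : ZMod q)) S := by
    intro i hi j hj hij
    have hi : i < Y := by
      simp only [hS, coe_filter, mem_filter, mem_range, Set.mem_ofPred_eq] at hi; exact hi.1.1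
    have hj : j < Y := by
      simp only [hS, coe_filter, mem_filter, mem_range, Set.mem_ofPred_eq] at hj; exact hj.1.1
    have := (ZMod.natCast_eq_natCast_iff' _ _ _).1 hij
    rw [Nat.mod_eq_of_lt (by omega), Nat.mod_eq_of_lt (by omega)] at this
    omega
  have hcz : (c : ZMod q) ≠ 0 := by rwa [Ne, ZMod.natCast_eq_zero_iff]
  have hsub : S.image (fun i : ℕ ↦ ((i + 1 : ℕ) : ZMod q)) ⊆
      (nthRoots b ((v : ZMod q) / c)).toFinset := by
    intro z hz
    obtain ⟨i, hi, rfl⟩ := mem_image.1 hz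
    have hv' : (c * (i + 1) ^ b) % q = v := (mem_filter.1 hi).2
    rw [Multiset.mem_toFinset, mem_nthRoots hb, eq_div_iff hcz, ← hv', ZMod.natCast_mod]
    push_cast; ring
  rw [← card_image_of_injOn hinj]
  exact (card_le_card hsub).trans ((Multiset.toFinset_card_le _).trans (card_nthRoots _ _))

lemma exists_forall_le_rpow (K : ℝ) {ε : ℝ} (hε : 0 < ε) :
    ∃ Q : ℕ, ∀ q : ℕ, Q ≤ q → K ≤ (q : ℝ) ^ ε := by
  have h := ((tendsto_rpow_atTop hε).comp tendsto_natCast_atTop_atTop).eventually_ge_atTop K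
  exact Filter.eventually_atTop.1 h

lemma half_le_floor {x : ℝ} (hx : 1 ≤ x) : x / 2 ≤ (⌊x⌋₊ : ℝ) := by
  have h1 := Nat.lt_floor_add_one x
  have h2 : (1 : ℝ) ≤ ⌊x⌋₊ := by exact_mod_cast (Nat.one_le_floor_iff _).2 hx
  linarith

lemma one_add_log_le {q δ : ℝ} (hq : 1 ≤ q) (hδ : 0 < δ) :
    1 + Real.log q ≤ (1 + 1 / δ) * q ^ δ := by
  have h1 := Real.log_le_rpow_div (by linarith : 0 ≤ q) hδ
  have h2 := Real.one_le_rpow hq hδ.le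
  calc 1 + Real.log q ≤ q ^ δ + q ^ δ / δ := by linarith
    _ = _ := by ring

open Polynomial Finset in
/-- A power saving for the exponential sums attached to `h c y ^ b / q`. -/
lemma norm_sum_expPhase_pow_le {b : ℕ} (hb : 1 < b) {δ : ℝ} (hδ : 0 < δ)
    (hδb : 8 * (b : ℝ) ^ 2 * δ ≤ 1) :
    ∃ C : ℝ, 0 < C ∧ ∃ Q : ℕ, ∀ q : ℕ, Q ≤ q → ∀ h c : ℕ, 1 ≤ h → 1 ≤ c →
      (h : ℝ) ≤ (q : ℝ) ^ δ → (c : ℝ) ≤ (q : ℝ) ^ δ →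
      ∀ Y : ℕ, ⌊(q : ℝ) ^ (1 / (b : ℝ) + δ)⌋₊ ≤ Y →
      ‖∑ i ∈ range Y, expPhase (h * ((c * (i + 1) ^ b : ℕ) / q))‖ ≤
        Y * (C * (q : ℝ) ^ (-(δ / 2 ^ (b - 1)))) := by
  obtain ⟨d, rfl⟩ : ∃ d, b = d + 1 := ⟨b - 1, by omega⟩
  obtain ⟨C, hC, hW⟩ := weyl_inequality d
  have hb0 : (0 : ℝ) < ((d + 1 : ℕ) : ℝ) := by positivity
  have hb1 : (2 : ℝ) ≤ ((d + 1 : ℕ) : ℝ) := by exact_mod_cast hb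
  obtain ⟨Q, hQ⟩ := exists_forall_le_rpow (2 * ((d + 1).factorial : ℝ))
    (ε := 1 / (2 * ((d + 1 : ℕ) : ℝ))) (by positivity)
  set B : ℝ := ((d + 1 : ℕ) : ℝ) with hB
  set C₁ : ℝ := C * (2 + (1 + 1 / δ) ^ d * 2 ^ (d + 1)) with hC₁
  have hC₁0 : 0 < C₁ := by positivity
  refine ⟨max 1 C₁, by positivity, max 1 Q, fun q hq h c hh hc hhq hcq Y hHY ↦ ?_⟩
  have hq1 : (1 : ℝ) ≤ q := by exact_mod_cast (le_max_left _ _).trans hq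
  have hq0 : (0 : ℝ) < q := by linarith
  have hqQ := hQ q ((le_max_right _ _).trans hq)
  have hh' : (1 : ℝ) ≤ h := by exact_mod_cast hh
  have hc' : (1 : ℝ) ≤ c := by exact_mod_cast hc
  set x : ℝ := (q : ℝ) ^ (1 / B + δ) with hx
  have hx1 : 1 ≤ x := Real.one_le_rpow hq1 (by positivity)
  set H : ℕ := ⌊x⌋₊ with hH
  have hHle : (H : ℝ) ≤ x := Nat.floor_le (by linarith)
  have hHge : x / 2 ≤ H := half_le_floor hx1
  have hH1 : 1 ≤ H := (Nat.one_le_floor_iff _).2 hx1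
  have hxq : x ≤ q := by
    conv_rhs => rw [← Real.rpow_one (q : ℝ)]
    refine Real.rpow_le_rpow_of_exponent_le hq1 ?_
    have : δ ≤ 1 / 2 := by nlinarith
    have : 1 / B ≤ 1 / 2 := one_div_le_one_div_of_le (by norm_num) hb1
    linarith
  set l : ℝ := h * c / q with hl
  have hl0 : 0 < l := by positivity
  set f : ℝ[X] := Polynomial.C l * (X + 1) ^ (d + 1) with hf
  have hmon : ((X + 1 : ℝ[X]) ^ (d + 1)).Monic := (monic_X_add_C (1 : ℝ)).pow _
  have hdeg : ((X + 1 : ℝ[X]) ^ (d + 1)).natDegree = d + 1 := by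
    rw [natDegree_pow, show (X + 1 : ℝ[X]) = X + Polynomial.C 1 by simp, natDegree_X_add_C, mul_one]
  have hcoeff : f.coeff (d + 1) = l := by
    rw [hf, coeff_C_mul]
    have := hmon.coeff_natDegree
    rw [hdeg] at this
    rw [this, mul_one]
  have hfdeg : f.natDegree ≤ d + 1 := (natDegree_C_mul_le _ _).trans hdeg.le
  have hcond : ((d + 1).factorial : ℝ) * f.coeff (d + 1) * (H : ℝ) ^ d ≤ 1 / 2 := by
    rw [hcoeff]
    have e1 : l * (H : ℝ) ^ d ≤ (q : ℝ) ^ (-(1 / (2 * B))) := by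
      calc l * (H : ℝ) ^ d ≤ ((q : ℝ) ^ δ * (q : ℝ) ^ δ / q) * x ^ d := by rw [hl]; gcongr
        _ = (q : ℝ) ^ (δ + δ - 1 + (1 / B + δ) * d) := by
          rw [hx, ← Real.rpow_mul_natCast hq0.le, Real.rpow_add hq0, Real.rpow_sub hq0,
            Real.rpow_add hq0, Real.rpow_one]
        _ ≤ _ := by
          refine Real.rpow_le_rpow_of_exponent_le hq1 ?_
          have hd : (d : ℝ) = B - 1 := by rw [hB]; push_cast; ring
          rw [hd]
          have e2 : δ + δ - 1 + (1 / B + δ) * (B - 1) = (B + 1) * δ - 1 / B := by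
            field_simp; ring
          have e3 : 1 / B = 2 * (1 / (2 * B)) := by field_simp
          have e4 : (B + 1) * δ ≤ 1 / (2 * B) := by
            rw [le_div_iff₀ (by positivity)]; nlinarith
          linarith
    calc ((d + 1).factorial : ℝ) * l * (H : ℝ) ^ d = (d + 1).factorial * (l * (H : ℝ) ^ d) := by
          ring
      _ ≤ ((q : ℝ) ^ (1 / (2 * B)) / 2) * (q : ℝ) ^ (-(1 / (2 * B))) := by
          gcongr; linarith
      _ = 1 / 2 := by
          rw [Real.rpow_neg hq0.le]; field_simp
  have hlog : ∑ h ∈ Ico 1 H, (1 / h : ℝ) ≤ (1 + 1 / δ) * (q : ℝ) ^ δ := by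
    refine le_trans ?_ (one_add_log_le hq1 hδ)
    have h1 := harmonic_le_one_add_log H
    have h2 : ∑ h ∈ Ico 1 H, (1 / h : ℝ) ≤ (harmonic H : ℝ) := by
      rw [harmonic_eq_sum_Icc]
      push_cast
      simp_rw [one_div]
      refine sum_le_sum_of_subset_of_nonneg (fun i hi ↦ ?_) (fun i _ _ ↦ by positivity)
      simp only [mem_Ico, mem_Icc] at hi ⊢; omega
    have h3 : Real.log H ≤ Real.log q := Real.log_le_log (by positivity) (hHle.trans hxq)
    linarith
  have hL1 : 1 ≤ (1 + 1 / δ) * (q : ℝ) ^ δ := by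
    have h1 := Real.one_le_rpow hq1 hδ.le
    have h2 : 0 < 1 / δ := by positivity
    nlinarith
  have key := hW f H Y Y _ hfdeg (hcoeff.symm ▸ hl0) hcond hH1 hHY le_rfl hlog hL1
  have hsum : ∀ i : ℕ, f.eval (i : ℝ) = h * ((c * (i + 1) ^ (d + 1) : ℕ) / q) := by
    intro i
    simp only [hf, hl, eval_mul, eval_C, eval_pow, eval_add, eval_X, eval_one]
    push_cast; ring
  simp_rw [hsum, hcoeff] at key
  have hY0 : (0 : ℝ) < Y := by exact_mod_cast hH1.trans hHY
  rw [← div_le_iff₀' hY0]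
  refine le_of_pow_le_pow_left₀ (n := 2 ^ d) (by positivity) (by positivity) (key.trans ?_)
  have hA : 1 / (H : ℝ) ≤ 2 * (q : ℝ) ^ (-δ) := by
    have h1 : (q : ℝ) ^ δ ≤ x := Real.rpow_le_rpow_of_exponent_le hq1 (by
      have : 0 < 1 / B := by positivity
      linarith)
    have h2 : 0 < (q : ℝ) ^ δ := by positivity
    rw [Real.rpow_neg hq0.le, ← div_eq_mul_inv, div_le_div_iff₀ (by positivity) h2]
    linarith
  have hBd : ((1 + 1 / δ) * (q : ℝ) ^ δ) ^ d / (l * (H : ℝ) ^ (d + 1)) ≤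
      (1 + 1 / δ) ^ d * 2 ^ (d + 1) * (q : ℝ) ^ (-δ) := by
    have h1 : (q : ℝ) ^ (B * δ) / 2 ^ (d + 1) ≤ l * (H : ℝ) ^ (d + 1) := by
      calc (q : ℝ) ^ (B * δ) / 2 ^ (d + 1) = 1 / q * (x / 2) ^ (d + 1) := by
            rw [hx, div_pow, ← Real.rpow_mul_natCast hq0.le, ← hB, add_mul,
              one_div_mul_cancel hb0.ne', Real.rpow_add hq0, Real.rpow_one, mul_comm δ]
            field_simp
        _ ≤ _ := by
            rw [hl]
            gcongr
            nlinarith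
    rw [div_le_iff₀ (by positivity)]
    refine le_trans (le_of_eq ?_) (mul_le_mul_of_nonneg_left h1 (by positivity))
    rw [mul_pow, ← Real.rpow_mul_natCast hq0.le]
    have h2 : (q : ℝ) ^ (δ * d) = (q : ℝ) ^ (-δ) * (q : ℝ) ^ (B * δ) := by
      rw [← Real.rpow_add hq0, hB]; congr 1; push_cast; ring
    rw [h2]; field_simp
  calc C * (1 / H + ((1 + 1 / δ) * (q : ℝ) ^ δ) ^ d / (l * (H : ℝ) ^ (d + 1)))
      ≤ C * (2 * (q : ℝ) ^ (-δ) + (1 + 1 / δ) ^ d * 2 ^ (d + 1) * (q : ℝ) ^ (-δ)) := by gcongr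
    _ = C₁ * (q : ℝ) ^ (-δ) := by rw [hC₁]; ring
    _ ≤ (max 1 C₁) ^ 2 ^ d * (q : ℝ) ^ (-δ) := by
        gcongr
        exact (le_max_right 1 C₁).trans (le_self_pow₀ (le_max_left _ _) (by positivity))
    _ = (max 1 C₁ * (q : ℝ) ^ (-(δ / 2 ^ (d + 1 - 1)))) ^ 2 ^ d := by
        rw [mul_pow, ← Real.rpow_mul_natCast hq0.le]
        congr 2
        push_cast
        field_simp

open Finset in
/-- The residues `c y ^ b mod q`, `y ≤ Y`, are equidistributed with a power saving. -/
lemma abs_card_filter_mod_le_sub {b : ℕ} (hb : 1 < b) {δ : ℝ} (hδ : 0 < δ)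
    (hδb : 8 * (b : ℝ) ^ 2 * δ ≤ 1) :
    ∃ C : ℝ, 0 < C ∧ ∃ Q : ℕ, ∀ q : ℕ, Q ≤ q → ∀ c : ℕ, 1 ≤ c → (c : ℝ) ≤ (q : ℝ) ^ δ →
      ∀ Y : ℕ, ⌊(q : ℝ) ^ (1 / (b : ℝ) + δ)⌋₊ ≤ Y → ∀ n < q,
      |(((range Y).filter fun i ↦ (c * (i + 1) ^ b) % q ≤ n).card : ℝ) - Y * n / q| ≤
        C * Y * (q : ℝ) ^ (-(δ / 2 ^ b)) := by
  obtain ⟨C₁, hC₁, Q₁, hW⟩ := norm_sum_expPhase_pow_le hb hδ hδb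
  obtain ⟨C₂, hC₂, hD⟩ := discrepancy_le
  set γ : ℝ := δ / 2 ^ (b - 1) with hγ
  have hγ0 : 0 < γ := by positivity
  obtain ⟨Q₂, hQ₂⟩ := exists_forall_le_rpow (C₁ + 1) hγ0
  have hγδ : γ ≤ δ / 2 := by
    rw [hγ]
    have : (2 : ℝ) ^ 1 ≤ 2 ^ (b - 1) := pow_le_pow_right₀ (by norm_num) (by omega)
    exact div_le_div_of_nonneg_left hδ.le (by norm_num) (by linarith)
  have hb2 : (2 : ℝ) ≤ b := by exact_mod_cast hb
  have hδ1 : δ ≤ 1 := by nlinarith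
  have hγ2 : δ / 2 ^ b = γ / 2 := by
    rw [hγ, div_div, ← pow_succ, Nat.sub_add_cancel hb.le]
  refine ⟨C₂ * √(C₁ + 1) + 1, by positivity, max 1 (max Q₁ Q₂),
    fun q hq c hc hcq Y hY n hn ↦ ?_⟩
  have hq1 : (1 : ℝ) ≤ q := by exact_mod_cast (le_max_left _ _).trans hq
  have hq0 : (0 : ℝ) < q := by linarith
  have hqW := hW q ((le_max_left _ _).trans ((le_max_right _ _).trans hq))
  have hqQ := hQ₂ q ((le_max_right _ _).trans ((le_max_right _ _).trans hq))
  have hpow : ((q : ℝ) ^ δ) ^ (-(1 / 2) : ℝ) ≤ (q : ℝ) ^ (-γ) := by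
    rw [← Real.rpow_mul hq0.le]
    exact Real.rpow_le_rpow_of_exponent_le hq1 (by linarith)
  have hsum : C₁ * (q : ℝ) ^ (-γ) + ((q : ℝ) ^ δ) ^ (-(1 / 2) : ℝ) ≤ (C₁ + 1) * (q : ℝ) ^ (-γ) := by
    linarith
  have hle1 : (C₁ + 1) * (q : ℝ) ^ (-γ) ≤ 1 := by
    rw [Real.rpow_neg hq0.le, ← div_eq_mul_inv, div_le_one (by positivity)]
    exact hqQ
  have hn1 : (n : ℝ) + 1 ≤ q := by exact_mod_cast hn
  have key := hD (range Y) (fun i ↦ ((c * (i + 1) ^ b : ℕ) : ℝ) / q) (C₁ * (q : ℝ) ^ (-γ))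
    ((q : ℝ) ^ δ) (by positivity) (Real.one_le_rpow hq1 hδ.le) (hsum.trans hle1)
    (fun h hh hhq ↦ by rw [card_range]; exact hqW h c hh hc hhq hcq Y hY)
    ((n + 1) / q) (by positivity) ((div_le_one hq0).2 hn1)
  rw [card_range] at key
  have hfilter : (range Y).filter (fun i ↦ Int.fract (((c * (i + 1) ^ b : ℕ) : ℝ) / q) <
      ((n : ℝ) + 1) / q) = (range Y).filter fun i ↦ (c * (i + 1) ^ b) % q ≤ n := by
    refine filter_congr fun i _ ↦ ?_
    rw [Int.fract_div_natCast_eq_div_natCast_mod, div_lt_div_iff_of_pos_right hq0]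
    norm_cast
    omega
  rw [hfilter] at key
  have hsqrt : √(C₁ * (q : ℝ) ^ (-γ) + ((q : ℝ) ^ δ) ^ (-(1 / 2) : ℝ)) ≤
      √(C₁ + 1) * (q : ℝ) ^ (-(δ / 2 ^ b)) := by
    refine (Real.sqrt_le_sqrt hsum).trans (le_of_eq ?_)
    rw [Real.sqrt_mul (by positivity), Real.sqrt_eq_rpow ((q : ℝ) ^ (-γ)), ← Real.rpow_mul hq0.le,
      hγ2]
    congr 2; ring
  have hlast : (Y : ℝ) / q ≤ Y * (q : ℝ) ^ (-(δ / 2 ^ b)) := by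
    rw [div_eq_mul_inv, ← Real.rpow_neg_one]
    gcongr
    rw [hγ2]; linarith
  set A : ℝ := (((range Y).filter fun i ↦ (c * (i + 1) ^ b) % q ≤ n).card : ℝ)
  calc |A - Y * n / q| = |(A - (n + 1) / q * Y) + Y / q| := by congr 1; ring
    _ ≤ |A - (n + 1) / q * Y| + |(Y : ℝ) / q| := abs_add_le _ _
    _ ≤ C₂ * Y * (√(C₁ + 1) * (q : ℝ) ^ (-(δ / 2 ^ b))) + Y * (q : ℝ) ^ (-(δ / 2 ^ b)) := by
        rw [abs_of_nonneg (by positivity : (0 : ℝ) ≤ (Y : ℝ) / q)]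
        refine add_le_add (key.trans ?_) hlast
        gcongr
    _ = _ := by ring

lemma not_dvd_of_le_rpow {q c : ℕ} [hq : Fact q.Prime] {δ : ℝ} (hδ : δ < 1) (hc : 0 < c)
    (hcq : (c : ℝ) ≤ (q : ℝ) ^ δ) : ¬ q ∣ c := by
  intro hd
  have h1 : (q : ℝ) ≤ c := by exact_mod_cast Nat.le_of_dvd hc hd
  have h2 : (q : ℝ) ^ δ < (q : ℝ) ^ (1 : ℝ) :=
    Real.rpow_lt_rpow_of_exponent_lt (by exact_mod_cast hq.out.one_lt) hδ
  rw [Real.rpow_one] at h2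
  linarith

lemma mul_pow_mod_pos {q c n : ℕ} [hq : Fact q.Prime] (hc : ¬ q ∣ c) (hn : 0 < n) (hnq : n < q)
    (b : ℕ) : 0 < c * n ^ b % q := by
  refine Nat.pos_of_ne_zero fun h0 ↦ ?_
  rcases hq.out.dvd_mul.1 (Nat.dvd_of_mod_eq_zero h0) with h | h
  · exact hc h
  · have := Nat.le_of_dvd hn (hq.out.dvd_of_dvd_pow h)
    omega

open Finset in
lemma sum_zmod_eq_sum_Ioc {q : ℕ} [NeZero q] (f : ZMod q → ℂ) (h0 : f 0 = 0) :
    ∑ j, f j = ∑ n ∈ Ioc 0 (q - 1), f n := by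
  have hq := NeZero.pos q
  have h1 : ∑ j, f j = ∑ n ∈ range q, f n :=
    sum_nbij' ZMod.val (fun n ↦ (n : ZMod q)) (fun j _ ↦ mem_range.2 (ZMod.val_lt j))
      (fun n _ ↦ mem_univ _) (fun j _ ↦ ZMod.natCast_zmod_val j)
      (fun n hn ↦ ZMod.val_cast_of_lt (mem_range.1 hn)) (fun j _ ↦ by rw [ZMod.natCast_zmod_val])
  have h2 : range q = insert 0 (Ioc 0 (q - 1)) := by
    ext n; simp only [mem_range, mem_insert, mem_Ioc]; omega
  rw [h1, h2, sum_insert (by simp), Nat.cast_zero, h0, zero_add]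

lemma hurwitzZeta_toAddCircle_natCast {q : ℕ} [NeZero q] (n : ℕ) :
    HurwitzZeta.hurwitzZeta (ZMod.toAddCircle (n : ZMod q)) (1 / 2) = hurwitzHalf q n := by
  rw [ZMod.toAddCircle_natCast, hurwitzHalf]

lemma hurwitzHalf_mod (q n : ℕ) [NeZero q] : hurwitzHalf q (n % q) = hurwitzHalf q n := by
  rw [← hurwitzZeta_toAddCircle_natCast, ← hurwitzZeta_toAddCircle_natCast, ZMod.natCast_mod]

lemma LFunction_one_half {q : ℕ} [hq : Fact q.Prime] :
    DirichletCharacter.LFunction (1 : DirichletCharacter ℂ q) (1 / 2) =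
      (1 - (q : ℂ) ^ (-(1 / 2) : ℂ)) * riemannZeta (1 / 2) := by
  have := DirichletCharacter.LFunctionTrivChar_eq_mul_riemannZeta (N := q) (s := 1 / 2)
    (by norm_num)
  rwa [hq.out.primeFactors, Finset.prod_singleton] at this

lemma norm_natCast_cpow_neg_half {q : ℕ} (hq : 0 < q) :
    ‖(q : ℂ) ^ (-(1 / 2) : ℂ)‖ = (q : ℝ) ^ (-(1 / 2) : ℝ) := by
  rw [Complex.norm_natCast_cpow_of_pos hq]; norm_num

lemma norm_LFunction_one_half_le {q : ℕ} [hq : Fact q.Prime] :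
    ‖DirichletCharacter.LFunction (1 : DirichletCharacter ℂ q) (1 / 2)‖ ≤
      2 * ‖riemannZeta (1 / 2)‖ := by
  rw [LFunction_one_half, norm_mul]
  gcongr
  refine (norm_sub_le _ _).trans ?_
  rw [norm_natCast_cpow_neg_half hq.out.pos, norm_one]
  have := Real.rpow_le_one_of_one_le_of_nonpos (x := q) (z := -(1 / 2))
    (by exact_mod_cast hq.out.one_le) (by norm_num)
  linarith

open Finset in
lemma norm_sum_hurwitzHalf_le {q : ℕ} [hq : Fact q.Prime] :
    ‖∑ n ∈ Ioc 0 (q - 1), hurwitzHalf q n‖ ≤ 2 * ‖riemannZeta (1 / 2)‖ * (q : ℝ) ^ (1 / 2 : ℝ) := by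
  have hq0 : (0 : ℝ) < q := by exact_mod_cast hq.out.pos
  have h := norm_LFunction_one_half_le (q := q)
  rw [DirichletCharacter.LFunction, ZMod.LFunction,
    sum_zmod_eq_sum_Ioc _ (mul_eq_zero_of_left (MulChar.map_zero _) _), norm_mul,
    norm_natCast_cpow_neg_half hq.out.pos, Real.rpow_neg hq0.le,
    inv_mul_le_iff₀ (by positivity), mul_comm] at h
  refine le_trans (le_of_eq (congrArg _ (sum_congr rfl fun n hn ↦ ?_))) h
  have hn' := mem_Ioc.1 hn
  have : IsUnit (n : ZMod q) := by
    rw [isUnit_iff_ne_zero, Ne, ZMod.natCast_eq_zero_iff]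
    exact fun hd ↦ absurd (Nat.le_of_dvd hn'.1 hd) (by omega)
  rw [MulChar.one_apply this, one_mul, hurwitzZeta_toAddCircle_natCast]

open Finset in
/-- The twisted second moment over all characters as a sum of products of Hurwitz zeta values. -/
lemma sum_char_LFunction_eq {q b l₁ l₂ : ℕ} [hq : Fact q.Prime] (hb : b ≠ 0) (h₁ : ¬ q ∣ l₁)
    (h₂ : ¬ q ∣ l₂) :
    ∑ χ : DirichletCharacter ℂ q, χ (l₁ : ZMod q) * (χ (l₂ : ZMod q)) ^ b *
      DirichletCharacter.LFunction χ⁻¹ (1 / 2) * DirichletCharacter.LFunction (χ ^ b) (1 / 2) =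
    ((q : ℂ) - 1) * ((q : ℂ)⁻¹ * ∑ n ∈ Ioc 0 (q - 1),
      hurwitzHalf q n * hurwitzHalf q ((l₁ * l₂ ^ b * n ^ b) % q)) := by
  have hq0 : (q : ℂ) ≠ 0 := by exact_mod_cast hq.out.ne_zero
  set G : ZMod q → ℂ := fun j ↦ HurwitzZeta.hurwitzZeta (ZMod.toAddCircle j) (1 / 2) with hG
  set c : ZMod q := l₁ * l₂ ^ b with hc
  have hc0 : c ≠ 0 := by
    rw [← ZMod.natCast_eq_zero_iff] at h₁ h₂
    exact mul_ne_zero h₁ (pow_ne_zero _ h₂)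
  have hterm : ∀ χ : DirichletCharacter ℂ q, χ (l₁ : ZMod q) * (χ (l₂ : ZMod q)) ^ b *
      DirichletCharacter.LFunction χ⁻¹ (1 / 2) * DirichletCharacter.LFunction (χ ^ b) (1 / 2) =
      (q : ℂ)⁻¹ * ∑ y, ∑ j, G y * G j * (χ j⁻¹ * χ (c * y ^ b)) := by
    intro χ
    have hqq : (q : ℂ)⁻¹ = (q : ℂ) ^ (-(1 / 2) : ℂ) * (q : ℂ) ^ (-(1 / 2) : ℂ) := by
      rw [← Complex.cpow_add _ _ hq0, ← Complex.cpow_neg_one]; norm_num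
    have hsum : ∑ y, ∑ j, G y * G j * (χ j⁻¹ * χ (c * y ^ b)) = χ (l₁ : ZMod q) *
        (χ (l₂ : ZMod q)) ^ b * (∑ j, χ⁻¹ j * G j) * ∑ y, (χ ^ b) y * G y := by
      rw [mul_assoc _ (∑ j, χ⁻¹ j * G j), sum_mul_sum, sum_comm, mul_sum]
      refine sum_congr rfl fun j _ ↦ ?_
      rw [mul_sum]
      refine sum_congr rfl fun y _ ↦ ?_
      rw [MulChar.inv_apply', MulChar.pow_apply' _ hb, hc, map_mul, map_mul, map_pow, map_pow]
      ring
    rw [hsum, DirichletCharacter.LFunction, DirichletCharacter.LFunction, ZMod.LFunction,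
      ZMod.LFunction, hqq]
    ring
  have horth : ∀ y j : ZMod q, ∑ χ : DirichletCharacter ℂ q, χ j⁻¹ * χ (c * y ^ b) =
      if j ≠ 0 ∧ j = c * y ^ b then ((q : ℂ) - 1) else 0 := by
    intro y j
    by_cases hj : j = 0
    · simp [hj, MulChar.map_zero]
    · rw [DirichletCharacter.sum_char_inv_mul_char_eq ℂ (isUnit_iff_ne_zero.2 hj),
        Nat.totient_prime hq.out, Nat.cast_sub hq.out.one_le]
      simp [hj]
  simp_rw [hterm]
  rw [← mul_sum, sum_comm]
  have hin : ∀ y : ZMod q, ∑ χ : DirichletCharacter ℂ q, ∑ j, G y * G j *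
      (χ j⁻¹ * χ (c * y ^ b)) = ((q : ℂ) - 1) * if y = 0 then 0 else G y * G (c * y ^ b) := by
    intro y
    rw [sum_comm]
    simp_rw [← mul_sum, horth]
    by_cases hy : y = 0
    · simp only [hy, zero_pow hb, mul_zero, if_true]
      refine sum_eq_zero fun j _ ↦ ?_
      rw [if_neg (by tauto), mul_zero]
    · have hcy : c * y ^ b ≠ 0 := mul_ne_zero hc0 (pow_ne_zero _ hy)
      rw [sum_eq_single (c * y ^ b) (fun j _ hj ↦ by rw [if_neg (by tauto), mul_zero]) (by simp),
        if_pos ⟨hcy, rfl⟩, if_neg hy]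
      ring
  simp_rw [hin]
  rw [← mul_sum, sum_zmod_eq_sum_Ioc _ (by simp), mul_left_comm]
  congr 2
  refine sum_congr rfl fun n hn ↦ ?_
  have hn' := mem_Ioc.1 hn
  have hn0 : (n : ZMod q) ≠ 0 := by
    rw [Ne, ZMod.natCast_eq_zero_iff]
    exact fun hd ↦ absurd (Nat.le_of_dvd hn'.1 hd) (by omega)
  rw [if_neg hn0, hurwitzHalf_mod, ← hurwitzZeta_toAddCircle_natCast,
    ← hurwitzZeta_toAddCircle_natCast]
  push_cast
  rfl

open Finset in
/-- Cancellation in the sums of Hurwitz zeta values along the residues `c y ^ b mod q`. -/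
lemma norm_sum_hurwitzHalf_mod_le {b : ℕ} (hb : 1 < b) {δ : ℝ} (hδ : 0 < δ)
    (hδb : 8 * (b : ℝ) ^ 2 * δ ≤ 1) :
    ∃ η : ℝ, 0 < η ∧ ∃ C : ℝ, 0 < C ∧ ∃ Q : ℕ, ∀ (q : ℕ) [Fact q.Prime], Q ≤ q → ∀ c : ℕ, 1 ≤ c →
      (c : ℝ) ≤ (q : ℝ) ^ δ → ∀ Y : ℕ, ⌊(q : ℝ) ^ (1 / (b : ℝ) + δ)⌋₊ ≤ Y → Y < q →
      ‖∑ i ∈ range Y, hurwitzHalf q ((c * (i + 1) ^ b) % q)‖ ≤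
        C * (q : ℝ) ^ (1 / 2 - η) * (Y : ℝ) ^ (1 / 2 : ℝ) := by
  obtain ⟨C₁, hC₁, Q, hE⟩ := abs_card_filter_mod_le_sub hb hδ hδb
  obtain ⟨C₂, hC₂, hF⟩ := hurwitzHalf_bounds
  set γ : ℝ := δ / 2 ^ b with hγ
  have hγ0 : 0 < γ := by positivity
  have hb2 : (2 : ℝ) ≤ b := by exact_mod_cast hb
  have hγ1 : γ ≤ 1 := (div_le_self hδ.le (one_le_pow₀ (by norm_num))).trans (by nlinarith)
  have hδ1 : δ < 1 := by nlinarith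
  set Z : ℝ := ‖riemannZeta (1 / 2)‖
  set K : ℝ := C₂ * √(C₁ * b) * (2 * (1 + 1 / (γ / 4)))
  refine ⟨γ / 4, by positivity, K + 2 * Z, by positivity, Q,
    fun q hq hqQ c hc hcq Y hHY hY ↦ ?_⟩
  have hq1 : (1 : ℝ) ≤ q := by exact_mod_cast hq.out.one_le
  have hq0 : (0 : ℝ) < q := by linarith
  have hYq : (Y : ℝ) ≤ q := by exact_mod_cast hY.le
  have hqc : ¬ q ∣ c := not_dvd_of_le_rpow hδ1 hc hcq
  set x : ℕ → ℕ := fun i ↦ (c * (i + 1) ^ b) % q with hx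
  set N : ℕ → ℝ := fun n ↦ (((range Y).filter fun i ↦ x i = n).card : ℝ) with hN
  have hxmem : ∀ i ∈ range Y, x i ∈ Ioc 0 (q - 1) := by
    intro i hi
    have h1 : x i < q := Nat.mod_lt _ hq.out.pos
    have h2 : 0 < x i :=
      mul_pow_mod_pos hqc i.succ_pos (by have := mem_range.1 hi; omega) b
    rw [mem_Ioc]; omega
  have hcount : ∀ n ≤ q - 1, ∑ m ∈ Ioc 0 n, N m =
      ((range Y).filter fun i ↦ x i ≤ n).card := by
    intro n hn
    rw [hN, ← Nat.cast_sum]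
    congr 1
    rw [card_eq_sum_card_fiberwise (f := x) (t := Ioc 0 n)]
    · refine sum_congr rfl fun m hm ↦ congrArg _ ?_
      rw [filter_filter]
      refine filter_congr fun i _ ↦ ?_
      have := mem_Ioc.1 hm
      constructor
      · rintro rfl; exact ⟨this.2, rfl⟩
      · exact fun h ↦ h.2
    · intro i hi
      simp only [coe_filter, Set.mem_ofPred_eq] at hi
      have := mem_Ioc.1 (hxmem i hi.1)
      simp only [coe_Ioc, Set.mem_Ioc]
      exact ⟨this.1, hi.2⟩
  have hsum : ∑ i ∈ range Y, hurwitzHalf q (x i) =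
      ∑ n ∈ Ioc 0 (q - 1), hurwitzHalf q n * ((N n - Y / q : ℝ) : ℂ) +
        (Y / q : ℝ) * ∑ n ∈ Ioc 0 (q - 1), hurwitzHalf q n := by
    rw [← sum_fiberwise_of_maps_to hxmem, mul_sum, ← sum_add_distrib]
    refine sum_congr rfl fun n _ ↦ ?_
    rw [sum_congr rfl (g := fun _ ↦ hurwitzHalf q n) fun i hi ↦ by rw [(mem_filter.1 hi).2],
      sum_const, nsmul_eq_mul, hN]
    push_cast
    ring
  set T : ℝ := √(C₁ * b) * (Y : ℝ) ^ (1 / 2 : ℝ) * (q : ℝ) ^ (-(γ / 2)) with hT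
  have hpart : ∀ n, 0 ≤ n → n ≤ q - 1 →
      ‖∑ m ∈ Ioc 0 n, ((N m - Y / q : ℝ) : ℂ)‖ ≤ T * (n : ℝ) ^ (1 / 2 : ℝ) := by
    intro n _ hn
    have hnq : n < q := by have := hq.out.pos; omega
    rw [← Complex.ofReal_sum, Complex.norm_real, sum_sub_distrib, hcount n hn, sum_const,
      Nat.card_Ioc, Nat.sub_zero, nsmul_eq_mul, Real.norm_eq_abs]
    set A : ℝ := (((range Y).filter fun i ↦ x i ≤ n).card : ℝ) with hA
    have h1 : |A - n * (Y / q)| ≤ C₁ * Y * (q : ℝ) ^ (-γ) := by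
      have := hE q hqQ c hc hcq Y hHY n hnq
      rwa [mul_comm (Y : ℝ) n, mul_div_assoc] at this
    have h2 : |A - n * (Y / q)| ≤ b * n := by
      have h3 : A ≤ b * n := by
        rw [hA]
        exact_mod_cast card_filter_mul_pow_mod_le (by omega : 0 < b) hqc hY n
      have h4 : (Y : ℝ) / q ≤ 1 := (div_le_one hq0).2 hYq
      have h5 : 0 ≤ A := by positivity
      have h6 : 0 ≤ (n : ℝ) * (Y / q) := by positivity
      have h7 : (n : ℝ) * (Y / q) ≤ n * 1 := by gcongr
      have h8 : (n : ℝ) * 1 ≤ n * b := by gcongr; linarith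
      rw [abs_le]; constructor <;> linarith
    have h3 : |A - n * (Y / q)| ≤ √((C₁ * Y * (q : ℝ) ^ (-γ)) * (b * n)) := by
      refine Real.le_sqrt_of_sq_le ?_
      rw [sq]
      exact mul_le_mul h1 h2 (abs_nonneg _) (by positivity)
    refine h3.trans (le_of_eq ?_)
    rw [hT, show C₁ * Y * (q : ℝ) ^ (-γ) * (b * n) = (C₁ * b) * Y * (q : ℝ) ^ (-γ) * n by ring,
      Real.sqrt_mul (by positivity), Real.sqrt_mul (by positivity), Real.sqrt_mul (by positivity),
      Real.sqrt_eq_rpow (Y : ℝ), Real.sqrt_eq_rpow (n : ℝ), Real.sqrt_eq_rpow ((q : ℝ) ^ (-γ)),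
      ← Real.rpow_mul hq0.le]
    congr 3; ring
  have hq2 := hq.out.two_le
  have habel := norm_sum_mul_le_of_partial_sums (w := hurwitzHalf q)
    (a := fun n ↦ ((N n - Y / q : ℝ) : ℂ)) (zero_le : 0 ≤ q - 1) (by omega)
    (D := C₂ * (q : ℝ) ^ (1 / 2 : ℝ)) (T := T) (by positivity) (by positivity)
    (fun n hn hnq ↦ (hF q n hn (by omega)).2.1) (fun n hn hnq ↦ (hF q n hn (by omega)).2.2) hpart
  have hlog : 2 + Real.log ((q - 1 : ℕ) : ℝ) ≤ 2 * (1 + 1 / (γ / 4)) * (q : ℝ) ^ (γ / 4) := by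
    have h1 := one_add_log_le hq1 (by positivity : 0 < γ / 4)
    have h2 : Real.log ((q - 1 : ℕ) : ℝ) ≤ Real.log q :=
      Real.log_le_log (by exact_mod_cast (by omega : 0 < q - 1)) (by exact_mod_cast Nat.sub_le _ _)
    have h3 := Real.log_nonneg hq1
    linarith
  have hexp1 : (q : ℝ) ^ (1 / 2 - γ / 4) =
      (q : ℝ) ^ (1 / 2 : ℝ) * (q : ℝ) ^ (-(γ / 2)) * (q : ℝ) ^ (γ / 4) := by
    rw [← Real.rpow_add hq0, ← Real.rpow_add hq0]; congr 1; ring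
  have hmain : ‖∑ n ∈ Ioc 0 (q - 1), hurwitzHalf q n * ((N n - Y / q : ℝ) : ℂ)‖ ≤
      K * (q : ℝ) ^ (1 / 2 - γ / 4) * (Y : ℝ) ^ (1 / 2 : ℝ) := by
    refine (habel.trans (mul_le_mul_of_nonneg_left hlog (by positivity))).trans (le_of_eq ?_)
    rw [hT, hexp1]; ring
  have htriv : ‖((Y / q : ℝ) : ℂ) * ∑ n ∈ Ioc 0 (q - 1), hurwitzHalf q n‖ ≤
      2 * Z * (q : ℝ) ^ (1 / 2 - γ / 4) * (Y : ℝ) ^ (1 / 2 : ℝ) := by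
    rw [norm_mul, Complex.norm_real, Real.norm_of_nonneg (by positivity)]
    have h1 : (Y : ℝ) / q * (q : ℝ) ^ (1 / 2 : ℝ) ≤ (Y : ℝ) ^ (1 / 2 : ℝ) := by
      have e1 : (Y : ℝ) = (Y : ℝ) ^ (1 / 2 : ℝ) * (Y : ℝ) ^ (1 / 2 : ℝ) := by
        rw [← Real.sqrt_eq_rpow, Real.mul_self_sqrt (by positivity)]
      have e2 : (q : ℝ) = (q : ℝ) ^ (1 / 2 : ℝ) * (q : ℝ) ^ (1 / 2 : ℝ) := by
        rw [← Real.sqrt_eq_rpow, Real.mul_self_sqrt (by positivity)]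
      have e3 : (Y : ℝ) ^ (1 / 2 : ℝ) ≤ (q : ℝ) ^ (1 / 2 : ℝ) := by gcongr
      rw [div_mul_eq_mul_div, div_le_iff₀ hq0]
      nth_rewrite 1 [e1]
      nth_rewrite 2 [e2]
      rw [mul_assoc]
      gcongr
    have h2 : 1 ≤ (q : ℝ) ^ (1 / 2 - γ / 4) := Real.one_le_rpow hq1 (by linarith)
    calc (Y : ℝ) / q * ‖∑ n ∈ Ioc 0 (q - 1), hurwitzHalf q n‖
        ≤ Y / q * (2 * Z * (q : ℝ) ^ (1 / 2 : ℝ)) := by gcongr; exact norm_sum_hurwitzHalf_le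
      _ = 2 * Z * (Y / q * (q : ℝ) ^ (1 / 2 : ℝ)) := by ring
      _ ≤ 2 * Z * (1 * (Y : ℝ) ^ (1 / 2 : ℝ)) := by rw [one_mul]; gcongr
      _ ≤ 2 * Z * ((q : ℝ) ^ (1 / 2 - γ / 4) * (Y : ℝ) ^ (1 / 2 : ℝ)) := by gcongr
      _ = _ := by ring
  rw [hsum]
  refine (norm_add_le _ _).trans ((add_le_add hmain htriv).trans (le_of_eq ?_))
  ring

open Finset in
lemma sum_Ioc_eq_sum_range_sub (a : ℕ → ℂ) {m n : ℕ} (h : m ≤ n) :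
    ∑ i ∈ Ioc m n, a i = ∑ i ∈ range n, a (i + 1) - ∑ i ∈ range m, a (i + 1) := by
  induction n, h using Nat.le_induction with
  | base => simp
  | succ n hn ih => rw [sum_Ioc_succ_top (by omega), ih, sum_range_succ]; ring

lemma floor_rpow_lt {b : ℕ} (hb : 1 < b) {δ : ℝ} (hδb : 8 * (b : ℝ) ^ 2 * δ ≤ 1)
    {q : ℕ} (hq : 1 < q) : ⌊(q : ℝ) ^ (1 / (b : ℝ) + δ)⌋₊ < q := by
  have hb2 : (2 : ℝ) ≤ b := by exact_mod_cast hb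
  rw [Nat.floor_lt (by positivity)]
  conv_rhs => rw [← Real.rpow_one (q : ℝ)]
  refine Real.rpow_lt_rpow_of_exponent_lt (by exact_mod_cast hq) ?_
  have h1 : 1 / (b : ℝ) ≤ 1 / 2 := one_div_le_one_div_of_le (by norm_num) hb2
  nlinarith

open Finset in
/-- The large `n` contribute a power saving. -/
lemma norm_sum_hurwitzHalf_mul_large_le {b : ℕ} (hb : 1 < b) {δ : ℝ} (hδ : 0 < δ)
    (hδb : 8 * (b : ℝ) ^ 2 * δ ≤ 1) :
    ∃ η : ℝ, 0 < η ∧ ∃ C : ℝ, 0 < C ∧ ∃ Q : ℕ, ∀ (q : ℕ) [Fact q.Prime], Q ≤ q → ∀ c : ℕ, 1 ≤ c →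
      (c : ℝ) ≤ (q : ℝ) ^ δ →
      ‖∑ n ∈ Ioc ⌊(q : ℝ) ^ (1 / (b : ℝ) + δ)⌋₊ (q - 1),
        hurwitzHalf q n * hurwitzHalf q ((c * n ^ b) % q)‖ ≤ C * (q : ℝ) ^ (1 - η) := by
  obtain ⟨η, hη, C₁, hC₁, Q, hE⟩ := norm_sum_hurwitzHalf_mod_le hb hδ hδb
  obtain ⟨C₂, hC₂, hF⟩ := hurwitzHalf_bounds
  refine ⟨η / 2, by positivity, C₂ * (2 * C₁) * (2 * (1 + 1 / (η / 2))), by positivity, Q,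
    fun q hq hqQ c hc hcq ↦ ?_⟩
  have hq1 : (1 : ℝ) ≤ q := by exact_mod_cast hq.out.one_le
  have hq0 : (0 : ℝ) < q := by linarith
  have hq2 := hq.out.two_le
  set H : ℕ := ⌊(q : ℝ) ^ (1 / (b : ℝ) + δ)⌋₊ with hH
  have hHq : H < q := floor_rpow_lt hb hδb hq.out.one_lt
  have hpart : ∀ n, H ≤ n → n ≤ q - 1 →
      ‖∑ i ∈ Ioc H n, hurwitzHalf q ((c * i ^ b) % q)‖ ≤
        2 * C₁ * (q : ℝ) ^ (1 / 2 - η) * (n : ℝ) ^ (1 / 2 : ℝ) := by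
    intro n hHn hn
    rw [sum_Ioc_eq_sum_range_sub (fun i ↦ hurwitzHalf q ((c * i ^ b) % q)) hHn]
    have h1 := hE q hqQ c hc hcq n hHn (by omega)
    have h2 := hE q hqQ c hc hcq H le_rfl hHq
    have h3 : (H : ℝ) ^ (1 / 2 : ℝ) ≤ (n : ℝ) ^ (1 / 2 : ℝ) := by gcongr
    have h4 : C₁ * (q : ℝ) ^ (1 / 2 - η) * (H : ℝ) ^ (1 / 2 : ℝ) ≤
      C₁ * (q : ℝ) ^ (1 / 2 - η) * (n : ℝ) ^ (1 / 2 : ℝ) := by gcongr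
    refine (norm_sub_le _ _).trans ?_
    linarith
  have habel := norm_sum_mul_le_of_partial_sums (w := hurwitzHalf q)
    (a := fun i ↦ hurwitzHalf q ((c * i ^ b) % q)) (by omega : H ≤ q - 1) (by omega)
    (D := C₂ * (q : ℝ) ^ (1 / 2 : ℝ)) (by positivity) (by positivity)
    (fun n hn hnq ↦ (hF q n hn (by omega)).2.1) (fun n hn hnq ↦ (hF q n hn (by omega)).2.2) hpart
  have hlog : 2 + Real.log ((q - 1 : ℕ) : ℝ) ≤ 2 * (1 + 1 / (η / 2)) * (q : ℝ) ^ (η / 2) := by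
    have h1 := one_add_log_le hq1 (by positivity : 0 < η / 2)
    have h2 : Real.log ((q - 1 : ℕ) : ℝ) ≤ Real.log q :=
      Real.log_le_log (by exact_mod_cast (by omega : 0 < q - 1)) (by exact_mod_cast Nat.sub_le _ _)
    have h3 := Real.log_nonneg hq1
    linarith
  refine (habel.trans (mul_le_mul_of_nonneg_left hlog (by positivity))).trans (le_of_eq ?_)
  have hexp : (q : ℝ) ^ (1 - η / 2) =
      (q : ℝ) ^ (1 / 2 : ℝ) * (q : ℝ) ^ (1 / 2 - η) * (q : ℝ) ^ (η / 2) := by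
    rw [← Real.rpow_add hq0, ← Real.rpow_add hq0]; congr 1; ring
  rw [hexp]; ring

open Finset in
lemma sum_Ioc_rpow_neg_half_le (H : ℕ) :
    ∑ n ∈ Ioc 0 H, (n : ℝ) ^ (-(1 / 2) : ℝ) ≤ 2 * (H : ℝ) ^ (1 / 2 : ℝ) := by
  induction H with
  | zero => simp
  | succ H ih =>
    rw [sum_Ioc_succ_top (by omega)]
    refine (add_le_add_left ih _).trans ?_
    rw [Real.rpow_neg (by positivity), ← Real.sqrt_eq_rpow, ← Real.sqrt_eq_rpow]
    have h0 : (0 : ℝ) < √((H + 1 : ℕ) : ℝ) := Real.sqrt_pos.2 (by positivity)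
    have h1 : √((H + 1 : ℕ) : ℝ) * √((H + 1 : ℕ) : ℝ) = H + 1 := by
      rw [Real.mul_self_sqrt (by positivity)]; push_cast; ring
    have h2 : √(H : ℝ) * √(H : ℝ) = H := Real.mul_self_sqrt (by positivity)
    have h3 : (√((H + 1 : ℕ) : ℝ))⁻¹ * √((H + 1 : ℕ) : ℝ) = 1 := inv_mul_cancel₀ h0.ne'
    refine le_of_mul_le_mul_right ?_ h0
    rw [add_mul, h3]
    nlinarith [sq_nonneg (√((H + 1 : ℕ) : ℝ) - √(H : ℝ))]

open Finset in
lemma sum_mul_rpow_neg_half_le {G : Finset ℕ} {x : ℕ → ℕ} {V : ℝ} (hV : 0 < V) {H : ℕ}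
    (hG : ∀ n ∈ G, V ≤ n ∧ n ≤ H ∧ 1 ≤ x n)
    (hx : ∀ m ∈ G, ∀ n ∈ G, m < n → V * (n - m : ℕ) ≤ x n) :
    ∑ n ∈ G, (n : ℝ) ^ (-(1 / 2) : ℝ) * (x n : ℝ) ^ (-(1 / 2) : ℝ) ≤
      V ^ (-(1 / 2) : ℝ) + 2 * V ^ (-1 : ℝ) * (H : ℝ) ^ (1 / 2 : ℝ) := by
  rcases G.eq_empty_or_nonempty with rfl | hne
  · rw [sum_empty]; positivity
  set m := G.min' hne with hm
  have hmG : m ∈ G := G.min'_mem hne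
  have hanti : ∀ {s t : ℝ}, 0 < s → s ≤ t → t ^ (-(1 / 2) : ℝ) ≤ s ^ (-(1 / 2) : ℝ) :=
    fun hs hst ↦ Real.rpow_le_rpow_of_nonpos hs hst (by norm_num)
  have hlt : ∀ n ∈ G.erase m, m < n := fun n hn ↦
    lt_of_le_of_ne (G.min'_le n (mem_of_mem_erase hn)) (ne_of_mem_erase hn).symm
  rw [← add_sum_erase G _ hmG]
  refine add_le_add ?_ ?_
  · have h1 : (x m : ℝ) ^ (-(1 / 2) : ℝ) ≤ 1 :=
      Real.rpow_le_one_of_one_le_of_nonpos (by exact_mod_cast (hG m hmG).2.2) (by norm_num)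
    have h2 := hanti hV (hG m hmG).1
    calc _ ≤ V ^ (-(1 / 2) : ℝ) * 1 := by gcongr
      _ = _ := mul_one _
  · calc ∑ n ∈ G.erase m, (n : ℝ) ^ (-(1 / 2) : ℝ) * (x n : ℝ) ^ (-(1 / 2) : ℝ)
        ≤ ∑ n ∈ G.erase m, V ^ (-1 : ℝ) * ((n - m : ℕ) : ℝ) ^ (-(1 / 2) : ℝ) := by
          refine sum_le_sum fun n hn ↦ ?_
          have hnG := mem_of_mem_erase hn
          have hnm : (0 : ℝ) < (n - m : ℕ) := by exact_mod_cast Nat.sub_pos_of_lt (hlt n hn)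
          have h1 := hanti hV (hG n hnG).1
          have h2 := hanti (by positivity) (hx m hmG n hnG (hlt n hn))
          rw [Real.mul_rpow hV.le hnm.le] at h2
          calc _ ≤ V ^ (-(1 / 2) : ℝ) *
                (V ^ (-(1 / 2) : ℝ) * ((n - m : ℕ) : ℝ) ^ (-(1 / 2) : ℝ)) := by gcongr
            _ = _ := by rw [← mul_assoc, ← Real.rpow_add hV]; norm_num
      _ = V ^ (-1 : ℝ) * ∑ j ∈ (G.erase m).image (fun n ↦ n - m), (j : ℝ) ^ (-(1 / 2) : ℝ) := by
          rw [← mul_sum, sum_image]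
          intro n hn n' hn' h
          have h1 := hlt n hn
          have h2 := hlt n' hn'
          simp only at h
          omega
      _ ≤ V ^ (-1 : ℝ) * ∑ j ∈ Ioc 0 H, (j : ℝ) ^ (-(1 / 2) : ℝ) := by
          gcongr
          intro j hj
          obtain ⟨n, hn, rfl⟩ := mem_image.1 hj
          have h1 := hlt n hn
          have h2 := (hG n (mem_of_mem_erase hn)).2.1
          rw [mem_Ioc]; omega
      _ ≤ V ^ (-1 : ℝ) * (2 * (H : ℝ) ^ (1 / 2 : ℝ)) := by
          gcongr
          exact sum_Ioc_rpow_neg_half_le H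
      _ = _ := by ring

open Finset in
/-- The main term: the small `n` reproduce the zeta value up to a power saving. -/
lemma abs_sum_rpow_mod_sub_le {b : ℕ} (hb : 1 < b) {δ : ℝ} (hδ : 0 < δ)
    (hδb : 8 * (b : ℝ) ^ 2 * δ ≤ 1) :
    ∃ C : ℝ, 0 < C ∧ ∀ (q : ℕ) [Fact q.Prime] (c : ℕ), 1 ≤ c → (c : ℝ) ≤ (q : ℝ) ^ δ →
      |∑ n ∈ Ioc 0 ⌊(q : ℝ) ^ (1 / (b : ℝ) + δ)⌋₊,
          (n : ℝ) ^ (-(1 / 2) : ℝ) * ((c * n ^ b % q : ℕ) : ℝ) ^ (-(1 / 2) : ℝ) -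
        (∑' n : ℕ, (n : ℝ) ^ (-(((b : ℝ) + 1) / 2))) * (c : ℝ) ^ (-(1 / 2) : ℝ)| ≤
        C * (q : ℝ) ^ (-(1 / (8 * (b : ℝ)))) := by
  have hb2 : (2 : ℝ) ≤ b := by exact_mod_cast hb
  have hb0 : (0 : ℝ) < b := by linarith
  set f : ℕ → ℝ := fun n ↦ (n : ℝ) ^ (-(((b : ℝ) + 1) / 2)) with hf
  set g : ℕ → ℝ := fun n ↦ (n : ℝ) ^ (-(5 / 4) : ℝ) with hg
  have hfs : Summable f := Real.summable_nat_rpow.2 (by linarith)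
  have hgs : Summable g := Real.summable_nat_rpow.2 (by norm_num)
  have hg0 : 0 ≤ ∑' n, g n := tsum_nonneg fun n ↦ by positivity
  refine ⟨∑' n, g n + 3, by positivity, fun q hq c hc hcq ↦ ?_⟩
  have hq1 : (1 : ℝ) ≤ q := by exact_mod_cast hq.out.one_le
  have hq0 : (0 : ℝ) < q := by linarith
  have hc0 : (0 : ℝ) < c := by exact_mod_cast hc
  have hc1 : (1 : ℝ) ≤ c := by exact_mod_cast hc
  set u : ℝ := 1 / (b : ℝ) with hu
  have hub : u * b = 1 := one_div_mul_cancel hb0.ne'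
  have hu0 : 0 < u := by positivity
  have hu2 : u ≤ 1 / 2 := one_div_le_one_div_of_le (by norm_num) hb2
  have hbδ : b * δ ≤ u / 8 := by nlinarith
  have hδu : δ ≤ u / 16 := by nlinarith
  have hδu2 : δ * u ≤ u / 32 := by nlinarith
  have hη : 1 / (8 * (b : ℝ)) = u / 8 := by rw [hu]; field_simp
  rw [hη]
  have hH1 : (⌊(q : ℝ) ^ (u + δ)⌋₊ : ℝ) ≤ (q : ℝ) ^ (u + δ) := Nat.floor_le (by positivity)
  have hH2 : (q : ℝ) ^ (u + δ) < ⌊(q : ℝ) ^ (u + δ)⌋₊ + 1 := Nat.lt_floor_add_one _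
  have hHq : ⌊(q : ℝ) ^ (u + δ)⌋₊ < q := floor_rpow_lt hb hδb hq.out.one_lt
  set H : ℕ := ⌊(q : ℝ) ^ (u + δ)⌋₊ with hH
  set V : ℝ := (q : ℝ) ^ ((1 - δ) * u) with hV
  have hV0 : 0 < V := by positivity
  have hVle : ∀ n : ℕ, q ≤ c * n ^ b → V ≤ n := by
    intro n hn
    have h1 : (q : ℝ) ≤ c * (n : ℝ) ^ b := by exact_mod_cast hn
    refine le_of_pow_le_pow_left₀ (n := b) (by omega) (by positivity) ?_
    rw [hV, ← Real.rpow_mul_natCast hq0.le, mul_assoc, hub, mul_one, Real.rpow_sub hq0,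
      Real.rpow_one, div_le_iff₀ (by positivity), mul_comm]
    exact h1.trans (by gcongr)
  have hHV : ∀ n : ℕ, H < n → q ≤ c * n ^ b := by
    intro n hn
    have h1 : (q : ℝ) ^ u ≤ n := by
      have h2 : (q : ℝ) ^ u ≤ (q : ℝ) ^ (u + δ) :=
        Real.rpow_le_rpow_of_exponent_le hq1 (by linarith)
      have h3 : (H : ℝ) + 1 ≤ n := by exact_mod_cast hn
      linarith
    have h4 : (q : ℝ) ≤ (n : ℝ) ^ b := by
      calc (q : ℝ) = ((q : ℝ) ^ u) ^ b := by
            rw [← Real.rpow_mul_natCast hq0.le, hub, Real.rpow_one]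
        _ ≤ _ := by gcongr
    have h5 : q ≤ n ^ b := by exact_mod_cast h4
    exact h5.trans (Nat.le_mul_of_pos_left _ hc)
  set t : ℕ → ℝ := fun n ↦ (n : ℝ) ^ (-(1 / 2) : ℝ) *
    ((c * n ^ b % q : ℕ) : ℝ) ^ (-(1 / 2) : ℝ) with ht
  set s : Finset ℕ := (Ioc 0 H).filter fun n ↦ c * n ^ b < q with hs
  have hmain : ∑ n ∈ s, t n = (∑ n ∈ s, f n) * (c : ℝ) ^ (-(1 / 2) : ℝ) := by
    rw [sum_mul]
    refine sum_congr rfl fun n hn ↦ ?_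
    obtain ⟨hn1, hn2⟩ := mem_filter.1 hn
    have hn0 : (0 : ℝ) < n := by exact_mod_cast (mem_Ioc.1 hn1).1
    rw [ht, hf]
    simp only
    rw [Nat.mod_eq_of_lt hn2]
    push_cast
    rw [Real.mul_rpow hc0.le (by positivity), ← Real.rpow_natCast_mul hn0.le, mul_left_comm,
      ← Real.rpow_add hn0, mul_comm]
    congr 2; ring
  have htail : ∑' n, f n ≤ ∑ n ∈ s, f n + V ^ (-(1 / 4) : ℝ) * ∑' n, g n := by
    have h1 : HasSum (fun n ↦ if n ∈ s then f n else 0) (∑ n ∈ s, f n) := by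
      rw [sum_congr rfl (g := fun n ↦ if n ∈ s then f n else 0) fun n hn ↦ (if_pos hn).symm]
      exact hasSum_sum_of_ne_finset_zero fun n hn ↦ if_neg hn
    refine hasSum_le (fun n ↦ ?_) hfs.hasSum
      (h1.add (hgs.hasSum.mul_left (V ^ (-(1 / 4) : ℝ))))
    by_cases hns : n ∈ s
    · simp only [if_pos hns]
      have : 0 ≤ V ^ (-(1 / 4) : ℝ) * g n := by positivity
      linarith
    · simp only [if_neg hns, zero_add]
      rcases Nat.eq_zero_or_pos n with rfl | hn0
      · rw [hf]
        simp only [Nat.cast_zero]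
        rw [Real.zero_rpow (ne_of_lt (by linarith))]
        positivity
      · have hn1 : (1 : ℝ) ≤ n := by exact_mod_cast hn0
        have hq : q ≤ c * n ^ b := by
          by_contra hlt
          rcases le_or_gt n H with h | h
          · exact hns (mem_filter.2 ⟨mem_Ioc.2 ⟨hn0, h⟩, by omega⟩)
          · exact hlt (hHV n h)
        have h2 : (n : ℝ) ^ (-(1 / 4) : ℝ) ≤ V ^ (-(1 / 4) : ℝ) :=
          Real.rpow_le_rpow_of_nonpos hV0 (hVle n hq) (by norm_num)
        calc f n ≤ (n : ℝ) ^ (-(1 / 4) + -(5 / 4) : ℝ) :=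
              Real.rpow_le_rpow_of_exponent_le hn1 (by linarith)
          _ = (n : ℝ) ^ (-(1 / 4) : ℝ) * g n := Real.rpow_add (by positivity) _ _
          _ ≤ _ := by gcongr
  have htail' : ∑ n ∈ s, f n ≤ ∑' n, f n := hfs.sum_le_tsum s fun n _ ↦ by positivity
  have hVu : V ^ (-(1 / 4) : ℝ) ≤ (q : ℝ) ^ (-(u / 8)) := by
    rw [hV, ← Real.rpow_mul hq0.le]
    exact Real.rpow_le_rpow_of_exponent_le hq1 (by linarith)
  have hc1' : (c : ℝ) ^ (-(1 / 2) : ℝ) ≤ 1 :=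
    Real.rpow_le_one_of_one_le_of_nonpos hc1 (by norm_num)
  set K : ℕ := c * H ^ b / q with hK
  have hrest : ∑ n ∈ (Ioc 0 H).filter (fun n ↦ ¬ c * n ^ b < q), t n ≤
      K * (V ^ (-(1 / 2) : ℝ) + 2 * V ^ (-1 : ℝ) * (H : ℝ) ^ (1 / 2 : ℝ)) := by
    have hmaps : ∀ n ∈ (Ioc 0 H).filter (fun n ↦ ¬ c * n ^ b < q), c * n ^ b / q ∈ Icc 1 K := by
      intro n hn
      obtain ⟨h1, h2⟩ := mem_filter.1 hn
      rw [mem_Icc]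
      refine ⟨(Nat.one_le_div_iff hq.out.pos).2 (by omega), Nat.div_le_div_right ?_⟩
      have := (mem_Ioc.1 h1).2
      gcongr
    rw [← sum_fiberwise_of_maps_to hmaps]
    refine (sum_le_card_nsmul _ _
      (V ^ (-(1 / 2) : ℝ) + 2 * V ^ (-1 : ℝ) * (H : ℝ) ^ (1 / 2 : ℝ)) fun k hk ↦ ?_).trans (le_of_eq ?_)
    · have hk1 := (mem_Icc.1 hk).1
      have hmem : ∀ n ∈ ((Ioc 0 H).filter (fun n ↦ ¬ c * n ^ b < q)).filter
          (fun n ↦ c * n ^ b / q = k), (0 < n ∧ n ≤ H) ∧ q ≤ c * n ^ b ∧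
            q * k + c * n ^ b % q = c * n ^ b ∧ 1 ≤ c * n ^ b % q := by
        intro n hn
        simp only [mem_filter, mem_Ioc, not_lt] at hn
        obtain ⟨⟨h1, h2⟩, h3⟩ := hn
        refine ⟨h1, h2, h3 ▸ Nat.div_add_mod _ _,
          mul_pow_mod_pos (not_dvd_of_le_rpow (by linarith) hc hcq) h1.1 (by omega) b⟩
      refine sum_mul_rpow_neg_half_le (x := fun n ↦ c * n ^ b % q) hV0
        (fun n hn ↦ ⟨hVle n (hmem n hn).2.1, (hmem n hn).1.2, (hmem n hn).2.2.2⟩) ?_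
      intro m hm n hn hmn
      obtain ⟨⟨hm0, -⟩, hm1, hm2, hm3⟩ := hmem m hm
      obtain ⟨-, -, hn2, -⟩ := hmem n hn
      obtain ⟨j, rfl⟩ : ∃ j, n = m + j := ⟨n - m, by omega⟩
      obtain ⟨d, rfl⟩ : ∃ d, b = d + 2 := ⟨b - 2, by omega⟩
      have h1 : m ^ (d + 2) + m * j ≤ (m + j) ^ (d + 2) := by
        have h2 : m ^ (d + 1) ≤ (m + j) ^ (d + 1) := by gcongr
        have h3 : m ≤ m ^ (d + 1) := Nat.le_self_pow (by omega) m
        calc m ^ (d + 2) + m * j ≤ m ^ (d + 1) * m + m ^ (d + 1) * j := by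
              rw [pow_succ]; gcongr
          _ = m ^ (d + 1) * (m + j) := by ring
          _ ≤ (m + j) ^ (d + 1) * (m + j) := by gcongr
          _ = _ := by ring
      have h4 : c * m ^ (d + 2) + m * j ≤ c * (m + j) ^ (d + 2) := by
        calc c * m ^ (d + 2) + m * j ≤ c * m ^ (d + 2) + c * (m * j) :=
              Nat.add_le_add_left (Nat.le_mul_of_pos_left _ hc) _
          _ = c * (m ^ (d + 2) + m * j) := by ring
          _ ≤ _ := by gcongr
      have h5 : m * j ≤ c * (m + j) ^ (d + 2) % q := by omega
      have h6 : (m : ℝ) * j ≤ (c * (m + j) ^ (d + 2) % q : ℕ) := by exact_mod_cast h5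
      rw [Nat.add_sub_cancel_left]
      refine le_trans ?_ h6
      gcongr
      exact hVle m hm1
    · rw [Nat.card_Icc, nsmul_eq_mul, Nat.add_sub_cancel]
  have hK' : (K : ℝ) ≤ (q : ℝ) ^ (δ + b * δ) := by
    have h1 : (H : ℝ) ^ b ≤ (q : ℝ) ^ (1 + b * δ) := by
      calc (H : ℝ) ^ b ≤ ((q : ℝ) ^ (u + δ)) ^ b := by gcongr
        _ = _ := by
          rw [← Real.rpow_mul_natCast hq0.le]; congr 1; linarith
    calc (K : ℝ) ≤ ((c * H ^ b : ℕ) : ℝ) / q := Nat.cast_div_le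
      _ ≤ ((q : ℝ) ^ δ * (q : ℝ) ^ (1 + b * δ)) / q := by push_cast; gcongr
      _ = _ := by
        rw [← Real.rpow_add hq0, div_eq_mul_inv, ← Real.rpow_neg_one (q : ℝ), ← Real.rpow_add hq0]
        congr 1; ring
  have hrest' : K * (V ^ (-(1 / 2) : ℝ) + 2 * V ^ (-1 : ℝ) * (H : ℝ) ^ (1 / 2 : ℝ)) ≤
      3 * (q : ℝ) ^ (-(u / 8)) := by
    have h1 : (K : ℝ) * V ^ (-(1 / 2) : ℝ) ≤ (q : ℝ) ^ (-(u / 8)) := by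
      calc (K : ℝ) * V ^ (-(1 / 2) : ℝ) ≤ (q : ℝ) ^ (δ + b * δ) * V ^ (-(1 / 2) : ℝ) := by gcongr
        _ = (q : ℝ) ^ (δ + b * δ + (1 - δ) * u * (-(1 / 2))) := by
          rw [hV, ← Real.rpow_mul hq0.le, ← Real.rpow_add hq0]
        _ ≤ _ := Real.rpow_le_rpow_of_exponent_le hq1 (by linarith)
    have h2 : (K : ℝ) * (V ^ (-1 : ℝ) * (H : ℝ) ^ (1 / 2 : ℝ)) ≤ (q : ℝ) ^ (-(u / 8)) := by
      calc (K : ℝ) * (V ^ (-1 : ℝ) * (H : ℝ) ^ (1 / 2 : ℝ))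
          ≤ (q : ℝ) ^ (δ + b * δ) * (V ^ (-1 : ℝ) * ((q : ℝ) ^ (u + δ)) ^ (1 / 2 : ℝ)) := by gcongr
        _ = (q : ℝ) ^ (δ + b * δ + ((1 - δ) * u * (-1) + (u + δ) * (1 / 2))) := by
          rw [hV, ← Real.rpow_mul hq0.le, ← Real.rpow_mul hq0.le, ← Real.rpow_add hq0,
            ← Real.rpow_add hq0]
        _ ≤ _ := Real.rpow_le_rpow_of_exponent_le hq1 (by linarith)
    linarith
  have hrest0 : 0 ≤ ∑ n ∈ (Ioc 0 H).filter (fun n ↦ ¬ c * n ^ b < q), t n :=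
    sum_nonneg fun n _ ↦ by positivity
  rw [← sum_filter_add_sum_filter_not (Ioc 0 H) (fun n ↦ c * n ^ b < q), hmain]
  have hc2 : 0 ≤ (c : ℝ) ^ (-(1 / 2) : ℝ) := by positivity
  have hdiff : (∑' n, f n - ∑ n ∈ s, f n) * (c : ℝ) ^ (-(1 / 2) : ℝ) ≤
      (∑' n, g n) * (q : ℝ) ^ (-(u / 8)) := by
    calc _ ≤ (∑' n, f n - ∑ n ∈ s, f n) * 1 := by
          gcongr
      _ ≤ V ^ (-(1 / 4) : ℝ) * ∑' n, g n := by linarith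
      _ ≤ (q : ℝ) ^ (-(u / 8)) * ∑' n, g n := by gcongr
      _ = _ := mul_comm _ _
  have hdiff0 : 0 ≤ (∑' n, f n - ∑ n ∈ s, f n) * (c : ℝ) ^ (-(1 / 2) : ℝ) :=
    mul_nonneg (by linarith) hc2
  have hq3 : 0 ≤ (∑' n, g n) * (q : ℝ) ^ (-(u / 8)) := by positivity
  rw [abs_le]
  constructor <;> linarith

open Finset in
/-- The small `n` contribute the main term. -/
lemma norm_sum_hurwitzHalf_mul_small_sub_le {b : ℕ} (hb : 1 < b) {δ : ℝ} (hδ : 0 < δ)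
    (hδb : 8 * (b : ℝ) ^ 2 * δ ≤ 1) :
    ∃ C : ℝ, 0 < C ∧ ∀ (q : ℕ) [Fact q.Prime] (c : ℕ), 1 ≤ c → (c : ℝ) ≤ (q : ℝ) ^ δ →
      ‖(q : ℂ)⁻¹ * ∑ n ∈ Ioc 0 ⌊(q : ℝ) ^ (1 / (b : ℝ) + δ)⌋₊,
          hurwitzHalf q n * hurwitzHalf q ((c * n ^ b) % q) -
        (((∑' n : ℕ, (n : ℝ) ^ (-(((b : ℝ) + 1) / 2))) * (c : ℝ) ^ (-(1 / 2) : ℝ) : ℝ) : ℂ)‖ ≤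
        C * (q : ℝ) ^ (-(1 / (8 * (b : ℝ)))) := by
  obtain ⟨C₁, hC₁, hM⟩ := abs_sum_rpow_mod_sub_le hb hδ hδb
  obtain ⟨C₂, hC₂, hF⟩ := hurwitzHalf_bounds
  have hb2 : (2 : ℝ) ≤ b := by exact_mod_cast hb
  have hb0 : (0 : ℝ) < b := by linarith
  set Z : ℝ := ∑' n : ℕ, (n : ℝ) ^ (-(((b : ℝ) + 1) / 2)) with hZ
  have hZ0 : 0 ≤ Z := tsum_nonneg fun n ↦ by positivity
  refine ⟨C₁ + (2 * C₂ ^ 2 + C₂ * (C₁ + Z)), by positivity, fun q hq c hc hcq ↦ ?_⟩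
  have hmain := hM q c hc hcq
  have hq1 : (1 : ℝ) ≤ q := by exact_mod_cast hq.out.one_le
  have hq0 : (0 : ℝ) < q := by linarith
  have hc1 : (1 : ℝ) ≤ c := by exact_mod_cast hc
  have hHq : ⌊(q : ℝ) ^ (1 / (b : ℝ) + δ)⌋₊ < q := floor_rpow_lt hb hδb hq.out.one_lt
  have hH1 : (⌊(q : ℝ) ^ (1 / (b : ℝ) + δ)⌋₊ : ℝ) ≤ (q : ℝ) ^ (1 / (b : ℝ) + δ) :=
    Nat.floor_le (by positivity)
  set H : ℕ := ⌊(q : ℝ) ^ (1 / (b : ℝ) + δ)⌋₊ with hH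
  set x : ℕ → ℕ := fun n ↦ c * n ^ b % q with hx
  set S : ℝ := ∑ n ∈ Ioc 0 H, (n : ℝ) ^ (-(1 / 2) : ℝ) * (x n : ℝ) ^ (-(1 / 2) : ℝ) with hS
  have hpt : ∀ n ∈ Ioc 0 H, ‖hurwitzHalf q n * hurwitzHalf q (x n) -
      ((q * ((n : ℝ) ^ (-(1 / 2) : ℝ) * (x n : ℝ) ^ (-(1 / 2) : ℝ)) : ℝ) : ℂ)‖ ≤
      C₂ ^ 2 * (q : ℝ) ^ (1 / 2 : ℝ) * (n : ℝ) ^ (-(1 / 2) : ℝ) +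
        C₂ * (q : ℝ) ^ (1 / 2 : ℝ) * (H : ℝ) ^ (1 / 2 : ℝ) *
          ((n : ℝ) ^ (-(1 / 2) : ℝ) * (x n : ℝ) ^ (-(1 / 2) : ℝ)) := by
    intro n hn
    obtain ⟨hn0, hnH⟩ := mem_Ioc.1 hn
    have hxq : x n < q := Nat.mod_lt _ hq.out.pos
    have hx0 : 0 < x n :=
      mul_pow_mod_pos (not_dvd_of_le_rpow (by nlinarith) hc hcq) hn0 (by omega) b
    obtain ⟨hn1, hn2, -⟩ := hF q n hn0 (by omega)
    obtain ⟨hx1, hx2, -⟩ := hF q (x n) hx0 hxq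
    set A : ℝ := (q : ℝ) ^ (1 / 2 : ℝ) * (n : ℝ) ^ (-(1 / 2) : ℝ) with hA
    set B : ℝ := (q : ℝ) ^ (1 / 2 : ℝ) * (x n : ℝ) ^ (-(1 / 2) : ℝ) with hB
    have hAB : (q : ℝ) * ((n : ℝ) ^ (-(1 / 2) : ℝ) * (x n : ℝ) ^ (-(1 / 2) : ℝ)) = A * B := by
      have : (q : ℝ) = (q : ℝ) ^ (1 / 2 : ℝ) * (q : ℝ) ^ (1 / 2 : ℝ) := by
        rw [← Real.sqrt_eq_rpow, Real.mul_self_sqrt hq0.le]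
      rw [hA, hB]
      nth_rewrite 1 [this]
      ring
    have hB0 : 0 ≤ B := by positivity
    have hBle : B ≤ (q : ℝ) ^ (1 / 2 : ℝ) * (H : ℝ) ^ (1 / 2 : ℝ) *
        ((n : ℝ) ^ (-(1 / 2) : ℝ) * (x n : ℝ) ^ (-(1 / 2) : ℝ)) := by
      have h1 : 1 ≤ (H : ℝ) ^ (1 / 2 : ℝ) * (n : ℝ) ^ (-(1 / 2) : ℝ) := by
        rw [Real.rpow_neg (by positivity), ← div_eq_mul_inv, one_le_div (by positivity)]
        gcongr
      calc B = B * 1 := (mul_one B).symm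
        _ ≤ B * ((H : ℝ) ^ (1 / 2 : ℝ) * (n : ℝ) ^ (-(1 / 2) : ℝ)) := by gcongr
        _ = _ := by rw [hB]; ring
    rw [hAB, show hurwitzHalf q n * hurwitzHalf q (x n) - ((A * B : ℝ) : ℂ) =
      hurwitzHalf q n * (hurwitzHalf q (x n) - (B : ℂ)) + (hurwitzHalf q n - (A : ℂ)) * (B : ℂ) by
        push_cast; ring]
    refine (norm_add_le _ _).trans ?_
    rw [norm_mul, norm_mul, Complex.norm_real, Real.norm_of_nonneg hB0]
    calc _ ≤ (C₂ * (q : ℝ) ^ (1 / 2 : ℝ) * (n : ℝ) ^ (-(1 / 2) : ℝ)) * C₂ +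
          C₂ * ((q : ℝ) ^ (1 / 2 : ℝ) * (H : ℝ) ^ (1 / 2 : ℝ) *
            ((n : ℝ) ^ (-(1 / 2) : ℝ) * (x n : ℝ) ^ (-(1 / 2) : ℝ))) := by gcongr
      _ = _ := by ring
  have hqη : (q : ℝ) ^ (-(1 / (8 * (b : ℝ)))) ≤ 1 :=
    Real.rpow_le_one_of_one_le_of_nonpos hq1 (by
      have : 0 < 1 / (8 * (b : ℝ)) := by positivity
      linarith)
  have hSle : S ≤ C₁ + Z := by
    have h1 := (abs_le.1 hmain).2
    have h2 : Z * (c : ℝ) ^ (-(1 / 2) : ℝ) ≤ Z * 1 := by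
      gcongr
      exact Real.rpow_le_one_of_one_le_of_nonpos hc1 (by norm_num)
    have h3 : C₁ * (q : ℝ) ^ (-(1 / (8 * (b : ℝ)))) ≤ C₁ * 1 := by gcongr
    linarith
  have hsum : ‖∑ n ∈ Ioc 0 H, hurwitzHalf q n * hurwitzHalf q (x n) - ((q * S : ℝ) : ℂ)‖ ≤
      (2 * C₂ ^ 2 + C₂ * (C₁ + Z)) * ((q : ℝ) ^ (1 / 2 : ℝ) * (H : ℝ) ^ (1 / 2 : ℝ)) := by
    rw [hS, mul_sum, Complex.ofReal_sum, ← sum_sub_distrib]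
    refine (norm_sum_le_of_le _ hpt).trans ?_
    rw [sum_add_distrib, ← mul_sum, ← mul_sum, ← hS]
    have h1 := sum_Ioc_rpow_neg_half_le H
    calc _ ≤ C₂ ^ 2 * (q : ℝ) ^ (1 / 2 : ℝ) * (2 * (H : ℝ) ^ (1 / 2 : ℝ)) +
          C₂ * (q : ℝ) ^ (1 / 2 : ℝ) * (H : ℝ) ^ (1 / 2 : ℝ) * (C₁ + Z) := by gcongr
      _ = _ := by ring
  have hHη : (q : ℝ)⁻¹ * ((q : ℝ) ^ (1 / 2 : ℝ) * (H : ℝ) ^ (1 / 2 : ℝ)) ≤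
      (q : ℝ) ^ (-(1 / (8 * (b : ℝ)))) := by
    calc (q : ℝ)⁻¹ * ((q : ℝ) ^ (1 / 2 : ℝ) * (H : ℝ) ^ (1 / 2 : ℝ))
        ≤ (q : ℝ)⁻¹ * ((q : ℝ) ^ (1 / 2 : ℝ) * ((q : ℝ) ^ (1 / (b : ℝ) + δ)) ^ (1 / 2 : ℝ)) := by
          gcongr
      _ = (q : ℝ) ^ (-1 + (1 / 2 + (1 / (b : ℝ) + δ) * (1 / 2))) := by
          rw [← Real.rpow_neg_one, ← Real.rpow_mul hq0.le, ← Real.rpow_add hq0,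
            ← Real.rpow_add hq0]
      _ ≤ _ := by
          refine Real.rpow_le_rpow_of_exponent_le hq1 ?_
          have h1 : 1 / (b : ℝ) ≤ 1 / 2 := one_div_le_one_div_of_le (by norm_num) hb2
          have h2 : 1 / (8 * (b : ℝ)) = 1 / 8 * (1 / b) := by field_simp
          have h3 : δ ≤ 1 / 16 := by nlinarith
          linarith
  have hqC : (q : ℂ) ≠ 0 := by exact_mod_cast hq0.ne'
  rw [show (q : ℂ)⁻¹ * ∑ n ∈ Ioc 0 H, hurwitzHalf q n * hurwitzHalf q (x n) -
      ((Z * (c : ℝ) ^ (-(1 / 2) : ℝ) : ℝ) : ℂ) =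
      ((S - Z * (c : ℝ) ^ (-(1 / 2) : ℝ) : ℝ) : ℂ) + (q : ℂ)⁻¹ *
        (∑ n ∈ Ioc 0 H, hurwitzHalf q n * hurwitzHalf q (x n) - ((q * S : ℝ) : ℂ)) by
    push_cast; field_simp; ring]
  refine (norm_add_le _ _).trans ?_
  rw [Complex.norm_real, Real.norm_eq_abs, norm_mul, norm_inv, Complex.norm_natCast, add_mul]
  refine add_le_add hmain ?_
  calc _ ≤ (q : ℝ)⁻¹ * ((2 * C₂ ^ 2 + C₂ * (C₁ + Z)) *
        ((q : ℝ) ^ (1 / 2 : ℝ) * (H : ℝ) ^ (1 / 2 : ℝ))) := by gcongr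
    _ = (2 * C₂ ^ 2 + C₂ * (C₁ + Z)) *
        ((q : ℝ)⁻¹ * ((q : ℝ) ^ (1 / 2 : ℝ) * (H : ℝ) ^ (1 / 2 : ℝ))) := by ring
    _ ≤ _ := by gcongr

lemma riemannZeta_half_eq {b : ℕ} (hb : 1 < b) :
    riemannZeta (((b : ℂ) + 1) / 2) =
      ((∑' n : ℕ, (n : ℝ) ^ (-(((b : ℝ) + 1) / 2)) : ℝ) : ℂ) := by
  have hb2 : (2 : ℝ) ≤ b := by exact_mod_cast hb
  have hs : ((b : ℂ) + 1) / 2 = ((((b : ℝ) + 1) / 2 : ℝ) : ℂ) := by push_cast; rfl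
  rw [hs, zeta_eq_tsum_one_div_nat_cpow (by rw [Complex.ofReal_re]; linarith), Complex.ofReal_tsum]
  refine tsum_congr fun n ↦ ?_
  rw [Complex.ofReal_cpow (by positivity), one_div, ← Complex.cpow_neg]
  push_cast
  rfl

/-- For an integer `b > 1`, there are `α, η, C > 0` such that for every
sufficiently large prime `q` and all `1 ≤ l1, l2 ≤ q^α`:
`|(q−1)⁻¹ Σ_{χ ≠ 1} χ(l1) χ(l2)^b L(χ⁻¹,1/2) L(χ^b,1/2) − ζ((b+1)/2)·(l1·l2^b)^{-1/2}|
  ≤ C·q^{-η}`. -/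
theorem twisted_second_moment_negOne_b (b : ℕ) (hb : 1 < b) :
    ∃ α : ℝ, 0 < α ∧ ∃ η : ℝ, 0 < η ∧ ∃ C : ℝ, 0 < C ∧ ∃ Q : ℕ,
      ∀ (q : ℕ) [Fact (Nat.Prime q)], Q ≤ q →
        ∀ l₁ l₂ : ℕ, 1 ≤ l₁ → 1 ≤ l₂ → (l₁ : ℝ) ≤ (q : ℝ) ^ α → (l₂ : ℝ) ≤ (q : ℝ) ^ α →
          ‖((q : ℂ) - 1)⁻¹ *
              (∑ χ : DirichletCharacter ℂ q,
                if χ = 1 then 0 else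
                  χ (l₁ : ZMod q) * (χ (l₂ : ZMod q)) ^ b *
                    DirichletCharacter.LFunction χ⁻¹ (1 / 2) *
                    DirichletCharacter.LFunction (χ ^ b) (1 / 2)) -
            riemannZeta (((b : ℂ) + 1) / 2) *
              ((((l₁ * l₂ ^ b : ℕ) : ℝ) ^ (-(1 / 2 : ℝ)) : ℝ) : ℂ)‖ ≤ C * (q : ℝ) ^ (-η) := by
  have hb2 : (2 : ℝ) ≤ b := by exact_mod_cast hb
  set δ : ℝ := 1 / (8 * (b : ℝ) ^ 2) with hδdef
  have hδ : 0 < δ := by positivity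
  have hδb : 8 * (b : ℝ) ^ 2 * δ ≤ 1 := by rw [hδdef, mul_one_div_cancel (by positivity)]
  obtain ⟨η₁, hη₁, C₁, hC₁, Q, hlarge⟩ := norm_sum_hurwitzHalf_mul_large_le hb hδ hδb
  obtain ⟨C₂, hC₂, hsmall⟩ := norm_sum_hurwitzHalf_mul_small_sub_le hb hδ hδb
  set Z : ℝ := ‖riemannZeta (1 / 2)‖
  set η : ℝ := min η₁ (min (1 / (8 * (b : ℝ))) 1) with hη
  refine ⟨δ / (1 + b), by positivity, η, by positivity, C₁ + C₂ + 8 * Z ^ 2, by positivity, Q,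
    fun q hq hqQ l₁ l₂ hl₁ hl₂ hl₁q hl₂q ↦ ?_⟩
  have hq1 : (1 : ℝ) ≤ q := by exact_mod_cast hq.out.one_le
  have hq2 : (2 : ℝ) ≤ q := by exact_mod_cast hq.out.two_le
  have hq0 : (0 : ℝ) < q := by linarith
  have hα : δ / (1 + b) < 1 := by
    rw [div_lt_one (by positivity)]; nlinarith
  have hc : 1 ≤ l₁ * l₂ ^ b := Nat.mul_pos hl₁ (Nat.pow_pos hl₂)
  have hcq : ((l₁ * l₂ ^ b : ℕ) : ℝ) ≤ (q : ℝ) ^ δ := by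
    calc ((l₁ * l₂ ^ b : ℕ) : ℝ) ≤ (q : ℝ) ^ (δ / (1 + b)) * ((q : ℝ) ^ (δ / (1 + b))) ^ b := by
          push_cast; gcongr
      _ = (q : ℝ) ^ δ := by
          rw [← Real.rpow_mul_natCast hq0.le, ← Real.rpow_add hq0]
          congr 1; field_simp
  set c : ℕ := l₁ * l₂ ^ b with hcdef
  set H : ℕ := ⌊(q : ℝ) ^ (1 / (b : ℝ) + δ)⌋₊ with hH
  have hHq : H < q := floor_rpow_lt hb hδb hq.out.one_lt
  set f : DirichletCharacter ℂ q → ℂ := fun χ ↦ χ (l₁ : ZMod q) * (χ (l₂ : ZMod q)) ^ b *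
    DirichletCharacter.LFunction χ⁻¹ (1 / 2) * DirichletCharacter.LFunction (χ ^ b) (1 / 2) with hf
  set t : ℕ → ℂ := fun n ↦ hurwitzHalf q n * hurwitzHalf q ((c * n ^ b) % q) with ht
  have hl₁d := not_dvd_of_le_rpow hα hl₁ hl₁q
  have hl₂d := not_dvd_of_le_rpow hα hl₂ hl₂q
  have hsplit : ∑ χ, (if χ = 1 then 0 else f χ) = ∑ χ, f χ - f 1 := by
    rw [eq_sub_iff_add_eq, ← Finset.sum_ite_eq' Finset.univ 1 f |>.trans (if_pos (Finset.mem_univ _)),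
      ← Finset.sum_add_distrib]
    refine Finset.sum_congr rfl fun χ _ ↦ ?_
    split_ifs <;> simp
  have htot : ∑ χ, f χ = ((q : ℂ) - 1) * ((q : ℂ)⁻¹ * ∑ n ∈ Finset.Ioc 0 (q - 1), t n) :=
    sum_char_LFunction_eq (by omega) hl₁d hl₂d
  have ht2 : ∑ n ∈ Finset.Ioc 0 (q - 1), t n =
      ∑ n ∈ Finset.Ioc 0 H, t n + ∑ n ∈ Finset.Ioc H (q - 1), t n :=
    (Finset.sum_Ioc_consecutive t H.zero_le (by omega)).symm
  have hq1C : (q : ℂ) - 1 ≠ 0 := by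
    rw [sub_ne_zero]; exact_mod_cast hq.out.ne_one
  set m : ℂ := riemannZeta (((b : ℂ) + 1) / 2) * (((c : ℝ) ^ (-(1 / 2 : ℝ)) : ℝ) : ℂ) with hm
  have hdecomp : ((q : ℂ) - 1)⁻¹ * (∑ χ, f χ - f 1) - m =
      ((q : ℂ)⁻¹ * ∑ n ∈ Finset.Ioc 0 H, t n - m) + (q : ℂ)⁻¹ * ∑ n ∈ Finset.Ioc H (q - 1), t n -
        ((q : ℂ) - 1)⁻¹ * f 1 := by
    rw [htot, ht2, mul_sub, inv_mul_cancel_left₀ hq1C]; ring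
  have hA : ‖(q : ℂ)⁻¹ * ∑ n ∈ Finset.Ioc 0 H, t n - m‖ ≤ C₂ * (q : ℝ) ^ (-η) := by
    have h1 := hsmall q c hc hcq
    rw [Complex.ofReal_mul, ← riemannZeta_half_eq hb] at h1
    refine h1.trans ?_
    gcongr
    exact (min_le_right _ _).trans (min_le_left _ _)
  have hB : ‖(q : ℂ)⁻¹ * ∑ n ∈ Finset.Ioc H (q - 1), t n‖ ≤ C₁ * (q : ℝ) ^ (-η) := by
    rw [norm_mul, norm_inv, Complex.norm_natCast]
    calc _ ≤ (q : ℝ)⁻¹ * (C₁ * (q : ℝ) ^ (1 - η₁)) := by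
          gcongr
          exact hlarge q hqQ c hc hcq
      _ = C₁ * (q : ℝ) ^ (-η₁) := by
          rw [sub_eq_add_neg, Real.rpow_add hq0, Real.rpow_one]; field_simp
      _ ≤ _ := by
          gcongr
          exact min_le_left _ _
  have hT : ‖((q : ℂ) - 1)⁻¹ * f 1‖ ≤ 8 * Z ^ 2 * (q : ℝ) ^ (-η) := by
    have hunit : ∀ l : ℕ, ¬ q ∣ l → (1 : DirichletCharacter ℂ q) (l : ZMod q) = 1 := fun l hl ↦
      MulChar.one_apply (isUnit_iff_ne_zero.2 (by rwa [Ne, ZMod.natCast_eq_zero_iff]))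
    have hL := norm_LFunction_one_half_le (q := q)
    have hf1 : ‖f 1‖ ≤ (2 * Z) * (2 * Z) := by
      rw [hf]
      simp only [hunit l₁ hl₁d, hunit l₂ hl₂d, one_pow, inv_one, one_mul, norm_mul]
      gcongr
    have hqn : ‖((q : ℂ) - 1)⁻¹‖ ≤ 2 * (q : ℝ) ^ (-η) := by
      rw [norm_inv, show (q : ℂ) - 1 = ((q - 1 : ℝ) : ℂ) by push_cast; rfl, Complex.norm_real,
        Real.norm_of_nonneg (by linarith)]
      calc ((q : ℝ) - 1)⁻¹ ≤ ((q : ℝ) / 2)⁻¹ := inv_anti₀ (by positivity) (by linarith)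
        _ = 2 * (q : ℝ) ^ (-1 : ℝ) := by rw [Real.rpow_neg_one]; field_simp
        _ ≤ _ := by
          gcongr
          exact (min_le_right _ _).trans (min_le_right _ _)
    rw [norm_mul]
    calc _ ≤ 2 * (q : ℝ) ^ (-η) * ((2 * Z) * (2 * Z)) := by gcongr
      _ = _ := by ring
  rw [hsplit, hdecomp]
  refine (norm_sub_le _ _).trans ((add_le_add (norm_add_le _ _) le_rfl).trans ?_)
  linarith
end

section
/- Let F be a finite field, ψ : F → ℂ^× a nontrivial additive character, and N a positive integer dividing #F − 1. For a multiplicative character χ of F^× set ε(ψ, χ) = (#F)^{-1/2} · Σ_{x ∈ F^×} ψ(x) χ(x), and let ψ_N denote the additive character x ↦ ψ(N·x). Then there exists a complex number ε_N(ψ) of absolute value 1, depending only on ψ and N, such that for every multiplicative character χ of F^×: −ε(ψ_N, χ^N) = ε_N(ψ) · ∏_{ρ} ε(ψ, χρ), the product running over all multiplicative characters ρ of F^× with ρ^N = 1. -/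
open scoped Real

/-- The normalized Gauss sum `ε(ψ, χ) = (#F)^{-1/2} · Σ_{x ∈ F^×} ψ(x) χ(x)`. -/
noncomputable def normGaussSum (F : Type*) [Field F] [Fintype F] [DecidableEq F]
    (ψ : AddChar F ℂ) (χ : MulChar F ℂ) : ℂ :=
  (Real.sqrt (Fintype.card F) : ℂ)⁻¹ * ∑ x : Fˣ, ψ (x : F) * χ (x : F)

open Polynomial in
/-- The power sum `∑ αᵢ ^ m` of the roots of a polynomial, read off from the logarithmic
derivative of its reverse. -/
noncomputable def Polynomial.rootPowerSum {K : Type*} [Field K] (m : ℕ) (f : K[X]) : K :=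
  -PowerSeries.coeff m
    (PowerSeries.X * PowerSeries.derivative (R := K) (f.reverse : PowerSeries K) *
      (f.reverse : PowerSeries K)⁻¹)

namespace Polynomial

variable {K : Type*} [Field K]

lemma Monic.constantCoeff_reverse {f : K[X]} (hf : f.Monic) :
    PowerSeries.constantCoeff (f.reverse : PowerSeries K) = 1 := by
  rw [constantCoeff_coe, coeff_zero_reverse, hf.leadingCoeff]

lemma rootPowerSum_one (m : ℕ) : rootPowerSum m (1 : K[X]) = 0 := by
  have h : (1 : K[X]).reverse = 1 := by
    simpa using reverse_C (1 : K)
  simp [rootPowerSum, h]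

lemma rootPowerSum_mul (m : ℕ) {f g : K[X]} (hf : f.Monic) (hg : g.Monic) :
    rootPowerSum m (f * g) = rootPowerSum m f + rootPowerSum m g := by
  have hf' := hf.constantCoeff_reverse
  have hg' := hg.constantCoeff_reverse
  rw [rootPowerSum, rootPowerSum, rootPowerSum, reverse_mul_of_domain, coe_mul, ← neg_add,
    ← map_add]
  congr 2
  generalize (f.reverse : PowerSeries K) = a at *
  generalize (g.reverse : PowerSeries K) = b at *
  have ha : a * a⁻¹ = 1 := PowerSeries.mul_inv_cancel a (by simp [hf'])
  have hb : b * b⁻¹ = 1 := PowerSeries.mul_inv_cancel b (by simp [hg'])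
  rw [PowerSeries.mul_inv_rev, Derivation.leibniz, smul_eq_mul, smul_eq_mul]
  linear_combination (PowerSeries.X * PowerSeries.derivative (R := K) b * b⁻¹) * ha +
    (PowerSeries.X * PowerSeries.derivative (R := K) a * a⁻¹) * hb

lemma rootPowerSum_map {L : Type*} [Field L] (φ : K →+* L) (m : ℕ) {f : K[X]} (hf : f.Monic) :
    rootPowerSum m (f.map φ) = φ (rootPowerSum m f) := by
  have h1 : ((f.map φ).reverse : PowerSeries L) = PowerSeries.map φ (f.reverse) := by
    rw [← polynomial_map_coe, reverse, reverse, natDegree_map, reflect_map]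
  have h2 : (PowerSeries.map φ f.reverse)⁻¹ = PowerSeries.map φ (f.reverse : PowerSeries K)⁻¹ := by
    rw [eq_comm, PowerSeries.eq_inv_iff_mul_eq_one, ← map_mul, PowerSeries.inv_mul_cancel, map_one]
    · simp [hf.constantCoeff_reverse]
    · rw [← h1, (hf.map φ).constantCoeff_reverse]; exact one_ne_zero
  have h3 : PowerSeries.derivative (R := L) (PowerSeries.map φ f.reverse) =
      PowerSeries.map φ (PowerSeries.derivative (R := K) f.reverse) := by
    ext n
    simp [PowerSeries.coeff_derivative]
  rw [rootPowerSum, rootPowerSum, h1, h2, h3, map_neg, ← PowerSeries.coeff_map,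
    map_mul (PowerSeries.map φ), map_mul (PowerSeries.map φ), PowerSeries.map_X]

lemma reverse_X_sub_C (a : K) : (X - C a).reverse = 1 - C a * X := by
  ext n
  rw [reverse, natDegree_X_sub_C, coeff_reflect]
  rcases n with _ | _ | n
  · simp [revAt_le]
  · simp [revAt_le, coeff_one, coeff_X]
  · rw [revAt_eq_self_of_lt (by lia)]
    simp [coeff_one, coeff_X]

lemma rootPowerSum_X_sub_C {m : ℕ} (hm : m ≠ 0) (a : K) : rootPowerSum m (X - C a) = a ^ m := by
  have h : (PowerSeries.mk (a ^ ·)) * (1 - PowerSeries.C a * PowerSeries.X : PowerSeries K) =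
      1 := by
    ext n
    rcases n with _ | n
    · simp
    · rw [mul_sub, mul_one, mul_left_comm, mul_comm (PowerSeries.mk _)]
      simp [PowerSeries.coeff_one, mul_assoc, pow_succ, mul_comm]
  have h' : (1 - PowerSeries.C a * PowerSeries.X : PowerSeries K)⁻¹ = PowerSeries.mk (a ^ ·) := by
    rw [eq_comm, PowerSeries.eq_inv_iff_mul_eq_one (by simp), h]
  obtain ⟨n, rfl⟩ := Nat.exists_eq_succ_of_ne_zero hm
  rw [rootPowerSum, reverse_X_sub_C]
  simp only [coe_sub, coe_one, coe_mul, coe_C, coe_X, h']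
  have hd : PowerSeries.derivative (R := K) (1 - PowerSeries.C a * PowerSeries.X) =
      -PowerSeries.C a := by
    simp [Derivation.leibniz]
  rw [hd, mul_assoc, PowerSeries.coeff_succ_X_mul]
  simp [pow_succ, mul_comm]

lemma rootPowerSum_multiset_prod {m : ℕ} (hm : m ≠ 0) (s : Multiset K) :
    rootPowerSum m (s.map (X - C ·)).prod = (s.map (· ^ m)).sum := by
  induction s using Multiset.induction with
  | empty => simp [rootPowerSum_one]
  | cons a s ih =>
    rw [Multiset.map_cons, Multiset.prod_cons, rootPowerSum_mul m (monic_X_sub_C a)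
      (monic_multisetProd_X_sub_C s), ih, rootPowerSum_X_sub_C hm, Multiset.map_cons,
      Multiset.sum_cons]

lemma rootPowerSum_one_eq {f : K[X]} (hf : f.Monic) {n : ℕ} (hn : f.natDegree = n + 1) :
    rootPowerSum 1 f = -f.coeff n := by
  rw [rootPowerSum, mul_assoc, ← zero_add 1, PowerSeries.coeff_succ_X_mul]
  simp only [PowerSeries.coeff_zero_eq_constantCoeff, map_mul, PowerSeries.constantCoeff_inv,
    hf.constantCoeff_reverse, inv_one, mul_one]
  rw [← PowerSeries.coeff_zero_eq_constantCoeff_apply, PowerSeries.coeff_derivative, coeff_coe]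
  rw [reverse, coeff_reflect, hn, revAt_le (by lia)]
  simp

lemma rootPowerSum_add_C {f : K[X]} (hf : f.Monic) {n : ℕ} (hn : n ≠ 0) (hfn : f.natDegree = n)
    (b : K) : rootPowerSum n (f + C b) = rootPowerSum n f - n * b := by
  have hfb : (f + C b).Monic := hf.add_of_left (by
    rw [degree_eq_natDegree hf.ne_zero, hfn]
    exact degree_C_le.trans_lt (by exact_mod_cast Nat.pos_of_ne_zero hn))
  have hr : (f + C b).reverse = f.reverse + C b * X ^ n := by
    rw [reverse, reverse, natDegree_add_C, reflect_add, reflect_C, hfn]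
  have h1 := hf.constantCoeff_reverse
  have h2 := hfb.constantCoeff_reverse
  rw [rootPowerSum, rootPowerSum]
  rw [hr] at h2 ⊢
  simp only [coe_add, coe_mul, coe_C, coe_pow, coe_X] at h2 ⊢
  generalize (f.reverse : PowerSeries K) = r at *
  set r' := r + PowerSeries.C b * PowerSeries.X ^ n with hr'
  have hi : r * r⁻¹ = 1 := PowerSeries.mul_inv_cancel r (by simp [h1])
  have hi' : r' * r'⁻¹ = 1 := PowerSeries.mul_inv_cancel r' (by simp [h2])
  obtain ⟨k, rfl⟩ : ∃ k, n = k + 1 := Nat.exists_eq_succ_of_ne_zero hn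
  have hd : PowerSeries.derivative (R := K) r' = PowerSeries.derivative (R := K) r +
      PowerSeries.C ((k + 1) * b) * PowerSeries.X ^ k := by
    rw [hr', map_add, Derivation.leibniz, Derivation.leibniz_pow]
    simp
    ring
  have key : PowerSeries.X * PowerSeries.derivative (R := K) r' * r'⁻¹ =
      PowerSeries.X * PowerSeries.derivative (R := K) r * r⁻¹ +
      PowerSeries.X ^ (k + 1) * (PowerSeries.C ((k + 1) * b) * r'⁻¹) -
      PowerSeries.X ^ (k + 2) * (PowerSeries.derivative (R := K) r * PowerSeries.C b *
        r⁻¹ * r'⁻¹) := by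
    rw [hd]
    linear_combination (PowerSeries.X * PowerSeries.derivative (R := K) r * r⁻¹ * r'⁻¹) * hr' +
      (-PowerSeries.X * PowerSeries.derivative (R := K) r * r'⁻¹) * hi +
      (PowerSeries.X * PowerSeries.derivative (R := K) r * r⁻¹) * hi'
  rw [key, map_sub, map_add, PowerSeries.coeff_X_pow_mul', PowerSeries.coeff_X_pow_mul']
  simp [h2]
  ring

end Polynomial

section HasseDavenport

open Finset Polynomial

section MonicSums

variable {F : Type*} [Field F] [Finite F]

lemma Polynomial.finite_monic_natDegree_eq (n : ℕ) :
    {f : F[X] | f.Monic ∧ f.natDegree = n}.Finite :=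
  Set.finite_coe_iff.mp (Finite.of_equiv (Fin n → F)
    ((monicEquivDegreeLT n).trans (degreeLTEquiv F n).toEquiv).symm)

variable (F) in
/-- The finite set of monic polynomials of degree `n` over a finite field. -/
noncomputable def monicsOfDegree (n : ℕ) : Finset F[X] :=
  (finite_monic_natDegree_eq n).toFinset

lemma mem_monicsOfDegree {n : ℕ} {f : F[X]} :
    f ∈ monicsOfDegree F n ↔ f.Monic ∧ f.natDegree = n := by
  simp [monicsOfDegree]

lemma monicsOfDegree_zero : monicsOfDegree F 0 = {1} := by
  ext f
  rw [mem_monicsOfDegree, mem_singleton]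
  exact ⟨fun h ↦ h.1.natDegree_eq_zero.mp h.2, by rintro rfl; exact ⟨monic_one, natDegree_one⟩⟩

open Classical in
variable (F) in
/-- The finite set of monic irreducible polynomials of degree `n` over a finite field. -/
noncomputable def monicIrreduciblesOfDegree (n : ℕ) : Finset F[X] :=
  (monicsOfDegree F n).filter Irreducible

lemma mem_monicIrreduciblesOfDegree {n : ℕ} {f : F[X]} :
    f ∈ monicIrreduciblesOfDegree F n ↔ (f.Monic ∧ f.natDegree = n) ∧ Irreducible f := by
  simp [monicIrreduciblesOfDegree, mem_monicsOfDegree]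

/-- The sum of `w` over monic polynomials of degree `n`. -/
noncomputable def monicSum (w : F[X] → ℂ) (n : ℕ) : ℂ := ∑ f ∈ monicsOfDegree F n, w f

/-- The `n`-th coefficient of the logarithmic derivative of the generating function of
`monicSum w`, as a sum over prime powers of degree `n`. -/
noncomputable def primePowerSum (w : F[X] → ℂ) (n : ℕ) : ℂ :=
  ∑ d ∈ n.divisors, ∑ P ∈ monicIrreduciblesOfDegree F d, d * w P ^ (n / d)

lemma sum_Icc_sum_divisors {M : Type*} [AddCommMonoid M] (h : ℕ → ℕ → M) (n : ℕ) :
    ∑ k ∈ Icc 1 n, ∑ d ∈ k.divisors, h d (k / d) =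
      ∑ d ∈ Icc 1 n, ∑ j ∈ Icc 1 n, if d * j ≤ n then h d j else 0 := by
  simp_rw [← sum_filter]
  rw [sum_sigma', sum_sigma']
  refine sum_bij' (fun x _ ↦ ⟨x.2, x.1 / x.2⟩) (fun x _ ↦ ⟨x.1 * x.2, x.1⟩) ?_ ?_ ?_ ?_ ?_
  · rintro ⟨k, d⟩ h
    simp only [mem_sigma, mem_Icc, Nat.mem_divisors, mem_filter] at h ⊢
    obtain ⟨⟨h1, h2⟩, ⟨j, rfl⟩, h3⟩ := h
    have hd : 0 < d := Nat.pos_of_ne_zero (by rintro rfl; simp at h3)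
    have hj : 0 < j := Nat.pos_of_ne_zero (by rintro rfl; simp at h3)
    rw [Nat.mul_div_cancel_left _ hd]
    exact ⟨⟨hd, by nlinarith⟩, ⟨hj, by nlinarith⟩, h2⟩
  · rintro ⟨d, j⟩ h
    simp only [mem_sigma, mem_Icc, Nat.mem_divisors, mem_filter] at h ⊢
    obtain ⟨⟨h1, h2⟩, ⟨h3, h4⟩, h5⟩ := h
    exact ⟨⟨Nat.mul_pos h1 h3, h5⟩, dvd_mul_right _ _, (Nat.mul_pos h1 h3).ne'⟩
  · rintro ⟨k, d⟩ h
    simp only [mem_sigma, mem_Icc, Nat.mem_divisors] at h ⊢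
    rw [Nat.mul_div_cancel' h.2.1]
  · rintro ⟨d, j⟩ h
    simp only [mem_sigma, mem_Icc, mem_filter] at h ⊢
    rw [Nat.mul_div_cancel_left _ h.1.1]
  · rintro ⟨k, d⟩ h
    rfl

open Classical in
lemma natDegree_eq_sum_monicIrreducibles {f : F[X]} (hf : f.Monic) :
    f.natDegree = ∑ d ∈ Icc 1 f.natDegree, ∑ P ∈ monicIrreduciblesOfDegree F d,
      ∑ j ∈ Icc 1 f.natDegree, if P ^ j ∣ f then d else 0 := by
  have hf0 := hf.ne_zero
  have hinner (d : ℕ) (hd : 1 ≤ d) (P : F[X]) (hP : P ∈ monicIrreduciblesOfDegree F d) :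
      (∑ j ∈ Icc 1 f.natDegree, if P ^ j ∣ f then d else 0) =
        (UniqueFactorizationMonoid.normalizedFactors f).count P * d := by
    obtain ⟨⟨hm, hdeg⟩, hirr⟩ := mem_monicIrreduciblesOfDegree.mp hP
    have hiff (j : ℕ) : P ^ j ∣ f ↔
        j ≤ (UniqueFactorizationMonoid.normalizedFactors f).count P := by
      rw [pow_dvd_iff_le_emultiplicity,
        UniqueFactorizationMonoid.emultiplicity_eq_count_normalizedFactors hirr hf0,
        hm.normalize_eq_self]
      exact Nat.cast_le
    have hle : (UniqueFactorizationMonoid.normalizedFactors f).count P ≤ f.natDegree := by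
      have h := natDegree_le_of_dvd ((hiff _).mpr le_rfl) hf0
      rw [natDegree_pow, hdeg] at h
      nlinarith
    simp_rw [hiff]
    rw [← sum_filter, sum_const, smul_eq_mul]
    congr 1
    have : (Icc 1 f.natDegree).filter
        (· ≤ (UniqueFactorizationMonoid.normalizedFactors f).count P) =
        Icc 1 ((UniqueFactorizationMonoid.normalizedFactors f).count P) := by
      ext j; simp; lia
    rw [this, Nat.card_Icc, Nat.add_sub_cancel]
  rw [sum_congr rfl fun d hd ↦ sum_congr rfl fun P hP ↦ hinner d (mem_Icc.mp hd).1 P hP]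
  have hmem {P : F[X]} (hP : P ∈ UniqueFactorizationMonoid.normalizedFactors f) :
      P.natDegree ∈ Icc 1 f.natDegree ∧ P ∈ monicIrreduciblesOfDegree F P.natDegree := by
    have hirr := UniqueFactorizationMonoid.irreducible_of_normalized_factor P hP
    have hm : P.Monic := by
      rw [← UniqueFactorizationMonoid.normalize_normalized_factor P hP]
      exact monic_normalize hirr.ne_zero
    exact ⟨mem_Icc.mpr ⟨hirr.natDegree_pos, natDegree_le_of_dvd
      (UniqueFactorizationMonoid.dvd_of_mem_normalizedFactors hP) hf0⟩,
      mem_monicIrreduciblesOfDegree.mpr ⟨⟨hm, rfl⟩, hirr⟩⟩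
  have hdeg : f.natDegree =
      ((UniqueFactorizationMonoid.normalizedFactors f).map natDegree).sum := by
    have hprod := UniqueFactorizationMonoid.prod_normalizedFactors_eq hf0
    rw [hf.normalize_eq_self] at hprod
    conv_lhs => rw [← hprod]
    exact natDegree_multiset_prod_of_monic _ fun P hP ↦
      (mem_monicIrreduciblesOfDegree.mp (hmem hP).2).1.1
  conv_lhs => rw [hdeg, sum_multiset_map_count]
  rw [sum_sigma']
  refine sum_bij_ne_zero (fun P _ _ ↦ ⟨P.natDegree, P⟩) ?_ ?_ ?_ ?_
  · intro P hP _
    rw [mem_sigma]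
    exact hmem (Multiset.mem_toFinset.mp hP)
  · intro P _ _ Q _ _ h
    simp only [Sigma.mk.injEq] at h
    exact eq_of_heq h.2
  · rintro ⟨d, P⟩ h hne
    simp only [mem_sigma, mem_monicIrreduciblesOfDegree] at h
    refine ⟨P, Multiset.mem_toFinset.mpr (Multiset.count_ne_zero.mp (left_ne_zero_of_mul hne)),
      ?_, ?_⟩
    · rw [smul_eq_mul, h.2.1.2]; exact hne
    · rw [h.2.1.2]
  · intro P _ _
    rfl

open Classical in
lemma sum_monicsOfDegree_filter_dvd {w : F[X] → ℂ}
    (hw : ∀ f g : F[X], f.Monic → g.Monic → w (f * g) = w f * w g) {Q : F[X]} (hQ : Q.Monic)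
    (n : ℕ) : (∑ f ∈ monicsOfDegree F n, if Q ∣ f then w f else 0) =
      if Q.natDegree ≤ n then w Q * monicSum w (n - Q.natDegree) else 0 := by
  rw [← sum_filter]
  split_ifs with h
  · rw [monicSum, mul_sum]
    symm
    refine sum_bij (fun g _ ↦ Q * g) ?_ ?_ ?_ ?_
    · intro g hg
      obtain ⟨hg, hgn⟩ := mem_monicsOfDegree.mp hg
      rw [mem_filter, mem_monicsOfDegree, hQ.natDegree_mul hg]
      exact ⟨⟨hQ.mul hg, by lia⟩, dvd_mul_right _ _⟩
    · intro g _ g' _ h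
      exact mul_left_cancel₀ hQ.ne_zero h
    · intro f hf
      rw [mem_filter, mem_monicsOfDegree] at hf
      obtain ⟨⟨hf, hfn⟩, g, rfl⟩ := hf
      have hg := hQ.of_mul_monic_left hf
      rw [hQ.natDegree_mul hg] at hfn
      exact ⟨g, mem_monicsOfDegree.mpr ⟨hg, by lia⟩, rfl⟩
    · intro g hg
      rw [hw Q g hQ (mem_monicsOfDegree.mp hg).1]
  · refine sum_eq_zero fun f hf ↦ ?_
    rw [mem_filter, mem_monicsOfDegree] at hf
    obtain ⟨⟨hf, rfl⟩, hd⟩ := hf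
    exact absurd (natDegree_le_of_dvd hd hf.ne_zero) h

/-- The Euler product of a completely multiplicative weight, in logarithmic form. -/
lemma nat_mul_monicSum {w : F[X] → ℂ} (hw1 : w 1 = 1)
    (hw : ∀ f g : F[X], f.Monic → g.Monic → w (f * g) = w f * w g) (n : ℕ) :
    n * monicSum w n = ∑ k ∈ Icc 1 n, primePowerSum w k * monicSum w (n - k) := by
  classical
  have hpow {P : F[X]} (hP : P.Monic) (j : ℕ) : w (P ^ j) = w P ^ j := by
    induction j with
    | zero => simp [hw1]
    | succ j ih => rw [pow_succ, pow_succ, hw _ _ (hP.pow j) hP, ih]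
  have hL : (n : ℂ) * monicSum w n = ∑ d ∈ Icc 1 n, ∑ P ∈ monicIrreduciblesOfDegree F d,
      ∑ j ∈ Icc 1 n, d * ∑ f ∈ monicsOfDegree F n, if P ^ j ∣ f then w f else 0 := by
    simp_rw [monicSum, mul_sum]
    rw [sum_congr rfl fun d _ ↦ sum_congr rfl fun P _ ↦ sum_comm,
      sum_congr rfl fun d _ ↦ sum_comm, sum_comm]
    refine sum_congr rfl fun f hf ↦ ?_
    obtain ⟨hf, hfn⟩ := mem_monicsOfDegree.mp hf
    have h := natDegree_eq_sum_monicIrreducibles hf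
    rw [hfn] at h
    conv_lhs => rw [h]
    push_cast
    simp_rw [sum_mul]
    refine sum_congr rfl fun d _ ↦ sum_congr rfl fun P _ ↦ sum_congr rfl fun j _ ↦ ?_
    split_ifs <;> simp
  have hR : ∑ k ∈ Icc 1 n, primePowerSum w k * monicSum w (n - k) =
      ∑ k ∈ Icc 1 n, ∑ d ∈ k.divisors, (∑ P ∈ monicIrreduciblesOfDegree F d,
        d * w P ^ (k / d)) * monicSum w (n - d * (k / d)) := by
    refine sum_congr rfl fun k _ ↦ ?_
    rw [primePowerSum, sum_mul]
    refine sum_congr rfl fun d hd ↦ ?_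
    rw [Nat.mul_div_cancel' (Nat.dvd_of_mem_divisors hd)]
  rw [hL, hR, sum_Icc_sum_divisors fun d j ↦ (∑ P ∈ monicIrreduciblesOfDegree F d,
        d * w P ^ j) * monicSum w (n - d * j)]
  refine sum_congr rfl fun d _ ↦ ?_
  rw [sum_comm]
  refine sum_congr rfl fun j _ ↦ ?_
  rw [sum_mul, ite_sum_zero]
  refine sum_congr rfl fun P hP ↦ ?_
  obtain ⟨⟨hm, rfl⟩, -⟩ := mem_monicIrreduciblesOfDegree.mp hP
  rw [sum_monicsOfDegree_filter_dvd hw (hm.pow j), natDegree_pow, hpow hm, mul_comm j]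
  split_ifs <;> ring

end MonicSums

section CharWeight

variable {F : Type*} [Field F]

/-- The weight `χ (∏ α) * ψ (∑ α ^ m)` of a polynomial with roots `α`. -/
noncomputable def charWeight (χ : MulChar F ℂ) (ψ : AddChar F ℂ) (m : ℕ) (f : F[X]) : ℂ :=
  χ ((-1) ^ f.natDegree * f.coeff 0) * ψ (rootPowerSum m f)

lemma charWeight_one (χ : MulChar F ℂ) (ψ : AddChar F ℂ) (m : ℕ) : charWeight χ ψ m 1 = 1 := by
  simp [charWeight, rootPowerSum_one]

lemma charWeight_mul (χ : MulChar F ℂ) (ψ : AddChar F ℂ) (m : ℕ) (f g : F[X]) (hf : f.Monic)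
    (hg : g.Monic) : charWeight χ ψ m (f * g) = charWeight χ ψ m f * charWeight χ ψ m g := by
  rw [charWeight, charWeight, charWeight, hf.natDegree_mul hg, mul_coeff_zero,
    rootPowerSum_mul m hf hg, AddChar.map_add_eq_mul, pow_add, mul_mul_mul_comm, map_mul,
    mul_mul_mul_comm]

end CharWeight

section NormTrace

open IntermediateField Module

variable {F E : Type*} [Field F] [Field E] [Algebra F E]

lemma norm_eq_coeff_zero_minpoly_pow [FiniteDimensional F E] (x : E) :
    Algebra.norm F x = ((-1) ^ (minpoly F x).natDegree * (minpoly F x).coeff 0) ^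
      (finrank F E / (minpoly F x).natDegree) := by
  have hx : IsIntegral F x := .of_finite F x
  have h := Algebra.PowerBasis.norm_gen_eq_coeff_zero_minpoly (adjoin.powerBasis hx)
  rw [← PowerBasis.natDegree_minpoly, adjoin.powerBasis_gen, minpoly_gen] at h
  rw [Algebra.norm_eq_norm_adjoin, h, ← adjoin.finrank hx, ← finrank_mul_finrank F F⟮x⟯ E,
    Nat.mul_div_cancel_left _ finrank_pos]

lemma trace_pow_eq_rootPowerSum_minpoly [FiniteDimensional F E] [Algebra.IsSeparable F E]
    {m : ℕ} (hm : m ≠ 0) (x : E) :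
    Algebra.trace F E (x ^ m) =
      (finrank F E / (minpoly F x).natDegree : ℕ) * rootPowerSum m (minpoly F x) := by
  classical
  have hx : IsIntegral F x := .of_finite F x
  have hgen : Algebra.trace F F⟮x⟯ (AdjoinSimple.gen F x ^ m) = rootPowerSum m (minpoly F x) := by
    apply (algebraMap F (AlgebraicClosure F)).injective
    let pb := adjoin.powerBasis hx
    have hpb : minpoly F pb.gen = minpoly F x := by rw [adjoin.powerBasis_gen, minpoly_gen]
    have hmon : (minpoly F pb.gen).Monic := minpoly.monic pb.isIntegral_gen
    have hsep : (minpoly F pb.gen).Separable := by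
      rw [hpb]; exact Algebra.IsSeparable.isSeparable F x
    have hsplit : (minpoly F pb.gen).map (algebraMap F (AlgebraicClosure F)) =
        (((minpoly F pb.gen).aroots (AlgebraicClosure F)).map (X - C ·)).prod :=
      (IsAlgClosed.splits _).eq_prod_roots_of_monic (hmon.map _)
    rw [trace_eq_sum_embeddings (AlgebraicClosure F), ← hpb, ← rootPowerSum_map _ _ hmon, hsplit,
      rootPowerSum_multiset_prod hm, ← adjoin.powerBasis_gen hx]
    change ∑ σ : F⟮x⟯ →ₐ[F] AlgebraicClosure F, σ (pb.gen ^ m) = _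
    rw [Fintype.sum_equiv pb.liftEquiv' _ (fun y ↦ (y : AlgebraicClosure F) ^ m) fun σ ↦ by
        rw [PowerBasis.liftEquiv'_apply_coe, map_pow],
      Finset.sum_mem_multiset _ _ (· ^ m) fun _ ↦ rfl,
      Finset.sum_eq_multiset_sum, Multiset.toFinset_val,
      Multiset.dedup_eq_self.mpr (nodup_roots ((separable_map _).mpr hsep))]
  have hxm : x ^ m = algebraMap F⟮x⟯ E (AdjoinSimple.gen F x ^ m) := by
    rw [map_pow, AdjoinSimple.algebraMap_gen]
  rw [← Algebra.trace_trace (S := F⟮x⟯), hxm, Algebra.trace_algebraMap,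
    LinearMap.map_smul_of_tower, hgen, nsmul_eq_mul, ← adjoin.finrank hx,
    ← finrank_mul_finrank F F⟮x⟯ E, Nat.mul_div_cancel_left _ finrank_pos]

lemma charWeight_minpoly_pow [FiniteDimensional F E] [Algebra.IsSeparable F E]
    (χ : MulChar F ℂ) (ψ : AddChar F ℂ) {m : ℕ} (hm : m ≠ 0) (x : E) :
    charWeight χ ψ m (minpoly F x) ^ (finrank F E / (minpoly F x).natDegree) =
      χ (Algebra.norm F x) * ψ (Algebra.trace F E (x ^ m)) := by
  rw [norm_eq_coeff_zero_minpoly_pow, trace_pow_eq_rootPowerSum_minpoly hm, charWeight, mul_pow,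
    ← map_pow, ← AddChar.map_nsmul_eq_pow, nsmul_eq_mul]

variable [Fintype E]

open Classical in
lemma card_filter_minpoly_eq [Finite F] {P : F[X]} (hP : Irreducible P) (hm : P.Monic)
    (hd : P.natDegree ∣ finrank F E) :
    #{x : E | minpoly F x = P} = P.natDegree := by
  have := Fintype.ofFinite F
  have hsplits : (P.map (algebraMap F E)).Splits := by
    have hdvd := hP.natDegree_dvd_iff_dvd_X_pow_card_pow_sub_X.mp hd
    refine Splits.of_dvd ?_ ?_ (Polynomial.map_dvd (algebraMap F E) hdvd)
    · have := FiniteField.isSplittingField_sub E F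
      rw [← Module.natCard_eq_pow_finrank, ← Fintype.card_eq_nat_card]
      exact IsSplittingField.splits E _
    · exact map_ne_zero (FiniteField.X_pow_card_pow_sub_X_ne_zero _ finrank_pos.ne'
        Finite.one_lt_card)
  rw [← card_rootSet_eq_natDegree (PerfectField.separable_of_irreducible hP) hsplits,
    ← Set.toFinset_card]
  congr 1
  ext x
  rw [mem_filter, Set.mem_toFinset, mem_rootSet]
  constructor
  · rintro ⟨-, rfl⟩
    exact ⟨hm.ne_zero, minpoly.aeval F x⟩
  · rintro ⟨-, h⟩
    exact ⟨mem_univ _, (minpoly.eq_of_irreducible_of_monic hP h hm).symm⟩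

/-- Prime power sums as sums over the extension of degree `finrank F E`. -/
lemma primePowerSum_finrank [Finite F] (w : F[X] → ℂ) :
    primePowerSum w (finrank F E) =
      ∑ x : E, w (minpoly F x) ^ (finrank F E / (minpoly F x).natDegree) := by
  classical
  rw [primePowerSum, sum_sigma']
  have hmaps (x : E) (_ : x ∈ univ) : (⟨(minpoly F x).natDegree, minpoly F x⟩ : Σ _ : ℕ, F[X]) ∈
      (finrank F E).divisors.sigma fun d ↦ monicIrreduciblesOfDegree F d := by
    rw [mem_sigma, Nat.mem_divisors, mem_monicIrreduciblesOfDegree]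
    have hx : IsIntegral F x := .of_finite F x
    exact ⟨⟨minpoly.degree_dvd hx, finrank_pos.ne'⟩, ⟨minpoly.monic hx, rfl⟩,
      minpoly.irreducible hx⟩
  rw [← sum_fiberwise_of_maps_to hmaps]
  refine sum_congr rfl ?_
  rintro ⟨d, P⟩ h
  rw [mem_sigma, Nat.mem_divisors, mem_monicIrreduciblesOfDegree] at h
  obtain ⟨⟨hd, -⟩, ⟨hm, hPd⟩, hP⟩ := h
  dsimp only at hd hm hPd hP ⊢
  subst hPd
  have hfilter : (univ.filter fun x : E ↦
      (⟨(minpoly F x).natDegree, minpoly F x⟩ : Σ _ : ℕ, F[X]) = ⟨P.natDegree, P⟩) =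
      univ.filter fun x : E ↦ minpoly F x = P := by
    refine filter_congr fun x _ ↦ ?_
    constructor
    · intro h
      simp only [Sigma.mk.injEq] at h
      exact eq_of_heq h.2
    · rintro rfl; rfl
  rw [hfilter, sum_congr rfl fun x hx ↦ by rw [(mem_filter.mp hx).2], sum_const,
    card_filter_minpoly_eq hP hm hd, nsmul_eq_mul]

end NormTrace

section PowerFibers

variable {G : Type*} [CommGroup G] [IsCyclic G] [Finite G]

lemma IsCyclic.card_pow_eq_one_of_dvd {N : ℕ} (hN : N ∣ Nat.card G) :
    Nat.card {u : G // u ^ N = 1} = N :=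
  (IsCyclic.card_powMonoidHom_ker G N).trans (Nat.gcd_eq_right hN)

lemma IsCyclic.exists_pow_eq_iff {N : ℕ} (hN : N ∣ Nat.card G) (t : G) :
    (∃ u, u ^ N = t) ↔ t ^ (Nat.card G / N) = 1 := by
  have hle : (powMonoidHom N : G →* G).range ≤ (powMonoidHom (Nat.card G / N) : G →* G).ker := by
    rintro _ ⟨u, rfl⟩
    rw [MonoidHom.mem_ker, powMonoidHom_apply, powMonoidHom_apply, ← pow_mul,
      Nat.mul_div_cancel' hN, pow_card_eq_one']
  have heq := Subgroup.eq_of_le_of_card_ge hle (by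
    rw [IsCyclic.card_powMonoidHom_ker, IsCyclic.card_powMonoidHom_range, Nat.gcd_eq_right hN,
      Nat.gcd_eq_right (Nat.div_dvd_of_dvd hN)])
  simpa using SetLike.ext_iff.mp heq t

lemma IsCyclic.card_pow_eq {N : ℕ} (hN : N ∣ Nat.card G) (t : G)
    [Decidable (t ^ (Nat.card G / N) = 1)] :
    Nat.card {u : G // u ^ N = t} = if t ^ (Nat.card G / N) = 1 then N else 0 := by
  split_ifs with h
  · obtain ⟨z, rfl⟩ := (IsCyclic.exists_pow_eq_iff hN t).mpr h
    refine Eq.trans ?_ (IsCyclic.card_pow_eq_one_of_dvd hN)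
    refine Nat.card_congr ((Equiv.mulRight z⁻¹).subtypeEquiv fun u ↦ ?_)
    rw [Equiv.coe_mulRight, mul_pow, inv_pow, mul_inv_eq_one]
  · have : IsEmpty {u : G // u ^ N = t} :=
      ⟨fun u ↦ h ((IsCyclic.exists_pow_eq_iff hN t).mp ⟨u, u.2⟩)⟩
    exact Nat.card_of_isEmpty

end PowerFibers

section TorsionChars

variable {F : Type*} [Field F] [Finite F]

lemma MulChar.finite_pow_eq_one (N : ℕ) : {ρ : MulChar F ℂ | ρ ^ N = 1}.Finite :=
  Set.toFinite _

variable (F) in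
/-- The finite set of multiplicative characters `ρ` with `ρ ^ N = 1`. -/
noncomputable def torsionMulChars (N : ℕ) : Finset (MulChar F ℂ) :=
  (MulChar.finite_pow_eq_one N).toFinset

lemma mem_torsionMulChars {N : ℕ} {ρ : MulChar F ℂ} : ρ ∈ torsionMulChars F N ↔ ρ ^ N = 1 := by
  simp [torsionMulChars]

lemma card_torsionMulChars {N : ℕ} (hN : N ∣ Nat.card Fˣ) : #(torsionMulChars F N) = N := by
  obtain ⟨e⟩ := MulChar.mulEquiv_units F ℂ
  refine Eq.trans ?_ (IsCyclic.card_pow_eq_one_of_dvd hN)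
  rw [torsionMulChars,
    ← Set.ncard_eq_toFinset_card _ (MulChar.finite_pow_eq_one N), ← Nat.card_coe_set_eq]
  refine Nat.card_congr (e.toEquiv.subtypeEquiv fun ρ ↦ ?_)
  rw [Set.mem_ofPred_eq, MulEquiv.toEquiv_eq_coe, MulEquiv.coe_toEquiv, ← map_pow,
    MulEquiv.map_eq_one_iff]

lemma sum_torsionMulChars {N : ℕ} (hN : N ∣ Nat.card Fˣ) (y : Fˣ)
    [Decidable (y ^ (Nat.card Fˣ / N) = 1)] :
    ∑ ρ ∈ torsionMulChars F N, ρ y = if y ^ (Nat.card Fˣ / N) = 1 then (N : ℂ) else 0 := by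
  split_ifs with h
  · obtain ⟨z, rfl⟩ := (IsCyclic.exists_pow_eq_iff hN y).mpr h
    have hρ (ρ) (h : ρ ∈ torsionMulChars F N) : ρ ((z ^ N : Fˣ) : F) = 1 := by
      rw [Units.val_pow_eq_pow_val, map_pow, ← MulChar.pow_apply_coe, mem_torsionMulChars.mp h,
        MulChar.one_apply_coe]
    rw [sum_congr rfl hρ, sum_const, card_torsionMulChars hN, nsmul_eq_mul, mul_one]
  · have hne : ((y ^ (Nat.card Fˣ / N) : Fˣ) : F) ≠ 1 := by
      simpa [← Units.val_pow_eq_pow_val] using h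
    obtain ⟨χ, hχ⟩ := MulChar.exists_apply_ne_one_of_hasEnoughRootsOfUnity F ℂ hne
    set σ := χ ^ (Nat.card Fˣ / N) with hσ
    have hσy : σ y ≠ 1 := by
      rwa [hσ, MulChar.pow_apply_coe, ← map_pow, ← Units.val_pow_eq_pow_val]
    have hσN : σ ^ N = 1 := by
      ext u
      rw [hσ, ← pow_mul, Nat.div_mul_cancel hN, MulChar.pow_apply_coe, ← map_pow,
        ← Units.val_pow_eq_pow_val, pow_card_eq_one', Units.val_one, map_one, MulChar.one_apply_coe]
    have hinv : σ y * ∑ ρ ∈ torsionMulChars F N, ρ y = ∑ ρ ∈ torsionMulChars F N, ρ y := by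
      rw [mul_sum]
      refine sum_bij' (fun ρ _ ↦ σ * ρ) (fun ρ _ ↦ σ⁻¹ * ρ) ?_ ?_ ?_ ?_ ?_
      · intro ρ hρ
        rw [mem_torsionMulChars] at hρ ⊢
        rw [mul_pow, hσN, hρ, one_mul]
      · intro ρ hρ
        rw [mem_torsionMulChars] at hρ ⊢
        rw [mul_pow, inv_pow, hσN, hρ, inv_one, one_mul]
      · simp
      · simp
      · intro ρ _
        rw [MulChar.mul_apply]
    by_contra h0
    exact hσy ((mul_eq_right₀ h0).mp hinv)

end TorsionChars

section PowerPullback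

open Module

variable {F E : Type*} [Field F] [Field E] [Fintype E] [Algebra F E]

lemma norm_pow_eq_one_iff {N : ℕ} (hN : N ∣ Nat.card Fˣ) (t : Eˣ) :
    Units.map (Algebra.norm F) t ^ (Nat.card Fˣ / N) = 1 ↔ t ^ (Nat.card Eˣ / N) = 1 := by
  have hdvd : Nat.card F - 1 ∣ Nat.card E - 1 := by
    rw [Module.natCard_eq_pow_finrank (K := F) (V := E)]
    simpa using Nat.sub_dvd_pow_sub_pow (Nat.card F) 1 (finrank F E)
  rw [Nat.card_units] at hN
  have hexp : (Nat.card E - 1) / (Nat.card F - 1) * ((Nat.card F - 1) / N) =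
      (Nat.card E - 1) / N := by
    rw [← Nat.mul_div_assoc _ hN, Nat.div_mul_cancel hdvd]
  rw [Nat.card_units, Nat.card_units, Units.ext_iff, Units.ext_iff,
    ← (algebraMap F E).injective.eq_iff, Units.val_pow_eq_pow_val, Units.val_pow_eq_pow_val,
    map_pow, Units.coe_map, FiniteField.algebraMap_norm_eq_pow, ← pow_mul, hexp,
    Units.val_one, map_one, Units.val_one]

variable [Finite F]

open Classical in
lemma card_filter_pow_eq {N : ℕ} (hN0 : N ≠ 0) (hN : N ∣ Nat.card Fˣ) {t : E} (ht : t ≠ 0) :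
    (#{x : E | x ^ N = t} : ℂ) = ∑ ρ ∈ torsionMulChars F N, ρ (Algebra.norm F t) := by
  have hdvd : Nat.card Fˣ ∣ Nat.card Eˣ := by
    rw [Nat.card_units, Nat.card_units, Module.natCard_eq_pow_finrank (K := F) (V := E)]
    simpa using Nat.sub_dvd_pow_sub_pow (Nat.card F) 1 (finrank F E)
  lift t to Eˣ using ht.isUnit
  have h := sum_torsionMulChars hN (Units.map (Algebra.norm F) t)
  rw [Units.coe_map] at h
  rw [h, if_congr (norm_pow_eq_one_iff hN t) rfl rfl]
  have hcard := IsCyclic.card_pow_eq (hN.trans hdvd) t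
  have : #{x : E | x ^ N = t} = Nat.card {u : Eˣ // u ^ N = t} := by
    rw [← Fintype.card_subtype, ← Nat.card_eq_fintype_card]
    refine (Nat.card_congr (Equiv.ofBijective
      (fun u : {u : Eˣ // u ^ N = t} ↦ (⟨u.1, ?_⟩ : {x : E // x ^ N = t})) ⟨?_, ?_⟩)).symm
    · rw [← Units.val_pow_eq_pow_val, u.2]
    · intro u v h
      exact Subtype.ext (Units.ext (congrArg Subtype.val h))
    · rintro ⟨x, hx⟩
      have hu : IsUnit x := (isUnit_pow_iff hN0).mp (hx ▸ t.isUnit)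
      exact ⟨⟨hu.unit, Units.ext (by rw [Units.val_pow_eq_pow_val, hu.unit_spec, hx])⟩, rfl⟩
  rw [this, hcard]
  split_ifs <;> simp

lemma primePowerSum_charWeight_pow {N : ℕ} (hN0 : N ≠ 0) (hN : N ∣ Nat.card Fˣ)
    (χ : MulChar F ℂ) (ψ : AddChar F ℂ) :
    primePowerSum (charWeight (χ ^ N) ψ N) (finrank F E) =
      ∑ ρ ∈ torsionMulChars F N, primePowerSum (charWeight (χ * ρ) ψ 1) (finrank F E) := by
  classical
  simp_rw [primePowerSum_finrank, charWeight_minpoly_pow _ ψ hN0,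
    charWeight_minpoly_pow _ ψ one_ne_zero, pow_one]
  rw [sum_comm]
  have hpow (x : E) : (χ ^ N) (Algebra.norm F x) = χ (Algebra.norm F (x ^ N)) := by
    rw [MulChar.pow_apply' χ hN0, ← map_pow, ← map_pow]
  simp_rw [hpow, MulChar.mul_apply]
  rw [← sum_fiberwise_of_maps_to (g := fun x : E ↦ x ^ N) fun x _ ↦ mem_univ _]
  refine sum_congr rfl fun t _ ↦ ?_
  rw [sum_congr rfl fun x hx ↦ by rw [(mem_filter.mp hx).2], sum_const, nsmul_eq_mul]
  rcases eq_or_ne t 0 with rfl | ht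
  · rw [Algebra.norm_zero, MulChar.map_zero]
    simp only [zero_mul, mul_zero, sum_const_zero]
  · rw [card_filter_pow_eq hN0 hN ht, sum_mul]
    refine sum_congr rfl fun ρ _ ↦ ?_
    ring

end PowerPullback

section ShiftSums

variable {F : Type*} [Field F] [Finite F]

lemma add_mem_monicsOfDegree {n : ℕ} {f g : F[X]} (hf : f ∈ monicsOfDegree F n)
    (hg : g.degree < n) : f + g ∈ monicsOfDegree F n := by
  obtain ⟨hm, rfl⟩ := mem_monicsOfDegree.mp hf
  rw [← degree_eq_natDegree hm.ne_zero] at hg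
  exact mem_monicsOfDegree.mpr ⟨hm.add_of_left hg, natDegree_add_eq_left_of_degree_lt hg⟩

lemma sum_monicsOfDegree_add {n : ℕ} {g : F[X]} (hg : g.degree < n) (w : F[X] → ℂ) :
    ∑ f ∈ monicsOfDegree F n, w (f + g) = ∑ f ∈ monicsOfDegree F n, w f :=
  sum_bij' (fun f _ ↦ f + g) (fun f _ ↦ f + -g) (fun _ hf ↦ add_mem_monicsOfDegree hf hg)
    (fun _ hf ↦ add_mem_monicsOfDegree hf (by rwa [degree_neg])) (by simp) (by simp)
    (fun _ _ ↦ rfl)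

open Classical in
/-- The sum of `ψ (∑ α ^ n)` over the monic polynomials of degree `n` with zero constant
coefficient. -/
noncomputable def powerSumFactor (ψ : AddChar F ℂ) (n : ℕ) : ℂ :=
  ∑ f ∈ monicsOfDegree F n with f.coeff 0 = 0, ψ (rootPowerSum n f)

lemma powerSumFactor_one (ψ : AddChar F ℂ) : powerSumFactor ψ 1 = 1 := by
  classical
  have h : {f ∈ monicsOfDegree F 1 | f.coeff 0 = 0} = {X} := by
    ext f
    rw [mem_filter, mem_monicsOfDegree, mem_singleton]
    constructor
    · rintro ⟨⟨hm, hd⟩, h0⟩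
      rw [hm.eq_X_add_C hd, h0, C_0, add_zero]
    · rintro rfl
      exact ⟨⟨monic_X, natDegree_X⟩, coeff_X_zero⟩
  rw [powerSumFactor, h, sum_singleton, rootPowerSum_one_eq monic_X (n := 0) natDegree_X,
    coeff_X_zero, neg_zero, AddChar.map_zero_eq_one]

lemma monicSum_charWeight_one_zero (χ : MulChar F ℂ) (ψ : AddChar F ℂ) (m : ℕ) :
    monicSum (charWeight χ ψ m) 0 = 1 := by
  rw [monicSum, monicsOfDegree_zero, sum_singleton, charWeight_one]

lemma monicSum_charWeight_one_of_two_le (χ : MulChar F ℂ) {ψ : AddChar F ℂ} (hψ : ψ ≠ 1) {n : ℕ}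
    (hn : 2 ≤ n) : monicSum (charWeight χ ψ 1) n = 0 := by
  obtain ⟨b, hb⟩ := AddChar.ne_one_iff.mp hψ
  obtain ⟨k, rfl⟩ : ∃ k, n = k + 2 := ⟨n - 2, by lia⟩
  have hdeg : (C (-b) * X ^ (k + 1) : F[X]).degree < (k + 2 : ℕ) :=
    (degree_C_mul_X_pow_le _ _).trans_lt (by exact_mod_cast Nat.lt_succ_self (k + 1))
  have h := sum_monicsOfDegree_add hdeg (charWeight χ ψ 1)
  have hw (f : F[X]) (hf : f ∈ monicsOfDegree F (k + 2)) :
      charWeight χ ψ 1 (f + C (-b) * X ^ (k + 1)) = ψ b * charWeight χ ψ 1 f := by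
    obtain ⟨hm', hd'⟩ := mem_monicsOfDegree.mp (add_mem_monicsOfDegree hf hdeg)
    obtain ⟨hm, hd⟩ := mem_monicsOfDegree.mp hf
    rw [charWeight, charWeight, rootPowerSum_one_eq hm' hd', rootPowerSum_one_eq hm hd, hd', hd,
      coeff_add, coeff_add, coeff_C_mul_X_pow, coeff_C_mul_X_pow, if_neg (by lia), if_pos rfl,
      neg_add, neg_neg, AddChar.map_add_eq_mul, add_zero]
    ring
  rw [sum_congr rfl hw, ← mul_sum] at h
  by_contra h0
  exact hb ((mul_eq_right₀ h0).mp h)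

variable [Fintype F]

lemma monicSum_charWeight_self (χ : MulChar F ℂ) (ψ : AddChar F ℂ) {n : ℕ}
    (hn : n ≠ 0) : monicSum (charWeight χ ψ n) n =
      χ ((-1) ^ (n + 1)) * (∑ b, χ b * ψ (n * b)) * powerSumFactor ψ n := by
  classical
  rw [monicSum, ← sum_fiberwise_of_maps_to (g := fun f : F[X] ↦ f.coeff 0) fun f _ ↦ mem_univ _,
    mul_sum, sum_mul, ← Equiv.sum_comp (Equiv.neg F)]
  refine sum_congr rfl fun b _ ↦ ?_
  rw [powerSumFactor, mul_sum]
  have hC (c : F) : (C c).degree < n :=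
    degree_C_le.trans_lt (by exact_mod_cast Nat.pos_of_ne_zero hn)
  symm
  refine sum_bij' (fun f _ ↦ f + C (-b)) (fun f _ ↦ f + C b) ?_ ?_ ?_ ?_ ?_
  · intro f hf
    rw [mem_filter] at hf ⊢
    exact ⟨add_mem_monicsOfDegree hf.1 (hC _), by simp [hf.2]⟩
  · intro f hf
    rw [mem_filter] at hf ⊢
    exact ⟨add_mem_monicsOfDegree hf.1 (hC _), by simp [hf.2]⟩
  · simp
  · simp
  · intro f hf
    rw [mem_filter] at hf
    obtain ⟨hm, hd⟩ := mem_monicsOfDegree.mp hf.1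
    rw [charWeight, rootPowerSum_add_C hm hn hd, natDegree_add_C, hd, coeff_add, hf.2, coeff_C_zero,
      mul_neg, sub_neg_eq_add, AddChar.map_add_eq_mul, zero_add,
      (by ring : (-1) ^ n * -b = (-1) ^ (n + 1) * b), map_mul χ]
    ring

lemma monicSum_charWeight_one_one (χ : MulChar F ℂ) (ψ : AddChar F ℂ) :
    monicSum (charWeight χ ψ 1) 1 = gaussSum χ ψ := by
  rw [monicSum_charWeight_self χ ψ one_ne_zero, powerSumFactor_one, gaussSum]
  simp

end ShiftSums

section GeneratingSeries

variable {F : Type*} [Field F] [Finite F]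

lemma PowerSeries.eq_zero_of_X_mul_derivative_eq {S A : PowerSeries ℂ}
    (hS : PowerSeries.constantCoeff S = 0) (hA : PowerSeries.constantCoeff A = 0)
    (h : PowerSeries.X * PowerSeries.derivative (R := ℂ) A = S * A) : A = 0 := by
  ext n
  rw [map_zero]
  induction n using Nat.strong_induction_on with
  | _ n ih =>
    rcases n with _ | n
    · simpa using hA
    have hc := congrArg (PowerSeries.coeff (n + 1)) h
    rw [PowerSeries.coeff_succ_X_mul, PowerSeries.coeff_derivative, PowerSeries.coeff_mul,
      sum_eq_zero] at hc
    · exact (mul_eq_zero.mp hc).resolve_right (by exact_mod_cast n.succ_ne_zero)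
    · rintro ⟨i, j⟩ hij
      rw [HasAntidiagonal.mem_antidiagonal] at hij
      rcases Nat.eq_zero_or_pos i with rfl | hi
      · simp [hS]
      · rw [ih j (by lia), mul_zero]

/-- The generating series of the sums of a weight over monic polynomials. -/
noncomputable def monicSeries (w : F[X] → ℂ) : PowerSeries ℂ := PowerSeries.mk (monicSum w)

lemma X_mul_derivative_monicSeries {w : F[X] → ℂ} (hw1 : w 1 = 1)
    (hw : ∀ f g : F[X], f.Monic → g.Monic → w (f * g) = w f * w g) :
    PowerSeries.X * PowerSeries.derivative (R := ℂ) (monicSeries w) =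
      PowerSeries.mk (primePowerSum w) * monicSeries w := by
  ext n
  have h := nat_mul_monicSum hw1 hw n
  have hR : PowerSeries.coeff n (PowerSeries.mk (primePowerSum w) * monicSeries w) =
      ∑ k ∈ Icc 1 n, primePowerSum w k * monicSum w (n - k) := by
    rw [PowerSeries.coeff_mul, Nat.sum_antidiagonal_eq_sum_range_succ_mk, range_eq_Ico,
      sum_eq_sum_Ico_succ_bot n.succ_pos]
    simp [monicSeries, primePowerSum, Ico_add_one_right_eq_Icc]
  rw [hR, ← h]
  rcases n with _ | n
  · simp
  · rw [PowerSeries.coeff_succ_X_mul, PowerSeries.coeff_derivative, monicSeries,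
      PowerSeries.coeff_mk]
    push_cast
    ring

lemma PowerSeries.X_mul_derivative_prod {ι : Type*} (s : Finset ι) {S A : ι → PowerSeries ℂ}
    (h : ∀ i ∈ s, PowerSeries.X * PowerSeries.derivative (R := ℂ) (A i) = S i * A i) :
    PowerSeries.X * PowerSeries.derivative (R := ℂ) (∏ i ∈ s, A i) =
      (∑ i ∈ s, S i) * ∏ i ∈ s, A i := by
  classical
  induction s using Finset.induction with
  | empty => simp
  | insert a s ha ih =>
    rw [prod_insert ha, sum_insert ha, Derivation.leibniz, smul_eq_mul, smul_eq_mul]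
    linear_combination (A a) * ih (fun i hi ↦ h i (mem_insert_of_mem hi)) +
      (∏ i ∈ s, A i) * h a (mem_insert_self _ _)

lemma FiniteField.exists_extension_finrank_eq (F : Type*) [Field F] [Finite F] {k : ℕ}
    (hk : k ≠ 0) : ∃ (E : Type) (_ : Field E) (_ : Algebra F E) (_ : Fintype E),
      Module.finrank F E = k := by
  obtain ⟨p, _⟩ := CharP.exists F
  have : Fact p.Prime := ⟨CharP.char_is_prime F p⟩
  have : NeZero k := ⟨hk⟩
  exact ⟨FiniteField.Extension F p k, inferInstance, inferInstance, Fintype.ofFinite _,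
    FiniteField.finrank_extension F p k⟩

lemma primePowerSum_charWeight_pow_eq {N : ℕ} (hN0 : N ≠ 0) (hN : N ∣ Nat.card Fˣ)
    (χ : MulChar F ℂ) (ψ : AddChar F ℂ) (k : ℕ) :
    primePowerSum (charWeight (χ ^ N) ψ N) k =
      ∑ ρ ∈ torsionMulChars F N, primePowerSum (charWeight (χ * ρ) ψ 1) k := by
  rcases eq_or_ne k 0 with rfl | hk
  · simp [primePowerSum]
  · obtain ⟨E, _, _, _, rfl⟩ := FiniteField.exists_extension_finrank_eq F hk
    exact primePowerSum_charWeight_pow hN0 hN χ ψ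

lemma monicSeries_charWeight_pow {N : ℕ} (hN0 : N ≠ 0) (hN : N ∣ Nat.card Fˣ)
    (χ : MulChar F ℂ) (ψ : AddChar F ℂ) :
    monicSeries (charWeight (χ ^ N) ψ N) =
      ∏ ρ ∈ torsionMulChars F N, monicSeries (charWeight (χ * ρ) ψ 1) := by
  have h0 (χ : MulChar F ℂ) (m : ℕ) :
      PowerSeries.constantCoeff (monicSeries (charWeight χ ψ m)) = 1 := by
    rw [← PowerSeries.coeff_zero_eq_constantCoeff_apply, monicSeries, PowerSeries.coeff_mk,
      monicSum_charWeight_one_zero]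
  have h1 := X_mul_derivative_monicSeries (charWeight_one (χ ^ N) ψ N) (charWeight_mul (χ ^ N) ψ N)
  have h2 := PowerSeries.X_mul_derivative_prod (torsionMulChars F N) fun ρ _ ↦
    X_mul_derivative_monicSeries (charWeight_one (χ * ρ) ψ 1) (charWeight_mul (χ * ρ) ψ 1)
  have hS : ∑ ρ ∈ torsionMulChars F N, PowerSeries.mk (primePowerSum (charWeight (χ * ρ) ψ 1)) =
      PowerSeries.mk (primePowerSum (charWeight (χ ^ N) ψ N)) := by
    ext k
    rw [map_sum, PowerSeries.coeff_mk, primePowerSum_charWeight_pow_eq hN0 hN]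
    simp only [PowerSeries.coeff_mk]
  rw [hS] at h2
  refine sub_eq_zero.mp (PowerSeries.eq_zero_of_X_mul_derivative_eq
    (S := PowerSeries.mk (primePowerSum (charWeight (χ ^ N) ψ N))) ?_ ?_ ?_)
  · rw [← PowerSeries.coeff_zero_eq_constantCoeff_apply, PowerSeries.coeff_mk]
    simp [primePowerSum]
  · rw [map_sub, map_prod, h0, prod_congr rfl fun ρ _ ↦ h0 (χ * ρ) 1, prod_const_one, sub_self]
  · rw [map_sub, mul_sub, mul_sub, h1, h2]

lemma monicSeries_charWeight_one [Fintype F] (χ : MulChar F ℂ) {ψ : AddChar F ℂ} (hψ : ψ ≠ 1) :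
    monicSeries (charWeight χ ψ 1) = ((1 + C (gaussSum χ ψ) * X : ℂ[X]) : PowerSeries ℂ) := by
  ext n
  rw [monicSeries, PowerSeries.coeff_mk, coeff_coe]
  rcases n with _ | _ | n
  · simp [monicSum_charWeight_one_zero]
  · simp [monicSum_charWeight_one_one, coeff_one]
  · rw [monicSum_charWeight_one_of_two_le χ hψ (by lia)]
    simp [coeff_one]

/-- The Hasse–Davenport product formula up to a factor independent of `χ`. -/
lemma prod_gaussSum_eq_powerSumFactor_mul [Fintype F] {N : ℕ} (hN0 : N ≠ 0)
    (hN : N ∣ Nat.card Fˣ) (χ : MulChar F ℂ) {ψ : AddChar F ℂ} (hψ : ψ ≠ 1) :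
    ∏ ρ ∈ torsionMulChars F N, gaussSum (χ * ρ) ψ =
      powerSumFactor ψ N * ∑ b, (χ ^ N) b * ψ (N * b) := by
  have h := congrArg (PowerSeries.coeff N) (monicSeries_charWeight_pow hN0 hN χ ψ)
  have hsign : (χ ^ N) ((-1) ^ (N + 1)) = 1 := by
    rw [MulChar.pow_apply' χ hN0, ← map_pow, ← pow_mul,
      (by simpa [mul_comm] using Nat.even_mul_succ_self N : Even ((N + 1) * N)).neg_one_pow,
      map_one]
  have hdeg (ρ : MulChar F ℂ) (_ : ρ ∈ torsionMulChars F N) :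
      (1 + C (gaussSum (χ * ρ) ψ) * X : ℂ[X]).natDegree ≤ 1 := by
    compute_degree
  have hc := coeff_prod_of_natDegree_le _ _ 1 hdeg
  rw [card_torsionMulChars hN, mul_one] at hc
  have hcoe := map_prod coeToPowerSeries.ringHom
    (fun ρ ↦ 1 + C (gaussSum (χ * ρ) ψ) * X) (torsionMulChars F N)
  simp only [coeToPowerSeries.ringHom_apply] at hcoe
  rw [prod_congr rfl fun ρ _ ↦ monicSeries_charWeight_one (χ * ρ) hψ, ← hcoe, coeff_coe, hc,
    monicSeries, PowerSeries.coeff_mk, monicSum_charWeight_self _ ψ hN0, hsign, one_mul] at h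
  rw [mul_comm (powerSumFactor ψ N), h]
  refine prod_congr rfl fun ρ _ ↦ ?_
  simp [coeff_one]

end GeneratingSeries

section GaussSumNorm

variable {F : Type*} [Field F] [Fintype F]

lemma norm_gaussSum {χ : MulChar F ℂ} (hχ : χ ≠ 1) {ψ : AddChar F ℂ} (hψ : ψ ≠ 1) :
    ‖gaussSum χ ψ‖ = √(Fintype.card F) := by
  have h := gaussSum_mul_gaussSum_eq_card hχ (AddChar.IsPrimitive.of_ne_one hψ)
  rw [← star_gaussSum_eq, Complex.star_def, Complex.mul_conj'] at h
  rw [← Real.sqrt_sq (norm_nonneg (gaussSum χ ψ))]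
  congr 1
  exact_mod_cast h

lemma natCast_ne_zero_of_dvd_card_units {N : ℕ} (hN : N ∣ Nat.card Fˣ) : (N : F) ≠ 0 := by
  intro h0
  obtain ⟨m, hm⟩ := hN
  have h : ((Nat.card Fˣ + 1 : ℕ) : F) = 0 := by
    rw [Nat.card_units, Nat.sub_add_cancel Nat.card_pos, Nat.card_eq_fintype_card,
      FiniteField.cast_card_eq_zero]
  rw [hm] at h
  simp [h0] at h

lemma sum_mulChar_one_mul_addChar {ψ : AddChar F ℂ} (hψ : ψ ≠ 1) {a : F} (ha : a ≠ 0) :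
    ∑ b, (1 : MulChar F ℂ) b * ψ (a * b) = -1 := by
  have h := gaussSum_one_left (AddChar.IsPrimitive.of_ne_one hψ ha)
  simpa [gaussSum, AddChar.mulShift_apply] using h

lemma norm_powerSumFactor {N : ℕ} (hN0 : N ≠ 0) (hN : N ∣ Nat.card Fˣ) {ψ : AddChar F ℂ}
    (hψ : ψ ≠ 1) : ‖powerSumFactor ψ N‖ = √(Fintype.card F) ^ (N - 1) := by
  classical
  have h := congrArg norm (prod_gaussSum_eq_powerSumFactor_mul hN0 hN 1 hψ)
  have h1 : (1 : MulChar F ℂ) ∈ torsionMulChars F N := mem_torsionMulChars.mpr (one_pow N)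
  have hne (ρ) (hρ : ρ ∈ (torsionMulChars F N).erase 1) :
      ‖gaussSum (1 * ρ) ψ‖ = √(Fintype.card F) := by
    rw [one_mul, norm_gaussSum (ne_of_mem_erase hρ) hψ]
  rw [one_pow, sum_mulChar_one_mul_addChar hψ (natCast_ne_zero_of_dvd_card_units hN), norm_prod,
    ← mul_prod_erase _ _ h1, prod_congr rfl hne, prod_const, card_erase_of_mem h1,
    card_torsionMulChars hN, one_mul, gaussSum_one_left hψ] at h
  simpa using h.symm

lemma sum_units_eq_sum {f : F → ℂ} (hf : f 0 = 0) [DecidableEq F] :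
    ∑ x : Fˣ, f x = ∑ x, f x :=
  Fintype.sum_of_injective Units.val Units.val_injective _ _
    (fun x hx ↦ by
      by_contra h0
      exact hx ⟨Units.mk0 x fun h ↦ h0 (h ▸ hf), rfl⟩) fun _ ↦ rfl

lemma normGaussSum_eq [DecidableEq F] (ψ : AddChar F ℂ) (χ : MulChar F ℂ) :
    normGaussSum F ψ χ = (√(Fintype.card F) : ℂ)⁻¹ * gaussSum χ ψ := by
  rw [normGaussSum, sum_units_eq_sum (f := fun x ↦ ψ x * χ x) (by simp [MulChar.map_zero]),
    gaussSum]
  simp_rw [mul_comm (ψ _)]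

end GaussSumNorm

end HasseDavenport

/-- **Hasse–Davenport relation.** For a finite field `F`, a nontrivial additive
character `ψ` of `F` and a positive integer `N` dividing `#F − 1`, there is a complex number
`ε_N(ψ)` of absolute value `1` such that for every multiplicative character `χ` of `F^×`:
`−ε(ψ_N, χ^N) = ε_N(ψ) · ∏_{ρ^N = 1} ε(ψ, χρ)`, where `ψ_N(x) = ψ(N·x)`. -/
theorem hasse_davenport_relation (F : Type*) [Field F] [Fintype F] [DecidableEq F]
    (ψ : AddChar F ℂ) (hψ : ∃ x : F, ψ x ≠ 1)
    (N : ℕ) (hN : 0 < N) (hNdvd : N ∣ Fintype.card F - 1) :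
    ∃ c : ℂ, ‖c‖ = 1 ∧ ∀ χ : MulChar F ℂ,
      -((Real.sqrt (Fintype.card F) : ℂ)⁻¹ *
          ∑ x : Fˣ, ψ ((N : F) * (x : F)) * (χ ^ N) (x : F)) =
        c * ∏ᶠ (ρ : MulChar F ℂ) (_ : ρ ^ N = 1), normGaussSum F ψ (χ * ρ) := by
  classical
  have hψ1 : ψ ≠ 1 := AddChar.ne_one_iff.mpr hψ
  have hN' : N ∣ Nat.card Fˣ := by rwa [Nat.card_units, Nat.card_eq_fintype_card]
  have hs : (√(Fintype.card F) : ℂ) ≠ 0 := by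
    exact_mod_cast (Real.sqrt_pos.mpr (Nat.cast_pos.mpr Fintype.card_pos)).ne'
  have hD := norm_powerSumFactor hN.ne' hN' hψ1
  have hD0 : powerSumFactor ψ N ≠ 0 := by
    rw [← norm_ne_zero_iff, hD]
    exact pow_ne_zero _ (by exact_mod_cast hs)
  refine ⟨-(√(Fintype.card F) : ℂ) ^ (N - 1) / powerSumFactor ψ N, ?_, fun χ ↦ ?_⟩
  · rw [norm_div, norm_neg, norm_pow, Complex.norm_real, Real.norm_of_nonneg (Real.sqrt_nonneg _),
      hD, div_self]
    rw [← hD]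
    exact norm_ne_zero_iff.mpr hD0
  · have hprod : ∏ᶠ (ρ : MulChar F ℂ) (_ : ρ ^ N = 1), normGaussSum F ψ (χ * ρ) =
        ∏ ρ ∈ torsionMulChars F N, normGaussSum F ψ (χ * ρ) :=
      finprod_mem_eq_finite_toFinset_prod _ (MulChar.finite_pow_eq_one N)
    simp_rw [hprod, normGaussSum_eq]
    rw [Finset.prod_mul_distrib, prod_gaussSum_eq_powerSumFactor_mul hN.ne' hN' χ hψ1,
      Finset.prod_const, card_torsionMulChars hN',
      sum_units_eq_sum (f := fun x ↦ ψ (N * x) * (χ ^ N) x) (by simp [MulChar.map_zero])]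
    simp_rw [mul_comm (ψ _)]
    obtain ⟨M, rfl⟩ : ∃ M, N = M + 1 := ⟨N - 1, by lia⟩
    rw [Nat.add_sub_cancel, inv_pow]
    field_simp
    ring
end
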